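/- For every real number ε with 0 < ε < 1 there exists a positive integer n₀ such that the following holds: if G is a simple graph on 2n−1 ≥ n₀ vertices with minimum degree δ(G) ≥ (1+ε)n, then the chromatic index χ'(G) equals the maximum degree Δ(G) if and only if G is not overfull, i.e., if and only if |E(G)| ≤ Δ(G)·(n−1). -/

import Mathlib

namespace SimpleGraph

variable {V : Type} (G : SimpleGraph V)

/-- `c` is a proper edge coloring of `G` with `k` colors: edges of `G` sharing a vertex
receive different colors. -/
def IsProperEdgeColoring {k : ℕ} (c : Sym2 V → Fin k) : Prop :=
  ∀ e₁ ∈ G.edgeSet, ∀ e₂ ∈ G.edgeSet, e₁ ≠ e₂ → (∃ v, v ∈ e₁ ∧ v ∈ e₂) → c e₁ ≠ c e₂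

/-- The chromatic index `χ'(G)`: the least `k` admitting a proper edge `k`-coloring. -/
noncomputable def chromaticIndex : ℕ :=
  sInf {k | ∃ c : Sym2 V → Fin k, G.IsProperEdgeColoring c}

end SimpleGraph

set_option linter.unusedSectionVars false
set_option linter.unusedDecidableInType false
set_option linter.unusedFintypeInType false

namespace Overfull

open Finset Function

section Basics

variable {W : Type*} [DecidableEq W]

/-- Indicator of the edges of the matching encoded by the involution `σ`. -/
def ind (σ : W → W) (p q : W) : ℕ := if σ p = q then 1 else 0

/-- Multiplicity of the pair `p q` in a family of matchings. -/
def cnt {ι : Type*} [Fintype ι] (M : ι → W → W) (p q : W) : ℕ := ∑ i, ind (M i) p q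

/-- The multigraph with the single edge `u v`. -/
def edge (u v p q : W) : ℕ := if (p = u ∧ q = v) ∨ (p = v ∧ q = u) then 1 else 0

/-- Add the edge `u v` to a matching in which `u` and `v` are uncovered. -/
def link (σ : W → W) (u v : W) : W → W :=
  fun t => if t = u then v else if t = v then u else σ t

/-- Remove from a matching the edge at `b`. -/
def unlink (σ : W → W) (b : W) : W → W :=
  fun t => if t = b then b else if t = σ b then σ b else σ t

theorem link_involutive {σ : W → W} (h : Involutive σ) {u v : W} (hu : σ u = u) (hv : σ v = v) :
    Involutive (link σ u v) := by
  intro t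
  have := h t
  unfold link
  grind

theorem unlink_involutive {σ : W → W} (h : Involutive σ) (b : W) :
    Involutive (unlink σ b) := by
  intro t
  have := h t
  have := h b
  unfold unlink
  grind

theorem ind_link {σ : W → W} {u v : W} (hu : σ u = u) (hv : σ v = v) (huv : u ≠ v)
    {p q : W} (hpq : p ≠ q) : ind (link σ u v) p q = ind σ p q + edge u v p q := by
  unfold ind link edge
  grind

theorem ind_unlink {σ : W → W} (h : Involutive σ) {b : W}
    {p q : W} (hpq : p ≠ q) : ind (unlink σ b) p q + edge b (σ b) p q = ind σ p q := by
  have := h b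
  have := h p
  have := h q
  unfold ind unlink edge
  grind

theorem edge_symm (u v p q : W) : edge u v p q = edge u v q p := by
  unfold edge; grind

theorem edge_comm (u v p q : W) : edge u v p q = edge v u p q := by
  unfold edge; grind

theorem edge_self {u v : W} (h : u ≠ v) (p : W) : edge u v p p = 0 := by
  unfold edge; grind

theorem edge_eq_one (u v : W) : edge u v u v = 1 := by
  unfold edge; grind

theorem ind_symm {σ : W → W} (h : Involutive σ) (p q : W) : ind σ p q = ind σ q p := by
  have := h p
  have := h q
  unfold ind
  grind

variable {ι : Type*} [Fintype ι]

theorem cnt_symm {M : ι → W → W} (h : ∀ i, Involutive (M i)) (p q : W) :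
    cnt M p q = cnt M q p :=
  Finset.sum_congr rfl fun i _ => ind_symm (h i) p q

theorem cnt_eq_card (M : ι → W → W) (p q : W) : cnt M p q = #{i | M i p = q} := by
  unfold cnt ind
  rw [Finset.card_filter]

theorem cnt_update [DecidableEq ι] (M : ι → W → W) (i : ι) (σ : W → W) (p q : W) :
    cnt (update M i σ) p q + ind (M i) p q = cnt M p q + ind σ p q := by
  unfold cnt
  rw [← Finset.add_sum_erase _ _ (mem_univ i), ← Finset.add_sum_erase _ _ (mem_univ i)]
  have : ∑ j ∈ univ.erase i, ind (update M i σ j) p q = ∑ j ∈ univ.erase i, ind (M j) p q :=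
    Finset.sum_congr rfl fun j hj => by rw [update_of_ne (Finset.ne_of_mem_erase hj)]
  rw [this]
  simp
  ring

theorem update_involutive [DecidableEq ι] {M : ι → W → W} (h : ∀ i, Involutive (M i)) (i : ι)
    {σ : W → W} (hσ : Involutive σ) : ∀ j, Involutive (update M i σ j) := by
  intro j
  by_cases hj : j = i
  · subst hj; simpa using hσ
  · rw [update_of_ne hj]; exact h j

variable [Fintype W]

theorem sum_ind (σ : W → W) (p : W) : ∑ q, ind σ p q = 1 := by
  simp [ind]

theorem sum_cnt (M : ι → W → W) (p : W) : ∑ q, cnt M p q = Fintype.card ι := by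
  unfold cnt
  rw [Finset.sum_comm]
  simp [sum_ind]

theorem sum_edge {u v : W} (huv : u ≠ v) (p : W) :
    ∑ q, edge u v p q = if p = u ∨ p = v then 1 else 0 := by
  by_cases h1 : p = u
  · subst h1
    simp [edge, huv]
  · by_cases h2 : p = v
    · subst h2
      simp [edge, h1]
    · simp [edge, h1, h2]

theorem even_card_fixed {σ : W → W} (h : Involutive σ) (hW : Even (Fintype.card W)) :
    Even #{v | σ v = v} := by
  have h0 : (show Function.End W from σ) ^ 2 ^ 1 = 1 := by
    funext v
    exact h v
  have := Equiv.Perm.card_fixedPoints_modEq (p := 2) h0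
  rw [Fintype.card_subtype] at this
  have h2 : #{v | σ v = v} = #{x | x ∈ fixedPoints (show Function.End W from σ)} := by
    congr
  rw [h2]
  rw [Nat.even_iff] at hW ⊢
  unfold Nat.ModEq at this
  rw [← hW, this]
  

end Basics

section Konig

variable {W : Type*} [DecidableEq W] [Fintype W]

/-- `Factorable w d`: the multigraph `w` is the union of `d` perfect matchings. -/
inductive Factorable : (W → W → ℕ) → ℕ → Prop
  | zero : Factorable (fun _ _ => 0) 0
  | add {w : W → W → ℕ} {d : ℕ} {σ : W → W} : Factorable w d → Involutive σ →
      (∀ v, σ v ≠ v) → Factorable (fun p q => w p q + ind σ p q) (d + 1)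

theorem Factorable.add_sum {ι : Type*} {M : ι → W → W} (hM : ∀ i, Involutive (M i))
    (hM' : ∀ i v, M i v ≠ v) {w : W → W → ℕ} {d : ℕ} (hw : Factorable w d) (s : Finset ι) :
    Factorable (fun p q => w p q + ∑ i ∈ s, ind (M i) p q) (d + #s) := by
  classical
  induction s using Finset.induction_on with
  | empty => simpa using hw
  | insert i s hi ih =>
    have := ih.add (hM i) (hM' i)
    rw [Finset.card_insert_of_notMem hi, ← add_assoc]
    convert this using 3 with p q
    rw [Finset.sum_insert hi]
    ring

theorem Factorable.add_cnt {ι : Type*} [Fintype ι] {M : ι → W → W} (hM : ∀ i, Involutive (M i))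
    (hM' : ∀ i v, M i v ≠ v) {w w' : W → W → ℕ} {d : ℕ} (hw : Factorable w d)
    (h : ∀ p q, w' p q = w p q + cnt M p q) : Factorable w' (d + Fintype.card ι) := by
  have := hw.add_sum hM hM' univ
  rw [Finset.card_univ] at this
  convert this using 1
  funext p q
  exact h p q

theorem Factorable.exists_family {w : W → W → ℕ} {d : ℕ} (h : Factorable w d) :
    ∃ M : Fin d → W → W, (∀ i, Involutive (M i)) ∧ (∀ i v, M i v ≠ v) ∧
      ∀ p q, w p q = cnt M p q := by
  induction h with
  | zero => exact ⟨fun i => i.elim0, fun i => i.elim0, fun i => i.elim0, by simp [cnt]⟩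
  | @add w d σ _ h1 h2 ih =>
    obtain ⟨M, hM, hM', hw⟩ := ih
    refine ⟨Fin.cons σ M, Fin.cases h1 hM, Fin.cases h2 hM', fun p q => ?_⟩
    simp [cnt, Fin.sum_univ_succ, hw, add_comm]

/-- Hall's theorem, used to extend a matching `τ`. -/
theorem exists_involution_of_hall {P Q : Finset W} (hPQ : Disjoint P Q) (hcard : #P = #Q)
    (r : W → W → Prop) [DecidableRel r]
    (hall : ∀ S ⊆ P, #S ≤ #{q ∈ Q | ∃ p ∈ S, r p q}) {τ : W → W} (hτ : Involutive τ)
    (hfix : ∀ v, v ∈ P ∨ v ∈ Q → τ v = v) :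
    ∃ σ : W → W, Involutive σ ∧ (∀ p ∈ P, σ p ∈ Q ∧ r p (σ p)) ∧ (∀ q ∈ Q, σ q ∈ P) ∧
      ∀ v, v ∉ P → v ∉ Q → σ v = τ v := by
  classical
  have H : ∀ A : Finset P, #A ≤ #(A.biUnion fun p : P => {q ∈ Q | r p q}) := by
    intro A
    have h1 := hall (A.map (Embedding.subtype _)) (by
      intro x hx
      simp only [Finset.mem_map, Embedding.coe_subtype] at hx
      obtain ⟨a, -, rfl⟩ := hx
      exact a.2)
    rw [Finset.card_map] at h1
    refine h1.trans (Finset.card_le_card ?_)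
    intro q hq
    simp only [Finset.mem_filter, Finset.mem_map, Embedding.coe_subtype, Finset.mem_biUnion] at hq ⊢
    obtain ⟨hq, p, ⟨a, ha, rfl⟩, hr⟩ := hq
    exact ⟨a, ha, hq, hr⟩
  obtain ⟨f, finj, hf⟩ := (Finset.all_card_le_biUnion_card_iff_exists_injective _).1 H
  simp only [Finset.mem_filter] at hf
  have himg : univ.image f = Q := by
    apply Finset.eq_of_subset_of_card_le
    · intro q hq
      simp only [Finset.mem_image, Finset.mem_univ, true_and] at hq
      obtain ⟨p, rfl⟩ := hq
      exact (hf p).1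
    · rw [Finset.card_image_of_injective _ finj]
      simp [hcard]
  let F : W → W := fun v => if h : v ∈ P then f ⟨v, h⟩ else v
  have hFP : ∀ p ∈ P, F p ∈ Q ∧ r p (F p) := fun p hp => by
    simpa [F, hp] using hf ⟨p, hp⟩
  have hFinj : ∀ p ∈ P, ∀ p' ∈ P, F p = F p' → p = p' := by
    intro p hp p' hp' h
    have h' : f ⟨p, hp⟩ = f ⟨p', hp'⟩ := by simpa only [F, hp, hp', dite_true] using h
    simpa using finj h'
  have hsurj : ∀ q ∈ Q, ∃ p ∈ P, F p = q := by
    intro q hq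
    rw [← himg] at hq
    obtain ⟨p, -, hp⟩ := Finset.mem_image.1 hq
    exact ⟨p, p.2, by simpa [F] using hp⟩
  choose! g hgP hg using hsurj
  have hgF : ∀ p ∈ P, g (F p) = p := by
    intro p hp
    exact hFinj _ (hgP _ (hFP p hp).1) _ hp (hg _ (hFP p hp).1)
  clear_value F
  have hdis : ∀ v ∈ P, v ∉ Q := fun v hv hv' => Finset.disjoint_left.1 hPQ hv hv'
  have hτ' : ∀ v, v ∉ P → v ∉ Q → τ v ∉ P ∧ τ v ∉ Q := by
    intro v h1 h2
    have := hτ v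
    constructor <;> intro h3
    · have := hfix _ (Or.inl h3)
      grind
    · have := hfix _ (Or.inr h3)
      grind
  refine ⟨fun v => if v ∈ P then F v else if v ∈ Q then g v else τ v, ?_, ?_, ?_, ?_⟩
  · intro v
    by_cases h1 : v ∈ P
    · have h2 : F v ∉ P := fun h => hdis _ h (hFP v h1).1
      simp [h1, h2, (hFP v h1).1, hgF v h1]
    · by_cases h2 : v ∈ Q
      · simp [h1, h2, hgP v h2, hg v h2]
      · simp [h1, h2, hτ' v h1 h2, hτ v]
  · intro p hp
    simpa [hp] using hFP p hp
  · intro q hq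
    have : q ∉ P := fun h => hdis q h hq
    simpa [hq, this] using hgP q hq
  · intro v h1 h2
    simp [h1, h2]

theorem card_side_eq {side : W → Bool} {w : W → W → ℕ} (hs : ∀ p q, w p q = w q p)
    (hc : ∀ p q, side p = side q → w p q = 0) {d : ℕ} (hd : 0 < d) (hreg : ∀ p, ∑ q, w p q = d) :
    #{v | side v = true} = #{v | side v = false} := by
  have h1 : ∑ p ∈ ({v | side v = true} : Finset W), ∑ q ∈ ({v | side v = false} : Finset W), w p q
      = #{v | side v = true} * d := by
    rw [Finset.sum_const_nat]
    intro p hp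
    rw [← hreg p]
    apply Finset.sum_subset (Finset.subset_univ _)
    intro q _ hq
    simp only [Finset.mem_filter, Finset.mem_univ, true_and] at hp hq
    exact hc _ _ (by simp_all)
  have h2 : ∑ q ∈ ({v | side v = false} : Finset W), ∑ p ∈ ({v | side v = true} : Finset W), w p q
      = #{v | side v = false} * d := by
    rw [Finset.sum_const_nat]
    intro p hp
    rw [← hreg p]
    simp only [hs _ p]
    apply Finset.sum_subset (Finset.subset_univ _)
    intro q _ hq
    simp only [Finset.mem_filter, Finset.mem_univ, true_and] at hp hq
    exact hc _ _ (by simp_all)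
  rw [Finset.sum_comm] at h2
  exact Nat.eq_of_mul_eq_mul_right hd (h1.symm.trans h2)

/-- König's theorem: regular bipartite multigraphs are unions of perfect matchings. -/
theorem factorable_of_bipartite (side : W → Bool) (d : ℕ) (w : W → W → ℕ)
    (hs : ∀ p q, w p q = w q p) (hc : ∀ p q, side p = side q → w p q = 0)
    (hreg : ∀ p, ∑ q, w p q = d) : Factorable w d := by
  induction d generalizing w with
  | zero =>
    have : w = fun _ _ => 0 := by
      funext p q
      exact Finset.sum_eq_zero_iff.1 (hreg p) q (mem_univ q)
    rw [this]
    exact Factorable.zero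
  | succ d ih =>
    obtain ⟨σ, h1, h2, h3, -⟩ := exists_involution_of_hall
      (P := ({v | side v = true} : Finset W)) (Q := ({v | side v = false} : Finset W))
      (Finset.disjoint_left.2 (by simp)) (card_side_eq hs hc (Nat.succ_pos d) hreg)
      (fun p q => 0 < w p q) (by
        intro S hS
        set N := ({q ∈ ({v | side v = false} : Finset W) | ∃ p ∈ S, 0 < w p q} : Finset W)
        have h1 : #S * (d + 1) = ∑ p ∈ S, ∑ q ∈ N, w p q := by
          rw [Finset.sum_const_nat]
          intro p hp
          rw [← hreg p]
          apply Finset.sum_subset (Finset.subset_univ _)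
          intro q _ hq
          by_contra h0
          have h4 := hS hp
          simp only [Finset.mem_filter, Finset.mem_univ, true_and, N] at hq h4
          apply hq
          refine ⟨?_, p, hp, by omega⟩
          by_contra h5
          exact h0 (hc _ _ (by simp_all))
        have h2 : ∑ q ∈ N, ∑ p ∈ S, w p q ≤ #N * (d + 1) := by
          apply Finset.sum_le_card_nsmul
          intro q _
          rw [← hreg q]
          simp only [hs _ q]
          exact Finset.sum_le_univ_sum_of_nonneg (by simp)
        rw [Finset.sum_comm, ← h1] at h2
        exact Nat.le_of_mul_le_mul_right h2 (Nat.succ_pos d))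
      (τ := id) (fun _ => rfl) (by simp)
    have hpos : ∀ v, 0 < w v (σ v) ∧ side (σ v) ≠ side v := by
      intro v
      cases hv : side v
      · have h4 := h3 v (by simpa using hv)
        have h5 := h2 _ h4
        rw [h1 v] at h5
        rw [hs]
        simp only [Finset.mem_filter, Finset.mem_univ, true_and] at h4
        exact ⟨h5.2, by simp [h4]⟩
      · have h4 := h2 v (by simpa using hv)
        simp only [Finset.mem_filter, Finset.mem_univ, true_and] at h4
        exact ⟨h4.2, by simp [h4.1]⟩
    have hle : ∀ p q, ind σ p q ≤ w p q := by
      intro p q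
      unfold ind
      split_ifs with h
      · subst h; exact (hpos p).1
      · exact Nat.zero_le _
    have := (ih (fun p q => w p q - ind σ p q)
      (fun p q => by rw [hs, ind_symm h1])
      (fun p q h => by simp [hc p q h])
      (fun p => by
        rw [Finset.sum_tsub_distrib _ (fun q _ => hle p q), hreg, sum_ind]
        rfl)).add h1 (fun v h => (hpos v).2 (by rw [h]))
    convert this using 3 with p q
    exact (Nat.sub_add_cancel (hle p q)).symm

end Konig

section Discrepancy

theorem exists_signs_cosh {ι J : Type*} [Fintype ι] [DecidableEq J] (c : ι → J → ℝ) {K : ℝ}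
    (hc : ∀ v j, |c v j| ≤ K) (s : Finset J) :
    ∃ g : J → Bool, ∑ v, Real.cosh (∑ j ∈ s, (if g j then 1 else -1) * c v j) ≤
      Fintype.card ι * Real.exp (#s * (K ^ 2 / 2)) := by
  induction s using Finset.induction_on with
  | empty => exact ⟨fun _ => true, by simp⟩
  | insert i s hi ih =>
    obtain ⟨g, hg⟩ := ih
    set a : ι → ℝ := fun v => ∑ j ∈ s, (if g j then 1 else -1) * c v j
    have hupd : ∀ b : Bool, ∀ v,
        ∑ j ∈ insert i s, (if update g i b j then 1 else -1) * c v j =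
          (if b then 1 else -1) * c v i + a v := by
      intro b v
      rw [Finset.sum_insert hi, update_self]
      congr 1
      refine Finset.sum_congr rfl fun j hj => ?_
      rw [update_of_ne]
      rintro rfl
      exact hi hj
    have hsum : ∑ v, Real.cosh (c v i + a v) + ∑ v, Real.cosh (-c v i + a v) ≤
        2 * (Fintype.card ι * Real.exp (#(insert i s) * (K ^ 2 / 2))) := by
      have h1 : ∀ v, Real.cosh (c v i + a v) + Real.cosh (-c v i + a v) ≤
          2 * Real.exp (K ^ 2 / 2) * Real.cosh (a v) := by
        intro v
        have h2 : Real.cosh (c v i) ≤ Real.exp (K ^ 2 / 2) := by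
          refine (Real.cosh_le_exp_half_sq _).trans (Real.exp_le_exp.2 ?_)
          have := sq_le_sq' (abs_le.1 (hc v i)).1 (abs_le.1 (hc v i)).2
          linarith
        rw [Real.cosh_add, Real.cosh_add, Real.cosh_neg, Real.sinh_neg]
        have := Real.cosh_pos (a v)
        nlinarith
      rw [← Finset.sum_add_distrib]
      refine (Finset.sum_le_sum fun v _ => h1 v).trans ?_
      rw [← Finset.mul_sum, Finset.card_insert_of_notMem hi]
      have h3 : Real.exp ((#s + 1 : ℕ) * (K ^ 2 / 2)) =
          Real.exp (K ^ 2 / 2) * Real.exp (#s * (K ^ 2 / 2)) := by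
        rw [← Real.exp_add]
        push_cast
        ring_nf
      rw [h3]
      have := mul_le_mul_of_nonneg_left hg (Real.exp_pos (K ^ 2 / 2)).le
      linarith
    by_cases h : ∑ v, Real.cosh (c v i + a v) ≤
        Fintype.card ι * Real.exp (#(insert i s) * (K ^ 2 / 2))
    · refine ⟨update g i true, ?_⟩
      simpa only [hupd, if_true, one_mul] using h
    · refine ⟨update g i false, ?_⟩
      simp only [hupd, Bool.false_eq_true, if_false, neg_mul, one_mul]
      linarith

theorem exists_signs {ι J : Type*} [Fintype ι] [DecidableEq J] (c : ι → J → ℝ) {K l t : ℝ}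
    (hl : 0 < l) (hc : ∀ v j, |c v j| ≤ K) (s : Finset J)
    (ht : 2 * (Fintype.card ι * Real.exp (#s * ((l * K) ^ 2 / 2))) < Real.exp (l * t)) :
    ∃ g : J → Bool, ∀ v, |∑ j ∈ s, (if g j then 1 else -1) * c v j| ≤ t := by
  obtain ⟨g, hg⟩ := exists_signs_cosh (fun v j => l * c v j) (K := l * K) (fun v j => by
    rw [abs_mul, abs_of_pos hl]
    exact mul_le_mul_of_nonneg_left (hc v j) hl.le) s
  refine ⟨g, fun v => ?_⟩
  by_contra! h
  set x := ∑ j ∈ s, (if g j then 1 else -1) * c v j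
  have h1 : ∑ j ∈ s, (if g j then 1 else -1) * (l * c v j) = l * x := by
    rw [Finset.mul_sum]
    exact Finset.sum_congr rfl fun j _ => by ring
  have h2 : Real.cosh (l * x) ≤ Fintype.card ι * Real.exp (#s * ((l * K) ^ 2 / 2)) := by
    rw [← h1]
    refine le_trans ?_ hg
    exact Finset.single_le_sum (f := fun v => Real.cosh (∑ j ∈ s, (if g j then 1 else -1) *
      (l * c v j))) (fun v _ => (Real.cosh_pos _).le) (mem_univ v)
  have h3 : Real.exp (l * |x|) ≤ 2 * Real.cosh (l * x) := by
    rw [← Real.cosh_abs, abs_mul, abs_of_pos hl, Real.cosh_eq]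
    have := Real.exp_pos (-(l * |x|))
    linarith
  have h4 : Real.exp (l * t) < Real.exp (l * |x|) :=
    Real.exp_lt_exp.2 (mul_lt_mul_of_pos_left h hl)
  linarith

/-- For large `n`, `O(n)` bounded rows over at most `n` columns have discrepancy `≤ σ n`. -/
theorem exists_signs_of_large {σ K : ℝ} (hσ : 0 < σ) (hK : 0 < K) :
    ∃ n₀ : ℕ, ∀ n ≥ n₀, ∀ (ι J : Type) [Fintype ι] [DecidableEq J] (c : ι → J → ℝ)
      (s : Finset J), Fintype.card ι ≤ 10 * n → #s ≤ n → (∀ v j, |c v j| ≤ K) →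
      ∃ g : J → Bool, ∀ v, |∑ j ∈ s, (if g j then 1 else -1) * c v j| ≤ σ * n := by
  set e : ℝ := σ ^ 2 / K ^ 2 / 2 with he
  have hepos : 0 < e := by positivity
  have hlim : Filter.Tendsto (fun n : ℕ => 20 * ((n : ℝ) ^ 1 * Real.exp (-(e * n)))) Filter.atTop
      (nhds (20 * 0)) := by
    refine Filter.Tendsto.const_mul _ ?_
    have := (Real.tendsto_pow_mul_exp_neg_atTop_nhds_zero 1).comp
      ((tendsto_natCast_atTop_atTop (R := ℝ)).const_mul_atTop hepos)
    have := this.const_mul (1 / e)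
    rw [mul_zero] at this
    refine this.congr fun n => ?_
    simp
    field_simp
  rw [mul_zero] at hlim
  obtain ⟨n₀, hn₀⟩ := Filter.eventually_atTop.1 (hlim.eventually (gt_mem_nhds one_pos))
  refine ⟨n₀, fun n hn ι J _ _ c s h1 h2 h3 => exists_signs c (l := σ / K ^ 2) (by positivity) h3 s ?_⟩
  have h4 := hn₀ n hn
  rw [pow_one, Real.exp_neg] at h4
  have h5 : 20 * (n : ℝ) < Real.exp (e * n) := by
    have := Real.exp_pos (e * n)
    rwa [← mul_assoc, ← div_eq_mul_inv, div_lt_one this] at h4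
  have h6 : Real.exp (σ / K ^ 2 * (σ * n)) = Real.exp (e * n) * Real.exp (e * n) := by
    rw [← Real.exp_add, he]
    congr 1
    field_simp
    ring
  have h7 : Real.exp (#s * ((σ / K ^ 2 * K) ^ 2 / 2)) ≤ Real.exp (e * n) := by
    rw [Real.exp_le_exp]
    have : (σ / K ^ 2 * K) ^ 2 / 2 = e := by rw [he]; field_simp
    rw [this, mul_comm]
    have : (#s : ℝ) ≤ n := by exact_mod_cast h2
    exact mul_le_mul_of_nonneg_left this hepos.le
  have h8 : (Fintype.card ι : ℝ) ≤ 10 * n := by exact_mod_cast h1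
  rw [h6]
  have h9 := Real.exp_pos (#s * ((σ / K ^ 2 * K) ^ 2 / 2))
  have h10 := Real.exp_pos (e * n)
  nlinarith [Nat.cast_nonneg (α := ℝ) n, Nat.cast_nonneg (α := ℝ) (Fintype.card ι)]

end Discrepancy

section Partition

variable {W : Type} [DecidableEq W] [Fintype W]

theorem exists_swap {P Q : Finset W} (hPQ : Disjoint P Q) (hcard : #P = #Q) :
    ∃ σ : W → W, Involutive σ ∧ (∀ p ∈ P, σ p ∈ Q) ∧ ∀ q ∈ Q, σ q ∈ P := by
  obtain ⟨σ, h1, h2, h3, -⟩ := exists_involution_of_hall hPQ hcard (fun _ _ => True) (by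
    intro S hS
    rcases S.eq_empty_or_nonempty with rfl | ⟨p, hp⟩
    · simp
    · have : ({q ∈ Q | ∃ p ∈ S, True} : Finset W) = Q := by
        ext q
        simp only [and_true, Finset.mem_filter, and_iff_left_iff_imp]
        exact fun _ => ⟨p, hp⟩
      rw [this, ← hcard]
      exact Finset.card_le_card hS) (τ := id) (fun _ => rfl) (fun _ _ => rfl)
  exact ⟨σ, h1, fun p hp => (h2 p hp).1, h3⟩

theorem sum_swap {P Q : Finset W} {σ : W → W} (h : Involutive σ) (hP : ∀ p ∈ P, σ p ∈ Q)
    (hQ : ∀ q ∈ Q, σ q ∈ P) {R : Type*} [AddCommMonoid R] (f : W → R) :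
    ∑ q ∈ Q, f q = ∑ p ∈ P, f (σ p) :=
  Finset.sum_nbij' σ σ hQ hP (fun q _ => h q) (fun p _ => h p) (fun q _ => by rw [h q])

theorem exists_balanced_partition {σ K : ℝ} (hσ : 0 < σ) (hK : 0 < K) :
    ∃ n₀ : ℕ, ∀ n ≥ n₀, ∀ (W ι : Type) [Fintype W] [DecidableEq W] [Fintype ι] (f : ι → W → ℝ)
      (R : Finset W), Even #R → #R ≤ 2 * n → Fintype.card ι ≤ 10 * n →
      (∀ i v, 0 ≤ f i v) → (∀ i v, f i v ≤ K) →
      ∃ side : W → Bool, #{v ∈ R | side v = true} = #{v ∈ R | side v = false} ∧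
        ∀ i, |∑ v ∈ R with side v = true, f i v - ∑ v ∈ R with side v = false, f i v| ≤ σ * n := by
  obtain ⟨n₀, hn₀⟩ := exists_signs_of_large hσ hK
  refine ⟨n₀, fun n hn W ι _ _ _ f R hev hR hι h0 h1 => ?_⟩
  obtain ⟨m, hm⟩ := hev
  obtain ⟨P, hPR, hP⟩ := Finset.exists_subset_card_eq (s := R) (n := m) (by omega)
  have hdis : Disjoint P (R \ P) := Finset.disjoint_sdiff
  have hQ : #P = #(R \ P) := by rw [Finset.card_sdiff_of_subset hPR]; omega
  obtain ⟨φ, hφ, hφP, hφQ⟩ := exists_swap hdis hQ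
  obtain ⟨g, hg⟩ := hn₀ n hn ι W (fun i j => f i j - f i (φ j)) P hι (by omega) (fun i j => by
    rw [abs_le]
    constructor <;> linarith [h0 i j, h1 i j, h0 i (φ j), h1 i (φ j)])
  set side : W → Bool := fun v => if v ∈ P then g v else !(g (φ v)) with hside
  have key : ∀ F : W → ℝ, ∑ v ∈ R with side v = true, F v - ∑ v ∈ R with side v = false, F v =
      ∑ j ∈ P, (if g j then 1 else -1) * (F j - F (φ j)) := by
    intro F
    rw [Finset.sum_filter, Finset.sum_filter, ← Finset.sum_sub_distrib]
    rw [← Finset.sum_sdiff hPR, sum_swap hφ hφP hφQ, ← Finset.sum_add_distrib]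
    refine Finset.sum_congr rfl fun j hj => ?_
    have h2 : φ j ∉ P := (Finset.mem_sdiff.1 (hφP j hj)).2
    have h3 : side j = g j := by simp [hside, hj]
    have h4 : side (φ j) = !(g j) := by simp [hside, h2, hφ j]
    rw [h3, h4]
    cases g j <;> simp <;> ring
  refine ⟨side, ?_, fun i => by rw [key]; exact hg i⟩
  have := key (fun _ => 1)
  simp only [sub_self, mul_zero, Finset.sum_const_zero, Finset.sum_const, nsmul_eq_mul,
    mul_one] at this
  exact_mod_cast sub_eq_zero.1 this

end Partition

section Kempe

variable {W : Type*}

/-- Alternating walk from `y` along two involutions. -/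
def altWalk (γ δ : W → W) (y : W) : ℕ → W
  | 0 => y
  | i + 1 => if i % 2 = 0 then γ (altWalk γ δ y i) else δ (altWalk γ δ y i)

theorem altWalk_closed {γ δ : W → W} (hγ : Involutive γ) (hδ : Involutive δ) {y : W}
    (hy : δ y = y) (i : ℕ) :
    (γ (altWalk γ δ y i) = altWalk γ δ y (if i % 2 = 0 then i + 1 else i - 1)) ∧
      (δ (altWalk γ δ y i) = altWalk γ δ y (if i % 2 = 0 then i - 1 else i + 1)) := by
  cases i with
  | zero => simp [altWalk, hy]
  | succ i =>
    rcases Nat.mod_two_eq_zero_or_one i with h | h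
    · have h' : (i + 1) % 2 = 1 := by omega
      simp [altWalk, h, h', hγ _]
    · have h' : (i + 1) % 2 = 0 := by omega
      simp [altWalk, h, h', hδ _]

theorem altWalk_end {γ δ : W → W} (hγ : Involutive γ) (hδ : Involutive δ) {y z : W}
    (hy : δ y = y) (hz : γ z = z) (hex : ∃ i, altWalk γ δ y i = z) :
    ∃ i, altWalk γ δ y i = z ∧ (∀ j < i, altWalk γ δ y j ≠ z) ∧
      ∀ j, ∃ t ≤ i, altWalk γ δ y j = altWalk γ δ y t := by
  classical
  obtain ⟨i, hi, hmin⟩ : ∃ i, altWalk γ δ y i = z ∧ ∀ j < i, altWalk γ δ y j ≠ z :=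
    ⟨Nat.find hex, Nat.find_spec hex, fun j hj => Nat.find_min hex hj⟩
  refine ⟨i, hi, hmin, fun j => ?_⟩
  have heven : i % 2 = 0 := by
    by_contra h
    have h1 := (altWalk_closed hγ hδ hy i).1
    rw [if_neg h, hi, hz] at h1
    exact hmin (i - 1) (by omega) h1.symm
  induction j with
  | zero => exact ⟨0, Nat.zero_le _, rfl⟩
  | succ j ih =>
    obtain ⟨t, ht, hjt⟩ := ih
    have h1 := altWalk_closed hγ hδ hy t
    rw [altWalk, hjt]
    rcases Nat.lt_or_ge t i with hlt | hge
    · split_ifs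
      · exact ⟨_, by split_ifs <;> omega, h1.1⟩
      · exact ⟨_, by split_ifs <;> omega, h1.2⟩
    · obtain rfl : t = i := le_antisymm ht hge
      split_ifs
      · exact ⟨t, le_rfl, by rw [hi, hz]⟩
      · exact ⟨_, by split_ifs; omega, h1.2⟩

theorem kempe_chain {γ δ : W → W} (hγ : Involutive γ) (hδ : Involutive δ) {y z z' : W}
    (hy : δ y = y) (hz : γ z = z) (hz' : γ z' = z') (hne : z ≠ z') :
    ¬ Relation.ReflTransGen (fun a b => b = γ a ∨ b = δ a) z y ∨
      ¬ Relation.ReflTransGen (fun a b => b = γ a ∨ b = δ a) z' y := by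
  have hsymm : Std.Symm (fun a b => b = γ a ∨ b = δ a) := ⟨by
    rintro a b (rfl | rfl)
    · exact Or.inl (hγ _).symm
    · exact Or.inr (hδ _).symm⟩
  have key : ∀ u, Relation.ReflTransGen (fun a b => b = γ a ∨ b = δ a) u y →
      ∃ i, altWalk γ δ y i = u := by
    intro u hu
    induction hu using Relation.ReflTransGen.head_induction_on with
    | refl => exact ⟨0, rfl⟩
    | @head a b h _ ih =>
      obtain ⟨i, hi⟩ := ih
      have h1 := altWalk_closed hγ hδ hy i
      rw [hi] at h1
      rcases h with rfl | rfl
      · rw [hγ] at h1; exact ⟨_, h1.1.symm⟩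
      · rw [hδ] at h1; exact ⟨_, h1.2.symm⟩
  by_contra! h
  obtain ⟨i, hi, hi1, hi2⟩ := altWalk_end hγ hδ hy hz (key _ h.1)
  obtain ⟨j, hj, hj1, hj2⟩ := altWalk_end hγ hδ hy hz' (key _ h.2)
  obtain ⟨t, ht, h1⟩ := hi2 j
  obtain ⟨t', ht', h2⟩ := hj2 i
  have h3 : j ≤ t := by
    by_contra! h; exact hj1 t h (by rw [← h1, hj])
  have h4 : i ≤ t' := by
    by_contra! h; exact hi1 t' h (by rw [← h2, hi])
  have : i = j := by omega
  subst this
  exact hne (hi.symm.trans hj)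

end Kempe

section Vizing

variable {W : Type*} [DecidableEq W] {ι : Type*} [Fintype ι] [DecidableEq ι]

theorem extend_direct {M : ι → W → W} (hM : ∀ i, Involutive (M i)) {p y : W} (hpy : p ≠ y) {α : ι}
    (h1 : M α p = p) (h2 : M α y = y) :
    ∃ M' : ι → W → W, (∀ i, Involutive (M' i)) ∧
      ∀ a b, a ≠ b → cnt M' a b = cnt M a b + edge p y a b := by
  refine ⟨update M α (link (M α) p y), update_involutive hM _ (link_involutive (hM α) h1 h2), ?_⟩
  intro a b hab
  have := cnt_update M α (link (M α) p y) a b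
  have := ind_link h1 h2 hpy hab
  omega

theorem extend_shift {M : ι → W → W} (hM : ∀ i, Involutive (M i)) {p y : W} (hpy : p ≠ y)
    {α γ : ι} (h1 : M α p = p) (h2 : M α y ≠ y) (h3 : M γ y = y) (h4 : M γ (M α y) = M α y) :
    ∃ M' : ι → W → W, (∀ i, Involutive (M' i)) ∧
      ∀ a b, a ≠ b → cnt M' a b = cnt M a b + edge p y a b := by
  have hne : γ ≠ α := by rintro rfl; exact h2 h3
  set M1 := update M γ (link (M γ) y (M α y)) with hM1
  have hM1' : ∀ i, Involutive (M1 i) := update_involutive hM _ (link_involutive (hM γ) h3 h4)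
  have hα : M1 α = M α := update_of_ne hne.symm _ _
  have hzp : M α y ≠ p := by
    intro h
    have := hM α y
    rw [h, h1] at this
    exact hpy this
  have h5 : unlink (M1 α) y p = p := by
    rw [hα]; unfold unlink; grind
  have h6 : unlink (M1 α) y y = y := by
    rw [hα]; unfold unlink; grind
  have hu := unlink_involutive (hM1' α) y
  refine ⟨update M1 α (link (unlink (M1 α) y) p y),
    update_involutive hM1' _ (link_involutive hu h5 h6), ?_⟩
  intro a b hab
  have e1 := cnt_update M1 α (link (unlink (M1 α) y) p y) a b
  have e2 := cnt_update M γ (link (M γ) y (M α y)) a b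
  have e3 := ind_link h5 h6 hpy hab
  have e4 := ind_unlink (hM1' α) (b := y) hab
  have e5 := ind_link h3 h4 h2.symm hab
  rw [hα] at e1 e3 e4
  rw [hα]
  rw [← hM1] at e2
  omega

theorem exists_kempe_swap {M : ι → W → W} (hM : ∀ i, Involutive (M i)) (γ δ : ι) (hne : γ ≠ δ)
    (z : W) :
    ∃ M' : ι → W → W, (∀ i, Involutive (M' i)) ∧ (∀ a b, cnt M' a b = cnt M a b) ∧
      (∀ i, i ≠ γ → i ≠ δ → M' i = M i) ∧ M' δ z = M γ z ∧
      ∀ v, ¬ Relation.ReflTransGen (fun a b => b = M γ a ∨ b = M δ a) z v →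
        ∀ i, M' i v = M i v := by
  classical
  set O : W → Prop := fun v => Relation.ReflTransGen (fun a b => b = M γ a ∨ b = M δ a) z v
  have hγO : ∀ v, O (M γ v) ↔ O v := fun v =>
    ⟨fun h => h.tail (Or.inl (hM γ v).symm), fun h => h.tail (Or.inl rfl)⟩
  have hδO : ∀ v, O (M δ v) ↔ O v := fun v =>
    ⟨fun h => h.tail (Or.inr (hM δ v).symm), fun h => h.tail (Or.inr rfl)⟩
  set f : W → W := fun v => if O v then M δ v else M γ v with hf
  set g : W → W := fun v => if O v then M γ v else M δ v with hg
  have hfi : Involutive f := by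
    intro v
    by_cases h : O v
    · simp [hf, h, hδO, hM δ v]
    · simp [hf, h, hγO, hM γ v]
  have hgi : Involutive g := by
    intro v
    by_cases h : O v
    · simp [hg, h, hγO, hM γ v]
    · simp [hg, h, hδO, hM δ v]
  have hδ : update M γ f δ = M δ := update_of_ne hne.symm _ _
  refine ⟨update (update M γ f) δ g, update_involutive (update_involutive hM _ hfi) _ hgi,
    fun a b => ?_, fun i h1 h2 => ?_, ?_, fun v hv i => ?_⟩
  · have e1 := cnt_update (update M γ f) δ g a b
    have e2 := cnt_update M γ f a b
    rw [hδ] at e1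
    have e3 : ind f a b + ind g a b = ind (M γ) a b + ind (M δ) a b := by
      by_cases h : O a
      · simp [ind, hf, hg, h, add_comm]
      · simp [ind, hf, hg, h]
    omega
  · rw [update_of_ne h2, update_of_ne h1]
  · have : O z := Relation.ReflTransGen.refl
    simp [hg, this]
  · have hv' : ¬ O v := hv
    by_cases h2 : i = δ
    · subst h2; simp [hg, hv']
    · rw [update_of_ne h2]
      by_cases h1 : i = γ
      · subst h1; simp [hf, hv']
      · rw [update_of_ne h1]

theorem extend_edge [Fintype W] {M : ι → W → W} (hM : ∀ i, Involutive (M i)) {p y : W}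
    (hpy : p ≠ y) {s C : ℕ} (hmiss : ∀ v, s ≤ #{i | M i v = v})
    (hC : ∀ α, M α p = p → M α y ≠ y → cnt M y (M α y) ≤ C)
    (hs : C * Fintype.card ι < s * s) :
    ∃ M' : ι → W → W, (∀ i, Involutive (M' i)) ∧
      ∀ a b, a ≠ b → cnt M' a b = cnt M a b + edge p y a b := by
  by_cases hA : ∃ α, M α p = p ∧ M α y = y
  · obtain ⟨α, h1, h2⟩ := hA
    exact extend_direct hM hpy h1 h2
  push Not at hA
  by_cases hB : ∃ α γ, M α p = p ∧ M γ y = y ∧ M γ (M α y) = M α y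
  · obtain ⟨α, γ, h1, h2, h3⟩ := hB
    exact extend_shift hM hpy h1 (hA α h1) h2 h3
  push Not at hB
  set Z : Finset W := ({α | M α p = p} : Finset ι).image (fun α => M α y) with hZ
  have h1 : s ≤ C * #Z := by
    refine (hmiss p).trans (Finset.card_le_mul_card_image _ C ?_)
    intro z hz
    obtain ⟨α, hα, rfl⟩ := Finset.mem_image.1 hz
    simp only [Finset.mem_filter, Finset.mem_univ, true_and] at hα
    refine le_trans ?_ (hC α hα (hA α hα))
    rw [cnt_eq_card]
    exact Finset.card_le_card fun i hi => by simp_all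
  by_cases hdis : (Z : Set W).PairwiseDisjoint (fun z => ({i | M i z = z} : Finset ι))
  · have h2 : #Z * s ≤ Fintype.card ι := by
      calc #Z * s ≤ ∑ z ∈ Z, #{i | M i z = z} := by
            rw [← smul_eq_mul]; exact Finset.card_nsmul_le_sum _ _ _ fun z _ => hmiss z
        _ = #(Z.biUnion fun z => ({i | M i z = z} : Finset ι)) := (Finset.card_biUnion hdis).symm
        _ ≤ _ := Finset.card_le_univ _
    nlinarith
  · simp only [Set.PairwiseDisjoint, Set.Pairwise] at hdis
    push Not at hdis
    obtain ⟨z, hz, z', hz', hne, hγ⟩ := hdis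
    simp only [Finset.disjoint_left] at hγ
    push Not at hγ
    obtain ⟨γ, hγz, hγz'⟩ := hγ
    have hspos : 0 < s := by
      rcases Nat.eq_zero_or_pos s with rfl | h
      · simp at hs
      · exact h
    obtain ⟨δ, hδ⟩ := Finset.card_pos.1 (hspos.trans_le (hmiss y))
    simp only [Finset.mem_filter, Finset.mem_univ, true_and, hZ, Finset.coe_image,
      Finset.coe_filter, Set.mem_image, Set.mem_ofPred_eq] at hγz hγz' hδ hz hz'
    have key : ∀ α, M α p = p → M γ (M α y) = M α y →
        ¬ Relation.ReflTransGen (fun a b => b = M γ a ∨ b = M δ a) (M α y) y →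
        ∃ M' : ι → W → W, (∀ i, Involutive (M' i)) ∧
          ∀ a b, a ≠ b → cnt M' a b = cnt M a b + edge p y a b := by
      intro α hα hγα hO
      have hγδ : γ ≠ δ := by
        rintro rfl
        exact hB α γ hα hδ hγα
      obtain ⟨M', h1, h2, h3, h4, h5⟩ := exists_kempe_swap hM γ δ hγδ (M α y)
      have hαγ : α ≠ γ := by
        rintro rfl
        rw [hM α y] at hγα
        exact hA α hα hγα.symm
      have hαδ : α ≠ δ := by
        rintro rfl
        exact hA α hα hδ
      have hα' := h3 α hαγ hαδ
      obtain ⟨M'', h6, h7⟩ := extend_shift h1 hpy (α := α) (γ := δ) (by rw [hα', hα])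
        (by rw [hα']; exact hA α hα) (by rw [h5 y hO, hδ]) (by rw [hα', h4, hγα])
      exact ⟨M'', h6, fun a b hab => by rw [h7 a b hab, h2]⟩
    obtain ⟨α, hα, rfl⟩ := hz
    obtain ⟨α', hα', rfl⟩ := hz'
    rcases kempe_chain (hM γ) (hM δ) hδ hγz hγz' hne with h | h
    · exact key α hα hγz h
    · refine key α' hα' hγz' ?_
      exact h

/-- A Vizing-type theorem with slack: all multiplicities off `x` are at most `C`. -/
theorem exists_coloring [Fintype W] (x : W) {s C : ℕ} (hs : C * Fintype.card ι < s * s)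
    (N : ℕ) (w : W → W → ℕ) (hN : ∑ p, ∑ q, w p q = N) (hsymm : ∀ p q, w p q = w q p)
    (hdiag : ∀ p, w p p = 0) (hdeg : ∀ p, ∑ q, w p q + s ≤ Fintype.card ι)
    (hC : ∀ u v, u ≠ x → v ≠ x → w u v ≤ C) :
    ∃ M : ι → W → W, (∀ i, Involutive (M i)) ∧ ∀ a b, a ≠ b → cnt M a b = w a b := by
  induction N using Nat.strong_induction_on generalizing w with
  | _ N ih =>
    by_cases h0 : ∃ p y, 0 < w p y
    swap
    · push Not at h0
      refine ⟨fun _ => id, fun _ _ => rfl, fun a b hab => ?_⟩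
      have := h0 a b
      simp [cnt, ind, hab]
      omega
    obtain ⟨p, y, hpy0, hyx, hx⟩ : ∃ p y, 0 < w p y ∧ y ≠ x ∧ (p = x ∨ ∀ v, w v x = 0) := by
      by_cases hx : ∃ v, 0 < w x v
      · obtain ⟨v, hv⟩ := hx
        exact ⟨x, v, hv, by rintro rfl; simp [hdiag] at hv, Or.inl rfl⟩
      · push Not at hx
        obtain ⟨p, y, h⟩ := h0
        refine ⟨p, y, h, ?_, Or.inr fun v => ?_⟩
        · rintro rfl
          rw [hsymm] at h
          have := hx p
          omega
        · rw [hsymm]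
          have := hx v
          omega
    have hpy : p ≠ y := by rintro rfl; simp [hdiag] at hpy0
    set w' : W → W → ℕ := fun a b => w a b - edge p y a b with hw'
    have hle : ∀ a b, edge p y a b ≤ w a b := by
      intro a b
      unfold edge
      split_ifs with h
      · rcases h with ⟨rfl, rfl⟩ | ⟨rfl, rfl⟩
        · exact hpy0
        · rw [hsymm]; exact hpy0
      · exact Nat.zero_le _
    have hww : ∀ a, ∑ b, w' a b + ∑ b, edge p y a b = ∑ b, w a b := by
      intro a
      rw [← Finset.sum_add_distrib]
      exact Finset.sum_congr rfl fun b _ => Nat.sub_add_cancel (hle a b)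
    have hlt : ∑ a, ∑ b, w' a b < N := by
      rw [← hN]
      apply Finset.sum_lt_sum
      · intro a _
        rw [← hww a]
        exact Nat.le_add_right _ _
      · refine ⟨p, mem_univ _, ?_⟩
        rw [← hww p, sum_edge hpy]
        simp
    obtain ⟨M, hM, hcnt⟩ := ih _ hlt w' rfl
      (fun a b => by simp only [hw', hsymm a b, edge_symm p y a b])
      (fun a => by simp [hw', hdiag])
      (fun a => by have := hww a; have := hdeg a; omega)
      (fun u v hu hv => (Nat.sub_le _ _).trans (hC u v hu hv))
    have hself : ∀ v, #{i | M i v = v} + ∑ b, w' v b = Fintype.card ι := by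
      intro v
      have h1 : w' v v = 0 := by simp [hw', hdiag]
      rw [← sum_cnt M v, ← cnt_eq_card,
        ← Finset.add_sum_erase univ (fun b => w' v b) (mem_univ v), h1, zero_add,
        ← Finset.add_sum_erase univ (fun b => cnt M v b) (mem_univ v)]
      congr 1
      refine Finset.sum_congr rfl fun b hb => (hcnt v b ?_).symm
      exact (Finset.ne_of_mem_erase hb).symm
    obtain ⟨M', hM', hcnt'⟩ := extend_edge hM hpy (s := s) (C := C)
      (fun v => by have := hself v; have := hww v; have := hdeg v; omega)
      (fun α h1 h2 => by
        rw [hcnt _ _ h2.symm]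
        by_cases hz : M α y = x
        · rcases hx with rfl | hx
          · have := hM α y
            rw [hz, h1] at this
            exact absurd this hpy
          · rw [hz]
            simp [hw', hx]
        · exact (Nat.sub_le _ _).trans (hC _ _ hyx hz)) hs
    refine ⟨M', hM', fun a b hab => ?_⟩
    rw [hcnt' a b hab, hcnt a b hab]
    exact Nat.sub_add_cancel (hle a b)

end Vizing

section Perfecting

variable {W : Type*} [DecidableEq W] (side : W → Bool) (Z : Finset W)

/-- The edge of `σ` at `v` joins two vertices on the same side, both outside `Z`. -/
def Good (σ : W → W) (v : W) : Prop :=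
  v ∉ Z ∧ σ v ∉ Z ∧ σ v ≠ v ∧ side (σ v) = side v

instance (σ : W → W) : DecidablePred (Good side Z σ) := fun v => by
  unfold Good; infer_instance

/-- Indicator that `v` is uncovered by `σ`, or joined to the other side outside `Z`. -/
def crossAt (σ : W → W) (v : W) : ℕ :=
  if σ v = v ∨ (side (σ v) ≠ side v ∧ σ v ∉ Z) then 1 else 0

variable {ι : Type*} [Fintype ι]

/-- The invariants kept while completing the matchings `M₀` to perfect matchings. -/
structure Valid (w : W → W → ℕ) (r : ℕ) (M₀ M : ι → W → W) : Prop where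
  inv : ∀ i, Involutive (M i)
  eqOn : ∀ i, ∀ z ∈ Z, M i z = M₀ i z
  le : ∀ p q, p ≠ q → cnt M p q ≤ w p q
  cross : ∀ v, v ∉ Z → ∑ i, crossAt side Z (M i) v ≤ r

theorem sum_update [DecidableEq ι] (M : ι → W → W) (i : ι) (σ : W → W) (f : (W → W) → ℕ) :
    ∑ j, f (update M i σ j) + f (M i) = ∑ j, f (M j) + f σ := by
  rw [← Finset.add_sum_erase _ _ (mem_univ i),
    ← Finset.add_sum_erase univ (fun j => f (M j)) (mem_univ i)]
  have : ∑ j ∈ univ.erase i, f (update M i σ j) = ∑ j ∈ univ.erase i, f (M j) :=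
    Finset.sum_congr rfl fun j hj => by rw [update_of_ne (Finset.ne_of_mem_erase hj)]
  rw [this, update_self]
  ring

variable [Fintype W]

/-- The weighted number of vertices at which `σ` is not good. -/
def defect (σ : W → W) : ℕ := #{v | ¬ Good side Z σ v} + 2 * #{v | σ v = v}

variable {side Z}
variable [DecidableEq ι] {w : W → W → ℕ} {r : ℕ} {M₀ M : ι → W → W}

theorem Valid.link_move (hw : ∀ p q, w p q = w q p) (hM : Valid side Z w r M₀ M)
    (hZ : ∀ i, ∀ z ∈ Z, M₀ i z ≠ z) (i : ι) {c d : W} (hc : M i c = c) (hd : M i d = d)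
    (hcd : side c ≠ side d) (hlt : cnt M c d < w c d) :
    Valid side Z w r M₀ (update M i (link (M i) c d)) ∧
      #{v | link (M i) c d v = v} + 2 = #{v | M i v = v} ∧
      defect side Z (link (M i) c d) + 4 ≤ defect side Z (M i) := by
  have hne : c ≠ d := by rintro rfl; exact hcd rfl
  have hcZ : c ∉ Z := fun h => hZ i c h (by rw [← hM.eqOn i c h, hc])
  have hdZ : d ∉ Z := fun h => hZ i d h (by rw [← hM.eqOn i d h, hd])
  have hlc : link (M i) c d c = d := by simp [link]
  have hld : link (M i) c d d = c := by simp [link, hne.symm]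
  have hlo : ∀ v, v ≠ c → v ≠ d → link (M i) c d v = M i v := fun v h1 h2 => by
    simp [link, h1, h2]
  have hU : #{v | link (M i) c d v = v} + 2 = #{v | M i v = v} := by
    have : ({v | M i v = v} : Finset W) = insert c (insert d
        ({v | link (M i) c d v = v} : Finset W)) := by
      ext v
      simp only [Finset.mem_filter, Finset.mem_univ, true_and, Finset.mem_insert]
      by_cases h1 : v = c
      · simp [h1, hc]
      · by_cases h2 : v = d
        · simp [h2, hd]
        · simp [h1, h2, hlo v h1 h2]
    rw [this, Finset.card_insert_of_notMem, Finset.card_insert_of_notMem]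
    · simp [hld, hne]
    · simp [hne, hlc, hne.symm]
  refine ⟨⟨update_involutive hM.inv _ (link_involutive (hM.inv i) hc hd), ?_, ?_, ?_⟩, hU, ?_⟩
  · intro j z hz
    by_cases hj : j = i
    · subst hj
      rw [update_self, hlo z (by grind) (by grind)]
      exact hM.eqOn j z hz
    · rw [update_of_ne hj]
      exact hM.eqOn j z hz
  · intro p q hpq
    have h1 := cnt_update M i (link (M i) c d) p q
    have h2 := ind_link hc hd hne hpq
    have h3 := hM.le p q hpq
    have h4 : edge c d p q = 1 → cnt M p q < w p q := by
      intro h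
      unfold edge at h
      split_ifs at h with h'
      rcases h' with ⟨rfl, rfl⟩ | ⟨rfl, rfl⟩
      · exact hlt
      · rwa [cnt_symm hM.inv, hw]
    have h5 : edge c d p q ≤ 1 := by unfold edge; split_ifs <;> simp
    omega
  · intro v hv
    have h1 := sum_update M i (link (M i) c d) (fun σ => crossAt side Z σ v)
    have h2 : crossAt side Z (link (M i) c d) v ≤ crossAt side Z (M i) v := by
      by_cases h1 : v = c
      · subst h1; unfold crossAt; rw [hc]; split_ifs <;> simp_all
      · by_cases h2 : v = d
        · subst h2; unfold crossAt; rw [hd]; split_ifs <;> simp_all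
        · unfold crossAt; rw [hlo v h1 h2]
    have := hM.cross v hv
    omega
  · unfold defect
    have : #{v | ¬ Good side Z (link (M i) c d) v} ≤ #{v | ¬ Good side Z (M i) v} := by
      apply Finset.card_le_card
      intro v
      simp only [Finset.mem_filter, Finset.mem_univ, true_and, not_imp_not]
      intro h
      have h1 : v ≠ c := by rintro rfl; exact h.2.2.1 hc
      have h2 : v ≠ d := by rintro rfl; exact h.2.2.1 hd
      unfold Good at h ⊢
      rwa [hlo v h1 h2]
    omega

theorem Valid.half_move (hw : ∀ p q, w p q = w q p) (hM : Valid side Z w r M₀ M)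
    (hZ : ∀ i, ∀ z ∈ Z, M₀ i z ≠ z) (i : ι) {a y : W} (ha : M i a = a)
    (hy : Good side Z (M i) y) (hay : side a ≠ side y) (hlt : cnt M a y < w a y)
    (hey : ∑ i, crossAt side Z (M i) y < r) (hey' : ∑ j, crossAt side Z (M j) (M i y) < r) :
    Valid side Z w r M₀ (update M i (link (unlink (M i) y) a y)) ∧
      #{v | link (unlink (M i) y) a y v = v} = #{v | M i v = v} ∧
      defect side Z (link (unlink (M i) y) a y) ≤ defect side Z (M i) + 2 ∧
      link (unlink (M i) y) a y (M i y) = M i y ∧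
      (∀ v, v ≠ a → v ≠ y → v ≠ M i y → link (unlink (M i) y) a y v = M i v) ∧
      ∀ c, c ≠ a → M i c = c →
        cnt (update M i (link (unlink (M i) y) a y)) c (M i y) ≤ cnt M c (M i y) := by
  obtain ⟨hyZ, hyZ', hyne, hys⟩ := hy
  have hne : a ≠ y := by rintro rfl; exact hay rfl
  have hinv := hM.inv i
  have hyy := hinv y
  have haZ : a ∉ Z := fun h => hZ i a h (by rw [← hM.eqOn i a h, ha])
  have hane : M i y ≠ a := by
    intro h; rw [h, ha] at hyy; exact hne hyy
  set σ := link (unlink (M i) y) a y with hσ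
  have hua : unlink (M i) y a = a := by
    simp only [unlink, ha, hane.symm, hne, if_false]
  have huy : unlink (M i) y y = y := by simp [unlink]
  have hσa : σ a = y := by simp [hσ, link]
  have hσy : σ y = a := by simp [hσ, link, hne.symm]
  have hσy' : σ (M i y) = M i y := by simp [hσ, link, hane, hyne, unlink]
  have hσo : ∀ v, v ≠ a → v ≠ y → v ≠ M i y → σ v = M i v := fun v h1 h2 h3 => by
    simp [hσ, link, unlink, h1, h2, h3]
  have hσi : Involutive σ := link_involutive (unlink_involutive hinv y) hua huy
  have hcnt : ∀ p q, p ≠ q → cnt (update M i σ) p q + edge y (M i y) p q =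
      cnt M p q + edge a y p q := by
    intro p q hpq
    have h1 := cnt_update M i σ p q
    have h2 := ind_link hua huy hne hpq
    have h3 := ind_unlink hinv (b := y) hpq
    rw [← hσ] at h2
    omega
  have hU : #{v | σ v = v} = #{v | M i v = v} := by
    have : ({v | σ v = v} : Finset W) = insert (M i y) (({v | M i v = v} : Finset W).erase a) := by
      ext v
      simp only [Finset.mem_filter, Finset.mem_univ, true_and, Finset.mem_insert, Finset.mem_erase]
      by_cases h1 : v = a
      · simp [h1, hσa, hne.symm, hane.symm]
      · by_cases h2 : v = y
        · simp [h2, hσy, hyne, hne, hyne.symm]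
        · by_cases h3 : v = M i y
          · simp [h3, hσy']
          · simp [h1, h3, hσo v h1 h2 h3]
    rw [this, Finset.card_insert_of_notMem, Finset.card_erase_add_one]
    · simp [ha]
    · simp [hyy, hyne.symm]
  refine ⟨⟨update_involutive hM.inv _ hσi, ?_, ?_, ?_⟩, hU, ?_, hσy', hσo, ?_⟩
  · intro j z hz
    by_cases hj : j = i
    · subst hj
      rw [update_self, hσo z (by grind) (by grind) (by grind)]
      exact hM.eqOn j z hz
    · rw [update_of_ne hj]
      exact hM.eqOn j z hz
  · intro p q hpq
    have h1 := hcnt p q hpq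
    have h3 := hM.le p q hpq
    have h4 : edge a y p q = 1 → cnt M p q < w p q := by
      intro h
      unfold edge at h
      split_ifs at h with h'
      rcases h' with ⟨rfl, rfl⟩ | ⟨rfl, rfl⟩
      · exact hlt
      · rwa [cnt_symm hM.inv, hw]
    have h5 : edge a y p q ≤ 1 := by unfold edge; split_ifs <;> simp
    omega
  · intro v hv
    have h1 := sum_update M i σ (fun σ => crossAt side Z σ v)
    have h3 := hM.cross v hv
    have hle1 : ∀ τ : W → W, crossAt side Z τ v ≤ 1 := fun τ => by
      unfold crossAt; split_ifs <;> simp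
    have h4 := hle1 σ
    by_cases e2 : v = y
    · subst e2; omega
    by_cases e3 : v = M i y
    · subst e3; omega
    have h2 : crossAt side Z σ v ≤ crossAt side Z (M i) v := by
      by_cases e1 : v = a
      · subst e1; unfold crossAt; rw [ha]; split_ifs <;> simp_all
      · unfold crossAt; rw [hσo v e1 e2 e3]
    omega
  · unfold defect
    have : #{v | ¬ Good side Z σ v} ≤ #{v | ¬ Good side Z (M i) v} + 2 := by
      have hsub : ({v | ¬ Good side Z σ v} : Finset W) ⊆
          insert y (insert (M i y) ({v | ¬ Good side Z (M i) v} : Finset W)) := by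
        intro v
        simp only [Finset.mem_filter, Finset.mem_univ, true_and, Finset.mem_insert]
        intro h
        by_contra! h'
        obtain ⟨h1, h2, h3⟩ := h'
        have h4 : v ≠ a := by rintro rfl; exact h3.2.2.1 ha
        unfold Good at h h3
        rw [hσo v h4 h1 h2] at h
        exact h h3
      refine (Finset.card_le_card hsub).trans ((Finset.card_insert_le _ _).trans ?_)
      have := Finset.card_insert_le (M i y) ({v | ¬ Good side Z (M i) v} : Finset W)
      omega
    omega
  · intro c hca hcc
    have h1 : c ≠ y := by rintro rfl; exact hyne hcc
    have h2 : c ≠ M i y := by rintro rfl; rw [hyy] at hcc; exact hyne hcc.symm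
    have h3 := hcnt c (M i y) h2
    have h4 : edge a y c (M i y) = 0 := by simp [edge, hca, h1]
    omega

/-- Vertices on the other side, outside `Z`, joined to `v` by an unused edge. -/
def avail (side : W → Bool) (Z : Finset W) (w : W → W → ℕ) (M : ι → W → W) (v : W) : Finset W :=
  {y | side v ≠ side y ∧ y ∉ Z ∧ cnt M v y < w v y}

theorem Valid.le_card_avail (hM : Valid side Z w r M₀ M) {v : W} (hv : v ∉ Z) {N : ℕ}
    (hN : N ≤ #{y | side v ≠ side y ∧ y ∉ Z ∧ 0 < w v y}) :
    N ≤ #(avail side Z w M v) + r := by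
  have h1 : #{y | side v ≠ side y ∧ y ∉ Z ∧ 0 < w v y} ≤ #(avail side Z w M v) +
      #{y | side v ≠ side y ∧ y ∉ Z ∧ 0 < cnt M v y} := by
    refine le_trans (Finset.card_le_card ?_) (Finset.card_union_le _ _)
    intro y
    simp only [avail, Finset.mem_filter, Finset.mem_univ, true_and, Finset.mem_union]
    rintro ⟨h1, h2, h3⟩
    by_cases h : cnt M v y < w v y
    · exact Or.inl ⟨h1, h2, h⟩
    · exact Or.inr ⟨h1, h2, by omega⟩
  have h2 : #{y | side v ≠ side y ∧ y ∉ Z ∧ 0 < cnt M v y} ≤ ∑ i, crossAt side Z (M i) v := by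
    have h3 : ({y | side v ≠ side y ∧ y ∉ Z ∧ 0 < cnt M v y} : Finset W) ⊆
        ({i | side (M i v) ≠ side v ∧ M i v ∉ Z} : Finset ι).image (fun i => M i v) := by
      intro y
      simp only [Finset.mem_filter, Finset.mem_univ, true_and, Finset.mem_image]
      rintro ⟨h1, h2, h3⟩
      rw [cnt_eq_card, Finset.card_pos] at h3
      obtain ⟨i, hi⟩ := h3
      simp only [Finset.mem_filter, Finset.mem_univ, true_and] at hi
      subst hi
      exact ⟨i, ⟨h1.symm, h2⟩, rfl⟩
    refine (Finset.card_le_card h3).trans (Finset.card_image_le.trans ?_)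
    rw [Finset.card_filter]
    refine Finset.sum_le_sum fun i _ => ?_
    unfold crossAt
    split_ifs <;> simp_all
  have := hM.cross v hv
  omega

theorem card_saturated_le {b q : ℕ} (hb : ∀ i, defect side Z (M i) ≤ b)
    (hq : Fintype.card ι * b < r * (q + 1)) :
    #{v | r ≤ ∑ i, crossAt side Z (M i) v} ≤ q := by
  by_contra! h
  have h1 : #{v | r ≤ ∑ i, crossAt side Z (M i) v} * r ≤ ∑ v, ∑ i, crossAt side Z (M i) v := by
    refine le_trans ?_ (Finset.sum_le_univ_sum_of_nonneg
      (s := ({v | r ≤ ∑ i, crossAt side Z (M i) v} : Finset W)) (fun _ => Nat.zero_le _))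
    rw [← smul_eq_mul]
    exact Finset.card_nsmul_le_sum _ _ _ fun v hv => by simpa using hv
  rw [Finset.sum_comm] at h1
  have h2 : ∑ i, ∑ v, crossAt side Z (M i) v ≤ ∑ i : ι, b := by
    refine Finset.sum_le_sum fun i _ => le_trans ?_ (hb i)
    refine le_trans ?_ (Nat.le_add_right _ _)
    rw [Finset.card_filter]
    refine Finset.sum_le_sum fun v _ => ?_
    unfold crossAt Good
    split_ifs <;> simp_all
  rw [Finset.sum_const, Finset.card_univ, smul_eq_mul] at h2
  nlinarith

theorem Valid.pair_move (hw : ∀ p q, w p q = w q p) (hM : Valid side Z w r M₀ M)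
    (hZ : ∀ i, ∀ z ∈ Z, M₀ i z ≠ z) {n N b q : ℕ} (hn : ∀ β, #{v | side v = β} ≤ n)
    (hN : ∀ v, v ∉ Z → N ≤ #{y | side v ≠ side y ∧ y ∉ Z ∧ 0 < w v y})
    (hb : ∀ i, defect side Z (M i) ≤ b) (hq : Fintype.card ι * b < r * (q + 1))
    (hlarge : n + 2 * (r + b + q) < 2 * N) (i : ι) {a c : W} (hac : a ≠ c)
    (ha : M i a = a) (hc : M i c = c) (hside : side a = side c) :
    ∃ σ : W → W, Valid side Z w r M₀ (update M i σ) ∧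
      #{v | σ v = v} + 2 = #{v | M i v = v} ∧ defect side Z σ + 2 ≤ defect side Z (M i) := by
  have haZ : a ∉ Z := fun h => hZ i a h (by rw [← hM.eqOn i a h, ha])
  have hcZ : c ∉ Z := fun h => hZ i c h (by rw [← hM.eqOn i c h, hc])
  have hinv := hM.inv i
  set X : W → Finset W := fun v => {y ∈ avail side Z w M v |
    Good side Z (M i) y ∧ ∑ i, crossAt side Z (M i) y < r} with hX
  have hXcard : ∀ v, v ∉ Z → N ≤ #(X v) + r + b + q := by
    intro v hv
    have h1 := hM.le_card_avail hv (hN v hv)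
    have h2 := card_saturated_le hb hq
    have h3 : #{v | ¬ Good side Z (M i) v} ≤ b := (Nat.le_add_right _ _).trans (hb i)
    have h4 : avail side Z w M v ⊆ X v ∪ (({v | ¬ Good side Z (M i) v} : Finset W) ∪
        ({v | r ≤ ∑ i, crossAt side Z (M i) v} : Finset W)) := by
      intro y hy
      simp only [hX, Finset.mem_union, Finset.mem_filter, Finset.mem_univ, true_and, hy]
      by_cases h5 : Good side Z (M i) y
      · by_cases h6 : ∑ i, crossAt side Z (M i) y < r
        · exact Or.inl ⟨h5, h6⟩
        · exact Or.inr (Or.inr (not_lt.1 h6))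
      · exact Or.inr (Or.inl h5)
    have h5 := Finset.card_le_card h4
    have h6 := Finset.card_union_le (X v) (({v | ¬ Good side Z (M i) v} : Finset W) ∪
        ({v | r ≤ ∑ i, crossAt side Z (M i) v} : Finset W))
    have h7 := Finset.card_union_le ({v | ¬ Good side Z (M i) v} : Finset W)
        {v | r ≤ ∑ i, crossAt side Z (M i) v}
    omega
  have hXside : ∀ v, ∀ y ∈ X v, side y = !(side v) := by
    intro v y hy
    simp only [hX, avail, Finset.mem_filter, Finset.mem_univ, true_and] at hy
    have := hy.1.1
    cases h1 : side y <;> cases h2 : side v <;> simp_all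
  have hint : ¬ Disjoint (X a) ((X c).image (M i)) := by
    intro hdis
    have h1 := Finset.card_union_of_disjoint hdis
    rw [Finset.card_image_of_injective _ hinv.injective] at h1
    have h2 : X a ∪ (X c).image (M i) ⊆ ({v | side v = !(side a)} : Finset W) := by
      intro y hy
      simp only [Finset.mem_filter, Finset.mem_univ, true_and]
      rcases Finset.mem_union.1 hy with hy | hy
      · exact hXside a y hy
      · obtain ⟨y', hy', rfl⟩ := Finset.mem_image.1 hy
        have hg : Good side Z (M i) y' := by
          simp only [hX, Finset.mem_filter] at hy'
          exact hy'.2.1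
        rw [hg.2.2.2, hXside c y' hy', hside]
    have h3 := Finset.card_le_card h2
    have h4 := hn (!(side a))
    have h5 := hXcard a haZ
    have h6 := hXcard c hcZ
    omega
  obtain ⟨y, hya, hyc⟩ := Finset.not_disjoint_iff.1 hint
  obtain ⟨y', hy', hyy'⟩ := Finset.mem_image.1 hyc
  have hy'' : M i y = y' := by rw [← hyy', hinv]
  have hysa := hXside a y hya
  have hysc := hXside c y' hy'
  simp only [hX, avail, Finset.mem_filter, Finset.mem_univ, true_and] at hya hy'
  obtain ⟨h1, h2, h3, h4, h5, h6⟩ := hM.half_move hw hZ i ha hya.2.1 hya.1.1 hya.1.2.2 hya.2.2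
    (by rw [hy'']; exact hy'.2.2)
  have hcc : link (unlink (M i) y) a y c = c := by
    rw [h5 c hac.symm, hc]
    · rintro rfl; exact hya.2.1.2.2.1 hc
    · rw [hy'']
      rintro rfl; exact hy'.2.1.2.2.1 hc
  set σ := link (unlink (M i) y) a y
  have hσ : update M i σ i = σ := update_self _ _ _
  obtain ⟨g1, g2, g3⟩ := h1.link_move hw hZ i (c := c) (d := y') (by rw [hσ, hcc])
    (by rw [hσ, ← hy'', h4]) hy'.1.1 (by
      have := h6 c hac.symm hc
      rw [hy''] at this
      exact this.trans_lt hy'.1.2.2)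
  rw [hσ, update_idem] at g1
  rw [hσ] at g2 g3
  exact ⟨_, g1, by omega, by omega⟩

/-- Near-perfect matchings can be completed to perfect ones, creating few cross edges. -/
theorem Valid.exists_perfect (hw : ∀ p q, w p q = w q p) (hM : Valid side Z w r M₀ M)
    (hZ : ∀ i, ∀ z ∈ Z, M₀ i z ≠ z) {n N b q : ℕ} (hn : ∀ β, #{v | side v = β} ≤ n)
    (hW : Even (Fintype.card W))
    (hN : ∀ v, v ∉ Z → N ≤ #{y | side v ≠ side y ∧ y ∉ Z ∧ 0 < w v y})
    (hb : ∀ i, defect side Z (M i) ≤ b) (hq : Fintype.card ι * (b + 2) < r * (q + 1))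
    (hlarge : n + 2 * (r + b + 2 + 2 * q) < 2 * N) :
    ∃ M' : ι → W → W, Valid side Z w r M₀ M' ∧ ∀ i v, M' i v ≠ v := by
  induction hm : ∑ i, #{v | M i v = v} using Nat.strong_induction_on generalizing M with
  | _ m ih =>
    subst hm
    by_cases hp : ∀ i v, M i v ≠ v
    · exact ⟨M, hM, hp⟩
    push Not at hp
    obtain ⟨i, a, ha⟩ := hp
    have hev := even_card_fixed (hM.inv i) hW
    have hone : 1 < #{v | M i v = v} := by
      have : 0 < #{v | M i v = v} := Finset.card_pos.2 ⟨a, by simpa using ha⟩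
      obtain ⟨k, hk⟩ := hev
      omega
    obtain ⟨c, hc, hca⟩ := Finset.exists_mem_ne hone a
    simp only [Finset.mem_filter, Finset.mem_univ, true_and] at hc
    have hq0 : Fintype.card ι * b < r * (q + 1) := by nlinarith
    have finish : ∀ σ : W → W, Valid side Z w r M₀ (update M i σ) →
        #{v | σ v = v} + 2 = #{v | M i v = v} → defect side Z σ ≤ b →
        ∃ M' : ι → W → W, Valid side Z w r M₀ M' ∧ ∀ i v, M' i v ≠ v := by
      intro σ h1 h2 h3
      refine ih _ ?_ h1 ?_ rfl
      · have := sum_update M i σ (fun σ => #{v | σ v = v})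
        omega
      · intro j
        by_cases hj : j = i
        · subst hj; rwa [update_self]
        · rw [update_of_ne hj]; exact hb j
    by_cases hside : side a = side c
    · obtain ⟨σ, h1, h2, h3⟩ := hM.pair_move hw hZ hn hN hb hq0 (by omega) i hca.symm ha hc hside
      exact finish σ h1 h2 (by have := hb i; omega)
    · have haZ : a ∉ Z := fun h => hZ i a h (by rw [← hM.eqOn i a h, ha])
      have hex : ∃ y ∈ avail side Z w M a, Good side Z (M i) y ∧
          ∑ i, crossAt side Z (M i) y < r ∧ ∑ j, crossAt side Z (M j) (M i y) < r := by
        by_contra! hno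
        have h1 := hM.le_card_avail haZ (hN a haZ)
        have h2 := card_saturated_le hb hq0
        have h3 : #{v | ¬ Good side Z (M i) v} ≤ b := (Nat.le_add_right _ _).trans (hb i)
        set S : Finset W := {v | r ≤ ∑ i, crossAt side Z (M i) v} with hS
        have h4 : avail side Z w M a ⊆ ({v | ¬ Good side Z (M i) v} : Finset W) ∪
            (S ∪ S.image (M i)) := by
          intro y hy
          simp only [Finset.mem_union, Finset.mem_image]
          by_cases h5 : Good side Z (M i) y
          · by_cases h6 : ∑ i, crossAt side Z (M i) y < r
            · exact Or.inr (Or.inr ⟨M i y, by simpa [hS] using hno y hy h5 h6, hM.inv i y⟩)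
            · exact Or.inr (Or.inl (by simpa [hS] using h6))
          · exact Or.inl (by simpa using h5)
        have h5 := Finset.card_le_card h4
        have h6 := Finset.card_union_le ({v | ¬ Good side Z (M i) v} : Finset W)
          (S ∪ S.image (M i))
        have h7 := Finset.card_union_le S (S.image (M i))
        have h8 : #(S.image (M i)) ≤ #S := Finset.card_image_le
        omega
      obtain ⟨y, hy, hyg, hy1, hy2⟩ := hex
      simp only [avail, Finset.mem_filter, Finset.mem_univ, true_and] at hy
      obtain ⟨h1, h2, h3, h4, h5, h6⟩ := hM.half_move hw hZ i ha hyg hy.1 hy.2.2 hy1 hy2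
      have hcy : c ≠ M i y := by
        rintro rfl
        rw [hM.inv i y] at hc
        exact hyg.2.2.1 hc.symm
      have hcc : link (unlink (M i) y) a y c = c := by
        rw [h5 c hca _ hcy, hc]
        rintro rfl; exact hyg.2.2.1 hc
      set σ := link (unlink (M i) y) a y
      have hσ : update M i σ i = σ := update_self _ _ _
      have hb' : ∀ j, defect side Z (update M i σ j) ≤ b + 2 := by
        intro j
        have := hb i
        by_cases hj : j = i
        · subst hj; rw [hσ]; omega
        · rw [update_of_ne hj]; have := hb j; omega
      obtain ⟨σ', g1, g2, g3⟩ := h1.pair_move hw hZ hn hN hb' hq (by omega) i hcy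
        (by rw [hσ, hcc]) (by rw [hσ, h4]) (by
          rw [hyg.2.2.2]
          have := hy.1
          cases e1 : side a <;> cases e2 : side c <;> cases e3 : side y <;> simp_all)
      rw [update_idem] at g1
      rw [hσ] at g2 g3
      exact finish σ' g1 (by omega) (by have := hb i; omega)

end Perfecting

section Completing

variable {W : Type*} [DecidableEq W]

theorem hall_of_dense {P Q Z : Finset W} (hcard : #P = #Q) (r : W → W → Prop) [DecidableRel r]
    (h1 : ∀ p ∈ P, p ∉ Z → #Q < 2 * #{q ∈ Q | r p q})
    (h2 : ∀ q ∈ Q, q ∉ Z → #P < 2 * #{p ∈ P | r p q})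
    (h3 : ∀ p ∈ P, #Z ≤ #{q ∈ Q | r p q}) (h4 : ∀ q ∈ Q, #Z ≤ #{p ∈ P | r p q}) :
    ∀ S ⊆ P, #S ≤ #{q ∈ Q | ∃ p ∈ S, r p q} := by
  intro S hS
  set N : Finset W := {q ∈ Q | ∃ p ∈ S, r p q} with hN
  have hsub : ∀ p ∈ S, #{q ∈ Q | r p q} ≤ #N := fun p hp =>
    Finset.card_le_card fun q hq => by
      simp only [Finset.mem_filter, hN] at hq ⊢
      exact ⟨hq.1, p, hp, hq.2⟩
  have hco : ∀ q ∈ Q, q ∉ N → #{p ∈ P | r p q} + #S ≤ #P := by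
    intro q hq hqN
    rw [← Finset.card_union_of_disjoint]
    · exact Finset.card_le_card (Finset.union_subset (Finset.filter_subset _ _) hS)
    · rw [Finset.disjoint_left]
      intro p hp hpS
      apply hqN
      simp only [hN, Finset.mem_filter] at hp ⊢
      exact ⟨hq, p, hpS, hp.2⟩
  by_cases hSZ : S ⊆ Z
  · rcases S.eq_empty_or_nonempty with rfl | ⟨p, hp⟩
    · simp
    · exact (Finset.card_le_card hSZ).trans ((h3 p (hS hp)).trans (hsub p hp))
  · obtain ⟨p, hp, hpZ⟩ := Finset.not_subset.1 hSZ
    have h5 := h1 p (hS hp) hpZ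
    have h6 := hsub p hp
    by_cases hbig : 2 * #S ≤ #P
    · omega
    have hQN : Q \ N ⊆ Z := by
      intro q hq
      rw [Finset.mem_sdiff] at hq
      by_contra hqZ
      have := h2 q hq.1 hqZ
      have := hco q hq.1 hq.2
      omega
    have h7 : #(Q \ N) + #N = #Q := Finset.card_sdiff_add_card_eq_card (Finset.filter_subset _ _)
    rcases (Q \ N).eq_empty_or_nonempty with he | ⟨q, hq⟩
    · rw [he, Finset.card_empty] at h7
      have := Finset.card_le_card hS
      omega
    · rw [Finset.mem_sdiff] at hq
      have := hco q hq.1 hq.2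
      have := h4 q hq.1
      have := Finset.card_le_card hQN
      omega

variable [Fintype W] {κ : Type*} [Fintype κ]

set_option maxHeartbeats 1000000 in
/-- Partial matchings which use up all edges inside the sides can be completed to a
factorization. -/
theorem factorable_of_partial [DecidableEq κ] {side : W → Bool} {w : W → W → ℕ} {d n cap : ℕ}
    {Z : Finset W} (hw : ∀ p q, w p q = w q p) (hdiag : ∀ p, w p p = 0)
    (hreg : ∀ p, ∑ q, w p q = d) (hn : ∀ β, #{v | side v = β} ≤ n)
    {τ : κ → W → W} (hτ : ∀ j, Involutive (τ j))
    (hle : ∀ p q, p ≠ q → cnt τ p q ≤ w p q)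
    (hinner : ∀ p q, p ≠ q → side p = side q → cnt τ p q = w p q)
    (hbal : ∀ j, #{v | side v = true ∧ τ j v = v} = #{v | side v = false ∧ τ j v = v})
    {x : W} (hx : ∀ j, τ j x ≠ x) (hcap : ∀ j, #{v | τ j v ≠ v} ≤ cap)
    (h1 : ∀ v, v ∉ Z → v ≠ x →
      n + 2 * (Fintype.card κ + cap) < 2 * #{y | side v ≠ side y ∧ 0 < w v y})
    (h2 : ∀ v, v ≠ x → #Z + Fintype.card κ + cap ≤ #{y | side v ≠ side y ∧ 0 < w v y}) :
    Factorable w d := by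
  have key : ∀ s : Finset κ, ∃ M : κ → W → W, (∀ j, Involutive (M j)) ∧
      (∀ p q, p ≠ q → cnt M p q ≤ w p q) ∧ (∀ j p, τ j p ≠ p → M j p = τ j p) ∧
      (∀ j ∈ s, ∀ v, M j v ≠ v) ∧ ∀ j ∉ s, M j = τ j := by
    intro s
    induction s using Finset.induction_on with
    | empty => exact ⟨τ, hτ, hle, fun _ _ _ => rfl, by simp, fun _ _ => rfl⟩
    | insert j s hj ih =>
      obtain ⟨M, hM, hMle, hext, hperf, hrest⟩ := ih
      have hMj := hrest j hj
      have hdeg : ∀ v β, side v ≠ β →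
          #{y | side v ≠ side y ∧ 0 < w v y} ≤
            #{y ∈ ({y | side y = β ∧ τ j y = y} : Finset W) | cnt M v y < w v y} +
            (Fintype.card κ + cap) := by
        intro v β hvβ
        have hsub : ({y | side v ≠ side y ∧ 0 < w v y} : Finset W) ⊆
            ({y ∈ ({y | side y = β ∧ τ j y = y} : Finset W) | cnt M v y < w v y} : Finset W) ∪
            (univ.image (fun i => M i v) ∪ ({v | τ j v ≠ v} : Finset W)) := by
          intro y
          simp only [Finset.mem_filter, Finset.mem_univ, true_and, Finset.mem_union,
            Finset.mem_image]
          rintro ⟨e1, e2⟩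
          by_cases e3 : τ j y = y
          · by_cases e4 : cnt M v y < w v y
            · refine Or.inl ⟨⟨?_, e3⟩, e4⟩
              revert e1 hvβ
              cases side v <;> cases side y <;> cases β <;> simp
            · have : 0 < cnt M v y := by omega
              rw [cnt_eq_card, Finset.card_pos] at this
              obtain ⟨i, hi⟩ := this
              exact Or.inr (Or.inl ⟨i, by simpa using hi⟩)
          · exact Or.inr (Or.inr e3)
        refine (Finset.card_le_card hsub).trans ((Finset.card_union_le _ _).trans ?_)
        have e1 := Finset.card_union_le (univ.image (fun i => M i v)) ({v | τ j v ≠ v} : Finset W)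
        have e2 : #(univ.image (fun i => M i v)) ≤ Fintype.card κ :=
          Finset.card_image_le.trans (by simp)
        have e3 := hcap j
        omega
      set P : Finset W := {v | side v = true ∧ τ j v = v} with hP
      set Q : Finset W := {v | side v = false ∧ τ j v = v} with hQ
      have hPn : #P ≤ n := (Finset.card_le_card fun v => by
        simp only [hP, Finset.mem_filter, Finset.mem_univ, true_and]
        exact fun h => h.1).trans (hn true)
      have hPx : ∀ p ∈ P, p ≠ x := by
        rintro p hp rfl
        simp only [hP, Finset.mem_filter] at hp
        exact hx j hp.2.2
      have hQx : ∀ p ∈ Q, p ≠ x := by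
        rintro p hp rfl
        simp only [hQ, Finset.mem_filter] at hp
        exact hx j hp.2.2
      have hPs : ∀ p ∈ P, side p ≠ false := by
        intro p hp
        simp only [hP, Finset.mem_filter] at hp
        simp [hp.2.1]
      have hQs : ∀ p ∈ Q, side p ≠ true := by
        intro p hp
        simp only [hQ, Finset.mem_filter] at hp
        simp [hp.2.1]
      have hsw : ∀ q, ({p ∈ P | cnt M p q < w p q} : Finset W) =
          {p ∈ P | cnt M q p < w q p} := fun q => by
        ext p
        simp only [Finset.mem_filter]
        rw [cnt_symm hM, hw]
      have hPQ : #P = #Q := hbal j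
      obtain ⟨σ, hσ, hσP, hσQ, hσo⟩ := exists_involution_of_hall (P := P) (Q := Q)
        (by
          rw [Finset.disjoint_left]
          intro v hv hv'
          exact hQs v hv' (Bool.eq_true_of_not_eq_false (hPs v hv))) hPQ (fun p q => cnt M p q < w p q)
        (hall_of_dense (Z := Z) hPQ _
          (fun p hp hpZ => by
            have e1 := hdeg p false (hPs p hp)
            have e2 := h1 p hpZ (hPx p hp)
            rw [← hQ] at e1
            omega)
          (fun q hq hqZ => by
            have e1 := hdeg q true (hQs q hq)
            have e2 := h1 q hqZ (hQx q hq)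
            rw [← hP] at e1
            rw [hsw]
            omega)
          (fun p hp => by
            have e1 := hdeg p false (hPs p hp)
            have e2 := h2 p (hPx p hp)
            rw [← hQ] at e1
            omega)
          (fun q hq => by
            have e1 := hdeg q true (hQs q hq)
            have e2 := h2 q (hQx q hq)
            rw [← hP] at e1
            rw [hsw]
            omega)) (hτ j) (by
          intro v hv
          simp only [hP, hQ, Finset.mem_filter] at hv
          rcases hv with hv | hv
          · exact hv.2.2
          · exact hv.2.2)
      have hmem : ∀ v, τ j v = v → v ∈ P ∨ v ∈ Q := by
        intro v hv
        simp only [hP, hQ, Finset.mem_filter, Finset.mem_univ, true_and, hv, and_true]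
        cases side v <;> simp
      have hnot : ∀ v, τ j v ≠ v → v ∉ P ∧ v ∉ Q := by
        intro v hv
        simp [hP, hQ, hv]
      have hσne : ∀ v, σ v ≠ v := by
        intro v hv
        by_cases h : τ j v = v
        · rcases hmem v h with h' | h'
          · have e1 := (hσP v h').1
            rw [hv] at e1
            exact hQs v e1 (Bool.eq_true_of_not_eq_false (hPs v h'))
          · have e1 := hσQ v h'
            rw [hv] at e1
            exact hQs v h' (Bool.eq_true_of_not_eq_false (hPs v e1))
        · rw [hσo v (hnot v h).1 (hnot v h).2] at hv
          exact h hv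
      refine ⟨update M j σ, update_involutive hM _ hσ, ?_, ?_, ?_, ?_⟩
      · intro p q hpq
        have e1 := cnt_update M j σ p q
        have e2 := hMle p q hpq
        by_cases hp : τ j p = p
        · by_cases hpσ : σ p = q
          · have e3 : ind σ p q ≤ 1 := by simp [ind, hpσ]
            have e4 : cnt M p q < w p q := by
              rcases hmem p hp with h | h
              · rw [← hpσ]; exact (hσP p h).2
              · have := (hσP _ (hσQ p h)).2
                rw [hσ p, hpσ] at this
                rwa [cnt_symm hM, hw]
            omega
          · have e3 : ind σ p q = 0 := by simp [ind, hpσ]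
            omega
        · have e3 : ind σ p q = ind (M j) p q := by
            unfold ind
            rw [hσo p (hnot p hp).1 (hnot p hp).2, hMj]
          omega
      · intro i p hp
        by_cases hij : i = j
        · subst hij
          rw [update_self, hσo p (hnot p hp).1 (hnot p hp).2]
        · rw [update_of_ne hij]
          exact hext i p hp
      · intro i hi v
        by_cases hij : i = j
        · subst hij
          rw [update_self]
          exact hσne v
        · rw [update_of_ne hij]
          exact hperf i (Finset.mem_of_mem_insert_of_ne hi hij) v
      · intro i hi
        rw [Finset.mem_insert, not_or] at hi
        rw [update_of_ne hi.1]
        exact hrest i hi.2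
  obtain ⟨M, hM, hMle, hext, hperf, -⟩ := key univ
  have hperf' : ∀ j v, M j v ≠ v := fun j => hperf j (mem_univ j)
  have hle' : ∀ p q, cnt M p q ≤ w p q := by
    intro p q
    by_cases h : p = q
    · subst h
      rw [cnt_eq_card]
      simp [hperf']
    · exact hMle p q h
  have hk : ∀ p : W, Fintype.card κ ≤ d := fun p => by
    rw [← sum_cnt M p, ← hreg p]
    exact Finset.sum_le_sum fun q _ => hle' p q
  have hfac := (factorable_of_bipartite side (d - Fintype.card κ) (fun p q => w p q - cnt M p q)
    (fun p q => by rw [hw, cnt_symm hM])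
    (fun p q hpq => by
      by_cases h : p = q
      · subst h; simp [hdiag]
      · have e1 := hinner p q h hpq
        have e2 : cnt τ p q ≤ cnt M p q := by
          refine Finset.sum_le_sum fun j _ => ?_
          unfold ind
          split_ifs with h3 h4
          · rfl
          · exact absurd ((hext j p (by rw [h3]; exact Ne.symm h)).trans h3) h4
          all_goals simp
        omega)
    (fun p => by
      rw [Finset.sum_tsub_distrib _ (fun q _ => hle' p q), hreg, sum_cnt])).add_cnt hM hperf'
    (w' := w) (fun p q => (Nat.sub_add_cancel (hle' p q)).symm)
  rwa [Nat.sub_add_cancel (hk x)] at hfac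

end Completing

section Greedy

variable {W : Type*} [DecidableEq W] [Fintype W] {κ : Type*} [Fintype κ]

/-- The number of vertices on side `β` covered by `σ`. -/
def cov (side : W → Bool) (σ : W → W) (β : Bool) : ℕ := #{v | side v = β ∧ σ v ≠ v}

/-- The state of the greedy distribution of the inner edges: `u` is still to be placed. -/
structure Partial (side : W → Bool) (w : W → W → ℕ) (x : W) (X : W → ℕ) (τ : κ → W → W)
    (u : W → W → ℕ) : Prop where
  inv : ∀ j, Involutive (τ j)
  symm : ∀ p q, u p q = u q p
  diag : ∀ p, u p p = 0
  cross : ∀ p q, side p ≠ side q → u p q = 0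
  atx : ∀ p, u p x = 0
  covx : ∀ j, τ j x ≠ x
  inner : ∀ p q, p ≠ q → side p = side q → cnt τ p q + u p q = w p q
  cntx : ∀ v, v ≠ x → cnt τ v x = X v
  cnt_cross : ∀ p q, p ≠ x → q ≠ x → side p ≠ side q → cnt τ p q = 0

variable {side : W → Bool} {w : W → W → ℕ} {x : W} {X : W → ℕ} {τ : κ → W → W} {u : W → W → ℕ}

theorem card_covered (τ : κ → W → W) (v : W) :
    #{j | τ j v ≠ v} = ∑ q, if q = v then 0 else cnt τ v q := by
  have h1 := sum_cnt τ v
  rw [← Finset.add_sum_erase _ _ (mem_univ v), cnt_eq_card, ← Finset.card_univ,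
    ← Finset.card_filter_add_card_filter_not (s := univ) (fun j => τ j v = v)] at h1
  rw [← Finset.add_sum_erase univ (fun q => if q = v then 0 else cnt τ v q) (mem_univ v),
    if_pos rfl, zero_add, ← Nat.add_left_cancel h1]
  refine Finset.sum_congr rfl fun q hq => ?_
  rw [if_neg (Finset.ne_of_mem_erase hq)]

theorem Partial.card_covered_le (h : Partial side w x X τ u) {r : ℕ} {v : W} (hv : v ≠ x)
    (hr : ∑ q, (if side q = side v ∧ q ≠ x then w v q else 0) ≤ r) :
    #{j | τ j v ≠ v} ≤ r + X v := by
  rw [card_covered]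
  have h1 : ∑ q, (if q = x then X v else 0) = X v := by simp
  rw [← h1]
  refine le_trans ?_ (Nat.add_le_add_right hr _)
  rw [← Finset.sum_add_distrib]
  refine Finset.sum_le_sum fun q _ => ?_
  by_cases hqv : q = v
  · simp [hqv]
  · by_cases hqx : q = x
    · subst hqx
      simp [hqv, h.cntx v hv]
    · by_cases hs : side q = side v
      · have := h.inner v q (Ne.symm hqv) hs.symm
        simp only [hqv, hqx, hs, if_false, ne_eq, not_false_eq_true, and_self, if_true]
        omega
      · simp [hqv, hqx, h.cnt_cross v q hv hqx (Ne.symm hs)]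

theorem Partial.sum_covered (h : Partial side w x X τ u) (hdiag : ∀ p, w p p = 0) (β : Bool) :
    ∑ v with side v = β, ∑ q, u v q + ∑ j, cov side (τ j) β =
      ∑ v with side v = β, ∑ q with side q = β, w v q +
        ∑ v with side v = β, ∑ q with side q ≠ β, cnt τ v q := by
  have h1 : ∑ j, cov side (τ j) β = ∑ v with side v = β, #{j | τ j v ≠ v} := by
    simp only [cov, Finset.card_filter]
    rw [Finset.sum_comm, Finset.sum_filter]
    refine Finset.sum_congr rfl fun v _ => ?_
    by_cases hv : side v = β <;> simp [hv]
  rw [h1, ← Finset.sum_add_distrib, ← Finset.sum_add_distrib]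
  refine Finset.sum_congr rfl fun v hv => ?_
  simp only [Finset.mem_filter, Finset.mem_univ, true_and] at hv
  rw [card_covered, ← Finset.sum_add_distrib, Finset.sum_filter, Finset.sum_filter,
    ← Finset.sum_add_distrib]
  refine Finset.sum_congr rfl fun q _ => ?_
  by_cases hqv : q = v
  · subst hqv
    simp [hv, h.diag, hdiag]
  · by_cases hq : side q = β
    · have := h.inner v q (Ne.symm hqv) (hv.trans hq.symm)
      simp only [hqv, hq, if_true, if_false, ne_eq, not_true_eq_false]
      omega
    · have := h.cross v q (by rw [hv]; exact Ne.symm hq)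
      simp [hqv, hq, this]

theorem Partial.balance (h : Partial side w x X τ u) (hdiag : ∀ p, w p p = 0)
    (hb : ∑ v with side v = true, ∑ q with side q = true, w v q =
      ∑ v with side v = false, ∑ q with side q = false, w v q) :
    ∑ v with side v = true, ∑ q, u v q + ∑ j, cov side (τ j) true =
      ∑ v with side v = false, ∑ q, u v q + ∑ j, cov side (τ j) false := by
  rw [h.sum_covered hdiag, h.sum_covered hdiag, hb]
  congr 1
  simp only [ne_eq, Bool.not_eq_true, Bool.not_eq_false]
  rw [Finset.sum_comm]
  refine Finset.sum_congr rfl fun v _ => Finset.sum_congr rfl fun q _ => ?_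
  exact cnt_symm h.inv _ _

theorem cov_link {σ : W → W} {p q : W} (hp : σ p = p) (hq : σ q = q) (hpq : p ≠ q)
    (hs : side p = side q) (β : Bool) :
    cov side (link σ p q) β = cov side σ β + if side p = β then 2 else 0 := by
  have hlp : link σ p q p = q := by simp [link]
  have hlq : link σ p q q = p := by simp [link, hpq.symm]
  have hlo : ∀ v, v ≠ p → v ≠ q → link σ p q v = σ v := fun v h1 h2 => by simp [link, h1, h2]
  unfold cov
  split_ifs with h
  · have : ({v | side v = β ∧ link σ p q v ≠ v} : Finset W) =
        insert p (insert q ({v | side v = β ∧ σ v ≠ v} : Finset W)) := by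
      ext v
      simp only [Finset.mem_filter, Finset.mem_univ, true_and, Finset.mem_insert]
      by_cases h1 : v = p
      · grind
      · by_cases h2 : v = q <;> grind
    rw [this, Finset.card_insert_of_notMem, Finset.card_insert_of_notMem]
    · simp [hq]
    · simp [hp, hpq]
  · rw [add_zero]
    congr 1
    ext v
    simp only [Finset.mem_filter, Finset.mem_univ, true_and]
    by_cases h1 : v = p
    · grind
    · by_cases h2 : v = q <;> grind

theorem Partial.add_edge [DecidableEq κ] (h : Partial side w x X τ u) {p q : W} (hu : 0 < u p q)
    {j : κ} (hp : τ j p = p) (hq : τ j q = q) :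
    Partial side w x X (update τ j (link (τ j) p q)) (fun a b => u a b - edge p q a b) ∧
      ∑ a, ∑ b, (u a b - edge p q a b) < ∑ a, ∑ b, u a b := by
  have hpq : p ≠ q := by rintro rfl; rw [h.diag] at hu; exact absurd hu (lt_irrefl 0)
  have hs : side p = side q := by
    by_contra hs
    rw [h.cross p q hs] at hu
    exact absurd hu (lt_irrefl 0)
  have hqx : q ≠ x := by rintro rfl; rw [h.atx] at hu; exact absurd hu (lt_irrefl 0)
  have hpx : p ≠ x := by rintro rfl; rw [h.symm, h.atx] at hu; exact absurd hu (lt_irrefl 0)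
  have hcnt : ∀ a b, a ≠ b → cnt (update τ j (link (τ j) p q)) a b = cnt τ a b + edge p q a b := by
    intro a b hab
    have := cnt_update τ j (link (τ j) p q) a b
    have := ind_link hp hq hpq hab
    omega
  have hle : ∀ a b, edge p q a b ≤ u a b := by
    intro a b
    unfold edge
    split_ifs with h'
    · rcases h' with ⟨rfl, rfl⟩ | ⟨rfl, rfl⟩
      · exact hu
      · rw [h.symm]; exact hu
    · exact Nat.zero_le _
  refine ⟨⟨update_involutive h.inv _ (link_involutive (h.inv j) hp hq), ?_, ?_, ?_, ?_, ?_, ?_,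
    ?_, ?_⟩, ?_⟩
  · intro a b
    rw [h.symm, edge_symm]
  · intro a
    simp [h.diag]
  · intro a b hab
    simp [h.cross a b hab]
  · intro a
    simp [h.atx]
  · intro i
    by_cases hij : i = j
    · subst hij
      simp [link, hpx.symm, hqx.symm, h.covx i]
    · rw [update_of_ne hij]
      exact h.covx i
  · intro a b hab hab'
    have e1 := h.inner a b hab hab'
    have e2 := hcnt a b hab
    have e3 := hle a b
    omega
  · intro v hv
    rw [hcnt v x hv, h.cntx v hv]
    simp [edge, hpx.symm, hqx.symm]
  · intro a b ha hb hab
    rw [hcnt a b (by rintro rfl; exact hab rfl), h.cnt_cross a b ha hb hab]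
    have e1 := hle a b
    rw [h.cross a b hab] at e1
    omega
  · refine Finset.sum_lt_sum (fun a _ => Finset.sum_le_sum fun b _ => Nat.sub_le _ _)
      ⟨p, mem_univ _, Finset.sum_lt_sum (fun b _ => Nat.sub_le _ _) ⟨q, mem_univ _, ?_⟩⟩
    rw [edge_eq_one]
    omega

theorem sum_size_eq (side : W → Bool) (τ : κ → W → W) :
    ∑ j, (cov side (τ j) true + cov side (τ j) false) = ∑ v, #{j | τ j v ≠ v} := by
  simp only [Finset.card_filter, cov]
  rw [Finset.sum_comm]
  refine Finset.sum_congr rfl fun j _ => ?_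
  rw [← Finset.sum_add_distrib]
  refine Finset.sum_congr rfl fun v _ => ?_
  cases side v <;> simp

theorem Partial.exists_finished [DecidableEq κ] (h : Partial side w x X τ u)
    (hdiag : ∀ p, w p p = 0)
    (hb : ∑ v with side v = true, ∑ q with side q = true, w v q =
      ∑ v with side v = false, ∑ q with side q = false, w v q)
    {r cap F : ℕ} (hcap : 4 ≤ cap)
    (hr : ∀ v, v ≠ x → ∑ q, (if side q = side v ∧ q ≠ x then w v q else 0) ≤ r)
    (hκ : Fintype.card κ = ∑ v, X v)
    (hF : Fintype.card W * r + 2 * Fintype.card κ < (F + 1) * (cap - 3))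
    (hX : ∀ p q p' q', side p = true → side q = true → side p' = false → side q' = false →
      p ≠ q → p' ≠ q' → 4 * r + X p + X q + X p' + X q' + F < Fintype.card κ)
    (hbal : ∀ j, cov side (τ j) true = cov side (τ j) false ∨
      (cov side (τ j) true = 0 ∧ cov side (τ j) false = 2))
    (hsize : ∀ j, cov side (τ j) true + cov side (τ j) false ≤ cap) :
    ∃ τ' : κ → W → W, Partial side w x X τ' (fun _ _ => 0) ∧
      (∀ j, cov side (τ' j) true = cov side (τ' j) false) ∧
      ∀ j, cov side (τ' j) true + cov side (τ' j) false ≤ cap := by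
  induction hm : ∑ a, ∑ b, u a b using Nat.strong_induction_on generalizing τ u with
  | _ m ih =>
    subst hm
    have hbalance := h.balance hdiag hb
    have hexedge : ∀ β, 0 < ∑ v with side v = β, ∑ q, u v q →
        ∃ p q, side p = β ∧ 0 < u p q := by
      intro β hpos
      by_contra! hno
      have : ∑ v with side v = β, ∑ q, u v q = 0 := by
        refine Finset.sum_eq_zero fun v hv => Finset.sum_eq_zero fun q _ => ?_
        have := hno v q (by simpa using hv)
        omega
      omega
    by_cases hunb : ∃ j, cov side (τ j) true ≠ cov side (τ j) false
    · obtain ⟨j, hj⟩ := hunb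
      have hj' := (hbal j).resolve_left hj
      have hlt : ∑ j, cov side (τ j) true < ∑ j, cov side (τ j) false := by
        refine Finset.sum_lt_sum (fun i _ => ?_) ⟨j, mem_univ j, ?_⟩
        · rcases hbal i with h | h <;> omega
        · omega
      obtain ⟨p, q, hp, hpq⟩ := hexedge true (by omega)
      have hpq' : p ≠ q := by rintro rfl; rw [h.diag] at hpq; exact absurd hpq (lt_irrefl 0)
      have hs : side p = side q := by
        by_contra hs
        rw [h.cross p q hs] at hpq
        exact absurd hpq (lt_irrefl 0)
      have hfree : ∀ v, side v = true → τ j v = v := by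
        intro v hv
        by_contra hne
        have := hj'.1
        rw [cov, Finset.card_eq_zero] at this
        have hmem : v ∈ ({v | side v = true ∧ τ j v ≠ v} : Finset W) := by simp [hv, hne]
        rw [this] at hmem
        simp at hmem
      have hfp := hfree p hp
      have hfq := hfree q (hs ▸ hp)
      obtain ⟨h1, h2⟩ := h.add_edge hpq hfp hfq
      have e1 := cov_link hfp hfq hpq' hs true
      have e2 := cov_link hfp hfq hpq' hs false
      simp only [hp, if_true, Bool.true_eq_false, if_false] at e1 e2
      refine ih _ h2 h1 ?_ ?_ rfl
      · intro i
        by_cases hij : i = j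
        · subst hij
          rw [update_self]
          omega
        · rw [update_of_ne hij]
          exact hbal i
      · intro i
        by_cases hij : i = j
        · subst hij
          rw [update_self]
          omega
        · rw [update_of_ne hij]
          exact hsize i
    · push Not at hunb
      have hsum : ∑ j, cov side (τ j) true = ∑ j, cov side (τ j) false :=
        Finset.sum_congr rfl fun j _ => hunb j
      by_cases hzero : ∑ v with side v = true, ∑ q, u v q = 0
      · have hzero' : ∑ v with side v = false, ∑ q, u v q = 0 := by omega
        have hu : u = fun _ _ => 0 := by
          funext p q
          cases hp : side p
          · exact Finset.sum_eq_zero_iff.1 (Finset.sum_eq_zero_iff.1 hzero' p (by simp [hp])) q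
              (mem_univ q)
          · exact Finset.sum_eq_zero_iff.1 (Finset.sum_eq_zero_iff.1 hzero p (by simp [hp])) q
              (mem_univ q)
        rw [hu] at h
        exact ⟨τ, h, hunb, hsize⟩
      obtain ⟨p, q, hp, hpq⟩ := hexedge true (by omega)
      obtain ⟨p', q', hp', hpq'⟩ := hexedge false (by omega)
      have hne : ∀ {p q}, 0 < u p q → p ≠ q ∧ side p = side q ∧ p ≠ x ∧ q ≠ x := by
        intro p q hu
        refine ⟨?_, ?_, ?_, ?_⟩
        · rintro rfl; rw [h.diag] at hu; exact absurd hu (lt_irrefl 0)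
        · by_contra hs
          rw [h.cross p q hs] at hu
          exact absurd hu (lt_irrefl 0)
        · rintro rfl; rw [h.symm, h.atx] at hu; exact absurd hu (lt_irrefl 0)
        · rintro rfl; rw [h.atx] at hu; exact absurd hu (lt_irrefl 0)
      obtain ⟨hne1, hs1, hpx, hqx⟩ := hne hpq
      obtain ⟨hne2, hs2, hpx', hqx'⟩ := hne hpq'
      have hfull : #{j | cap - 3 ≤ cov side (τ j) true + cov side (τ j) false} ≤ F := by
        by_contra! hgt
        have e1 : #{j | cap - 3 ≤ cov side (τ j) true + cov side (τ j) false} * (cap - 3) ≤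
            ∑ j, (cov side (τ j) true + cov side (τ j) false) := by
          refine le_trans ?_ (Finset.sum_le_univ_sum_of_nonneg
            (s := ({j | cap - 3 ≤ cov side (τ j) true + cov side (τ j) false} : Finset κ))
            (fun _ => Nat.zero_le _))
          rw [← smul_eq_mul]
          exact Finset.card_nsmul_le_sum _ _ _ fun v hv => by simpa using hv
        rw [sum_size_eq] at e1
        have e2 : ∑ v, #{j | τ j v ≠ v} ≤ ∑ v, (r + X v + if v = x then Fintype.card κ else 0) := by
          refine Finset.sum_le_sum fun v _ => ?_
          by_cases hv : v = x
          · rw [if_pos hv]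
            exact (Finset.card_le_univ _).trans (Nat.le_add_left _ _)
          · rw [if_neg hv]
            exact h.card_covered_le hv (hr v hv)
        rw [Finset.sum_add_distrib, Finset.sum_add_distrib, ← hκ] at e2
        simp only [Finset.sum_const, Finset.card_univ, smul_eq_mul, Finset.sum_ite_eq',
          Finset.mem_univ, if_true] at e2
        have e3 : (F + 1) * (cap - 3) ≤
            #{j | cap - 3 ≤ cov side (τ j) true + cov side (τ j) false} * (cap - 3) :=
          Nat.mul_le_mul_right _ hgt
        omega
      obtain ⟨j, hj⟩ : ∃ j, τ j p = p ∧ τ j q = q ∧ τ j p' = p' ∧ τ j q' = q' ∧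
          cov side (τ j) true + cov side (τ j) false + 4 ≤ cap := by
        by_contra! hno
        have hsub : (univ : Finset κ) ⊆ ({j | τ j p ≠ p} : Finset κ) ∪ (({j | τ j q ≠ q} : Finset κ) ∪
            (({j | τ j p' ≠ p'} : Finset κ) ∪ (({j | τ j q' ≠ q'} : Finset κ) ∪
            ({j | cap - 3 ≤ cov side (τ j) true + cov side (τ j) false} : Finset κ)))) := by
          intro j _
          simp only [Finset.mem_union, Finset.mem_filter, Finset.mem_univ, true_and]
          by_contra! hno'
          obtain ⟨f1, f2, f3, f4, f5⟩ := hno'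
          have := hno j f1 f2 f3 f4
          omega
        have c0 := Finset.card_le_card hsub
        have c1 := hX p q p' q' hp (hs1 ▸ hp) hp' (hs2 ▸ hp') hne1 hne2
        have c2 := h.card_covered_le hpx (hr p hpx)
        have c3 := h.card_covered_le hqx (hr q hqx)
        have c4 := h.card_covered_le hpx' (hr p' hpx')
        have c5 := h.card_covered_le hqx' (hr q' hqx')
        have d1 := Finset.card_union_le ({j | τ j p ≠ p} : Finset κ) (({j | τ j q ≠ q} : Finset κ) ∪
            (({j | τ j p' ≠ p'} : Finset κ) ∪ (({j | τ j q' ≠ q'} : Finset κ) ∪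
            ({j | cap - 3 ≤ cov side (τ j) true + cov side (τ j) false} : Finset κ))))
        have d2 := Finset.card_union_le ({j | τ j q ≠ q} : Finset κ)
            (({j | τ j p' ≠ p'} : Finset κ) ∪ (({j | τ j q' ≠ q'} : Finset κ) ∪
            ({j | cap - 3 ≤ cov side (τ j) true + cov side (τ j) false} : Finset κ)))
        have d3 := Finset.card_union_le
            ({j | τ j p' ≠ p'} : Finset κ) (({j | τ j q' ≠ q'} : Finset κ) ∪
            ({j | cap - 3 ≤ cov side (τ j) true + cov side (τ j) false} : Finset κ))
        have d4 := Finset.card_union_le ({j | τ j q' ≠ q'} : Finset κ)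
            ({j | cap - 3 ≤ cov side (τ j) true + cov side (τ j) false} : Finset κ)
        rw [Finset.card_univ] at c0
        omega
      obtain ⟨f1, f2, f3, f4, f5⟩ := hj
      obtain ⟨g1, g2⟩ := h.add_edge hpq f1 f2
      have hpp : p' ≠ p ∧ p' ≠ q ∧ q' ≠ p ∧ q' ≠ q := by
        refine ⟨?_, ?_, ?_, ?_⟩ <;> rintro rfl <;> simp_all
      have f3' : link (τ j) p q p' = p' := by simp [link, hpp, f3]
      have f4' : link (τ j) p q q' = q' := by simp [link, hpp, f4]
      have hu' : 0 < u p' q' - edge p q p' q' := by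
        simp only [edge, hpp, false_and, or_self, if_false]
        omega
      obtain ⟨k1, k2⟩ := g1.add_edge (j := j) hu' (by rw [update_self, f3'])
        (by rw [update_self, f4'])
      rw [update_idem, update_self] at k1
      have e1 := cov_link f1 f2 hne1 hs1 true
      have e2 := cov_link f1 f2 hne1 hs1 false
      have e3 := cov_link f3' f4' hne2 hs2 true
      have e4 := cov_link f3' f4' hne2 hs2 false
      simp only [hp, hp', if_true, Bool.true_eq_false, Bool.false_eq_true, if_false] at e1 e2 e3 e4
      have e5 := hunb j
      refine ih _ (k2.trans g2) k1 ?_ ?_ rfl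
      · intro i
        by_cases hij : i = j
        · subst hij
          rw [update_self]
          omega
        · rw [update_of_ne hij]
          exact hbal i
      · intro i
        by_cases hij : i = j
        · subst hij
          rw [update_self]
          omega
        · rw [update_of_ne hij]
          exact hsize i

end Greedy

section Finish

variable {W : Type*} [DecidableEq W] [Fintype W]

theorem cnt_star (X : W → ℕ) (x : W) {p q : W} (hpq : p ≠ q) :
    cnt (fun j : Σ v : W, Fin (X v) => link id x j.1) p q = ∑ v, X v * edge x v p q := by
  unfold cnt
  rw [Fintype.sum_sigma]
  refine Finset.sum_congr rfl fun v _ => ?_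
  simp only [Finset.sum_const, Finset.card_univ, Fintype.card_fin, smul_eq_mul]
  by_cases hv : v = x
  · subst hv
    have h1 : ind (link id v v) p q = 0 := by unfold ind link; grind
    have h2 : edge v v p q = 0 := by unfold edge; grind
    simp [h1, h2]
  · rw [ind_link rfl rfl (Ne.symm hv) hpq]
    simp [ind, hpq]

theorem sum_mul_edge (X : W → ℕ) (x : W) {v : W} (hv : v ≠ x) :
    ∑ u, X u * edge x u v x = X v := by
  rw [Finset.sum_eq_single v]
  · rw [edge_comm, edge_eq_one, mul_one]
  · intro u _ hu
    have : edge x u v x = 0 := by unfold edge; grind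
    rw [this, mul_zero]
  · simp

theorem cov_star (side : W → Bool) {x v : W} (hv : v ≠ x) (β : Bool) :
    cov side (link id x v) β = (if side x = β then 1 else 0) + (if side v = β then 1 else 0) := by
  have h1 : ({y | side y = β ∧ link id x v y ≠ y} : Finset W) = ({x, v} : Finset W).filter (side · = β) := by
    ext y
    simp only [Finset.mem_filter, Finset.mem_univ, true_and, Finset.mem_insert,
      Finset.mem_singleton]
    by_cases hyx : y = x
    · subst hyx
      simp [link, hv]
    · by_cases hyv : y = v
      · subst hyv
        simp [link, hyx, Ne.symm hv]
      · simp [link, hyx, hyv]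
  rw [cov, h1, Finset.card_filter, Finset.sum_pair (Ne.symm hv)]

/-- A dense bipartite graph together with a small inner part decomposes into perfect matchings. -/
theorem factorable_of_small_inner {side : W → Bool} {w : W → W → ℕ} {d n cap r F : ℕ}
    {Z : Finset W} {x : W} {X : W → ℕ} (hw : ∀ p q, w p q = w q p) (hdiag : ∀ p, w p p = 0)
    (hreg : ∀ p, ∑ q, w p q = d) (hn : ∀ β, #{v | side v = β} = n) (hside : side x = false)
    (hXx : X x = 0) (hXle : ∀ v, v ≠ x → X v ≤ w x v)
    (hXeq : ∀ v, v ≠ x → side v = false → X v = w x v) (hcap : 4 ≤ cap)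
    (hr : ∀ v, v ≠ x → ∑ q, (if side q = side v ∧ q ≠ x then w v q else 0) ≤ r)
    (hF : 2 * n * r + 2 * ∑ v, X v < (F + 1) * (cap - 3))
    (hX : ∀ p q p' q', side p = true → side q = true → side p' = false → side q' = false →
      p ≠ q → p' ≠ q' → 4 * r + X p + X q + X p' + X q' + F < ∑ v, X v)
    (h1 : ∀ v, v ∉ Z → v ≠ x →
      n + 2 * (∑ v, X v + cap) < 2 * #{y | side v ≠ side y ∧ 0 < w v y})
    (h2 : ∀ v, v ≠ x → #Z + ∑ v, X v + cap ≤ #{y | side v ≠ side y ∧ 0 < w v y}) :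
    Factorable w d := by
  have hcardW : Fintype.card W = 2 * n := by
    rw [← Finset.card_univ, ← Finset.card_filter_add_card_filter_not (s := univ) (fun v => side v = true)]
    have e1 := hn true
    have e2 := hn false
    simp only [Bool.not_eq_true]
    omega
  have hκ : Fintype.card (Σ v : W, Fin (X v)) = ∑ v, X v := by simp
  have hne : ∀ j : Σ v : W, Fin (X v), j.1 ≠ x := by
    rintro ⟨v, i⟩ rfl
    exact absurd i.isLt (by simp [hXx])
  have hedge : ∀ v p q, p ≠ x → q ≠ x → edge x v p q = 0 := by
    intro v p q hp hq
    unfold edge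
    grind
  have hP : Partial side w x X (fun j : Σ v : W, Fin (X v) => link id x j.1)
      (fun p q => if side p = side q ∧ p ≠ x ∧ q ≠ x then w p q else 0) := by
    refine ⟨fun j => link_involutive (fun _ => rfl) rfl rfl, ?_, ?_, ?_, ?_, ?_, ?_, ?_, ?_⟩
    · intro p q
      rw [hw]
      exact if_congr (by grind) rfl rfl
    · intro p
      simp [hdiag]
    · intro p q hpq
      simp [hpq]
    · intro p
      simp
    · intro j
      simpa [link] using hne j
    · intro p q hpq hs
      rw [cnt_star _ _ hpq]
      by_cases hp : p = x
      · subst hp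
        have : ∑ v, X v * edge p v p q = X q := by
          rw [← sum_mul_edge X p (Ne.symm hpq)]
          exact Finset.sum_congr rfl fun v _ => by rw [edge_symm]
        rw [this, hXeq q (Ne.symm hpq) (by rw [← hs, hside])]
        simp
      · by_cases hq : q = x
        · subst hq
          rw [sum_mul_edge _ _ hpq, hXeq p hpq (by rw [hs, hside]), hw]
          simp
        · simp [hedge _ p q hp hq, hs, hp, hq]
    · intro v hv
      rw [cnt_star _ _ hv, sum_mul_edge _ _ hv]
    · intro p q hp hq hs
      rw [cnt_star _ _ (by rintro rfl; exact hs rfl)]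
      simp [hedge _ p q hp hq]
  have hb : ∑ v with side v = true, ∑ q with side q = true, w v q =
      ∑ v with side v = false, ∑ q with side q = false, w v q := by
    have hside_sum : ∀ β, ∑ v with side v = β, ∑ q with side q = β, w v q +
        ∑ v with side v = β, ∑ q with side q = !β, w v q = n * d := by
      intro β
      rw [← Finset.sum_add_distrib, ← hn β, ← smul_eq_mul, ← Finset.sum_const]
      refine Finset.sum_congr rfl fun v _ => ?_
      rw [← hreg v, ← Finset.sum_filter_add_sum_filter_not univ (fun q => side q = β)]
      congr 2
      ext q
      simp only [Finset.mem_filter, Finset.mem_univ, true_and]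
      cases side q <;> cases β <;> simp
    have e1 := hside_sum true
    have e2 := hside_sum false
    have e3 : ∑ v with side v = true, ∑ q with side q = !true, w v q =
        ∑ v with side v = false, ∑ q with side q = !false, w v q := by
      rw [Finset.sum_comm]
      exact Finset.sum_congr rfl fun v _ => Finset.sum_congr rfl fun q _ => hw _ _
    omega
  obtain ⟨τ, hτ, hbal, hsize⟩ := hP.exists_finished hdiag hb hcap hr hκ
    (by rw [hκ, hcardW]; exact hF) (by rw [hκ]; exact hX)
    (by
      intro j
      rw [cov_star side (hne j), cov_star side (hne j), hside]
      cases side j.1 <;> simp)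
    (by
      intro j
      rw [cov_star side (hne j), cov_star side (hne j), hside]
      cases side j.1 <;> simp <;> omega)
  have hcovn : ∀ j β, #{v | side v = β ∧ τ j v = v} + cov side (τ j) β = n := by
    intro j β
    rw [← hn β, ← Finset.card_filter_add_card_filter_not (s := ({v | side v = β} : Finset W))
      (fun v => τ j v = v), Finset.filter_filter, Finset.filter_filter]
    rfl
  have hcross : ∀ p q, p ≠ q → cnt τ p q ≤ w p q := by
    intro p q hpq
    by_cases hs : side p = side q
    · have := hτ.inner p q hpq hs
      omega
    · by_cases hp : p = x
      · subst hp
        rw [cnt_symm hτ.inv, hτ.cntx q (Ne.symm hpq)]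
        exact hXle q (Ne.symm hpq)
      · by_cases hq : q = x
        · subst hq
          rw [hτ.cntx p hp, hw]
          exact hXle p hp
        · rw [hτ.cnt_cross p q hp hq hs]
          exact Nat.zero_le _
  refine factorable_of_partial (Z := Z) (cap := cap) hw hdiag hreg (fun β => (hn β).le) hτ.inv hcross
    (fun p q hpq hs => by simpa using hτ.inner p q hpq hs) ?_ hτ.covx ?_ ?_ ?_
  · intro j
    have e1 := hcovn j true
    have e2 := hcovn j false
    have e3 := hbal j
    omega
  · intro j
    refine le_trans (le_of_eq ?_) (hsize j)
    rw [← Finset.card_filter_add_card_filter_not (s := ({v | τ j v ≠ v} : Finset W))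
      (fun v => side v = true), Finset.filter_filter, Finset.filter_filter]
    unfold cov
    congr 2 <;> · ext v; simp [and_comm]
  · rw [hκ]; exact h1
  · rw [hκ]; exact h2

end Finish

section Kept

variable {W : Type*} [DecidableEq W] [Fintype W]

theorem card_fixed_add_sum {ι : Type*} [Fintype ι] (M : ι → W → W) (v : W) :
    #{i | M i v = v} + ∑ q, (if q = v then 0 else cnt M v q) = Fintype.card ι := by
  rw [← card_covered, ← Finset.card_univ,
    ← Finset.card_filter_add_card_filter_not (s := univ) (fun i => M i v = v)]

theorem card_mul_lt_of_sum {ι : Type*} [Fintype ι] (f : ι → ℕ) {a S t : ℕ}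
    (hS : ∑ i, f i ≤ S) (h : S < (t + 1) * a) : #{i | a ≤ f i} ≤ t := by
  by_contra! hgt
  have e1 : #{i | a ≤ f i} * a ≤ ∑ i, f i := by
    refine le_trans ?_ (Finset.sum_le_univ_sum_of_nonneg (s := ({i | a ≤ f i} : Finset ι))
      (fun _ => Nat.zero_le _))
    rw [← smul_eq_mul]
    exact Finset.card_nsmul_le_sum _ _ _ fun v hv => by simpa using hv
  have e2 : (t + 1) * a ≤ #{i | a ≤ f i} * a := Nat.mul_le_mul_right _ hgt
  omega

theorem defect_le {side : W → Bool} {Z : Finset W} {σ : W → W} (hσ : Involutive σ) {x : W}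
    (hx : x ∈ Z) (hc : ∀ v, side (σ v) ≠ side v → v = x ∨ σ v = x) :
    defect side Z σ ≤ 2 * #Z + 3 * #{v | σ v = v} := by
  have h1 : ({v | ¬ Good side Z σ v} : Finset W) ⊆
      Z ∪ (Z.image σ ∪ ({v | σ v = v} : Finset W)) := by
    intro v hv
    simp only [Finset.mem_filter, Finset.mem_univ, true_and, Finset.mem_union,
      Finset.mem_image] at hv ⊢
    by_contra! hno
    obtain ⟨f1, f2, f3⟩ := hno
    have f4 : σ v ∉ Z := fun h => f2 _ h (hσ v)
    refine hv ⟨f1, f4, f3, ?_⟩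
    by_contra hs
    rcases hc v hs with rfl | h
    · exact f1 hx
    · exact f4 (h ▸ hx)
  have h2 := Finset.card_le_card h1
  have h3 := Finset.card_union_le Z (Z.image σ ∪ ({v | σ v = v} : Finset W))
  have h4 := Finset.card_union_le (Z.image σ) ({v | σ v = v} : Finset W)
  have h5 : #(Z.image σ) ≤ #Z := Finset.card_image_le
  unfold defect
  omega

/-- Colour the multigraph `w₁`, drop the poor colours and complete the others to perfect
matchings of `w`. -/
theorem exists_perfect_family {side : W → Bool} {w w₁ : W → W → ℕ} {Z : Finset W} {x : W}
    (hxZ : x ∈ Z) {n k s s' C b q t r₁ N : ℕ} (hw : ∀ p q, w p q = w q p)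
    (hw₁ : ∀ p q, w₁ p q = w₁ q p) (hdiag : ∀ p, w₁ p p = 0) (hle : ∀ p q, w₁ p q ≤ w p q)
    (hC : ∀ p q, p ≠ x → q ≠ x → w₁ p q ≤ C)
    (hcross : ∀ p q, p ≠ x → q ≠ x → side p ≠ side q → w₁ p q = 0)
    (hdeg : ∀ p, ∑ q, w₁ p q + s ≤ k) (hdeg' : ∀ p, k ≤ ∑ q, w₁ p q + s')
    (hCs : C * k < s * s) (hn : ∀ β, #{v | side v = β} = n) (hs' : s' ≤ r₁)
    (ht : 3 * (2 * n * s') < (t + 1) * (b + 1 - 2 * #Z))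
    (hN : ∀ v, v ∉ Z → N ≤ #{y | side v ≠ side y ∧ y ∉ Z ∧ 0 < w v y})
    (hq : k * (b + 2) < r₁ * (q + 1)) (hlarge : n + 2 * (r₁ + b + 2 + 2 * q) < 2 * N) :
    ∃ (m : ℕ) (M : Fin m → W → W), m ≤ k ∧ k ≤ m + (#Z * s' + t) ∧ (∀ i, Involutive (M i)) ∧
      (∀ i v, M i v ≠ v) ∧ (∀ p q, p ≠ q → cnt M p q ≤ w p q) ∧
      (∀ z ∈ Z, ∀ q, z ≠ q → cnt M z q ≤ w₁ z q) ∧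
      ∀ v, v ∉ Z → ∑ i, crossAt side Z (M i) v ≤ r₁ := by
  have hcardW : Fintype.card W = 2 * n := by
    rw [← Finset.card_univ,
      ← Finset.card_filter_add_card_filter_not (s := univ) (fun v => side v = true)]
    have e1 := hn true
    have e2 := hn false
    simp only [Bool.not_eq_true]
    omega
  obtain ⟨M₀, hinv, hcnt⟩ := exists_coloring (ι := Fin k) x (s := s) (C := C)
    (by simpa using hCs) _ w₁ rfl hw₁ hdiag (by simpa using hdeg) hC
  have hfix : ∀ v, #{i | M₀ i v = v} ≤ s' := by
    intro v
    have e1 := card_fixed_add_sum M₀ v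
    have e2 : ∑ q, (if q = v then 0 else cnt M₀ v q) = ∑ q, w₁ v q := by
      refine Finset.sum_congr rfl fun q _ => ?_
      split_ifs with h
      · rw [h, hdiag]
      · exact hcnt v q (Ne.symm h)
    have e3 := hdeg' v
    rw [Fintype.card_fin] at e1
    omega
  have hcr : ∀ i v, side (M₀ i v) ≠ side v → v = x ∨ M₀ i v = x := by
    intro i v hs
    by_contra! hno
    have h1 := hcross v (M₀ i v) hno.1 hno.2 (Ne.symm hs)
    have hne : v ≠ M₀ i v := by
      intro h
      exact hs (by rw [← h])
    rw [← hcnt v _ hne, cnt_eq_card, Finset.card_eq_zero] at h1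
    have : i ∈ ({j | M₀ j v = M₀ i v} : Finset (Fin k)) := by simp
    rw [h1] at this
    simp at this
  set I : Finset (Fin k) := {i | (∀ z ∈ Z, M₀ i z ≠ z) ∧ defect side Z (M₀ i) ≤ b} with hI
  have hbad : k ≤ #I + (#Z * s' + t) := by
    have h1 : (univ : Finset (Fin k)) ⊆ I ∪ ((Z.biUnion fun z => ({i | M₀ i z = z} : Finset _)) ∪
        ({i | b + 1 - 2 * #Z ≤ 3 * #{v | M₀ i v = v}} : Finset _)) := by
      intro i _
      simp only [hI, Finset.mem_union, Finset.mem_filter, Finset.mem_univ, true_and,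
        Finset.mem_biUnion]
      by_contra! hno
      obtain ⟨f1, f2, f3⟩ := hno
      have := defect_le (side := side) (hinv i) hxZ (hcr i)
      have := f1 f2
      omega
    have h2 := Finset.card_le_card h1
    have h3 := Finset.card_union_le I ((Z.biUnion fun z => ({i | M₀ i z = z} : Finset _)) ∪
        ({i | b + 1 - 2 * #Z ≤ 3 * #{v | M₀ i v = v}} : Finset _))
    have h4 := Finset.card_union_le (Z.biUnion fun z => ({i | M₀ i z = z} : Finset _))
        ({i | b + 1 - 2 * #Z ≤ 3 * #{v | M₀ i v = v}} : Finset _)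
    have h5 : #(Z.biUnion fun z => ({i | M₀ i z = z} : Finset _)) ≤ #Z * s' :=
      Finset.card_biUnion_le_card_mul _ _ _ fun z _ => hfix z
    have h6 : #({i | b + 1 - 2 * #Z ≤ 3 * #{v | M₀ i v = v}} : Finset (Fin k)) ≤ t := by
      refine card_mul_lt_of_sum _ ?_ ht
      rw [← Finset.mul_sum]
      refine Nat.mul_le_mul_left _ ?_
      have : ∑ i, #{v | M₀ i v = v} = ∑ v, #{i | M₀ i v = v} := by
        simp only [Finset.card_filter]
        exact Finset.sum_comm
      rw [this, ← hcardW, ← smul_eq_mul, ← Finset.card_univ]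
      exact Finset.sum_le_card_nsmul _ _ _ fun v _ => hfix v
    rw [Finset.card_univ, Fintype.card_fin] at h2
    omega
  have hIk : #I ≤ k := by simpa using Finset.card_le_univ I
  let e := I.equivFin.symm
  let M : Fin #I → W → W := fun i => M₀ (e i)
  have hsub : ∀ f : Fin k → ℕ, ∑ i, f (e i) ≤ ∑ i, f i := by
    intro f
    rw [e.sum_comp (fun i : I => f i), Finset.sum_coe_sort I f]
    exact Finset.sum_le_univ_sum_of_nonneg fun _ => Nat.zero_le _
  have hMw₁ : ∀ p q, p ≠ q → cnt M p q ≤ w₁ p q := by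
    intro p q hpq
    rw [← hcnt p q hpq]
    exact hsub fun i => ind (M₀ i) p q
  have hgood : ∀ i, (∀ z ∈ Z, M i z ≠ z) ∧ defect side Z (M i) ≤ b := by
    exact fun i => (Finset.mem_filter.1 (e i).2).2
  have hvalid : Valid side Z w r₁ M M := by
    refine ⟨fun i => hinv _, fun _ _ _ => rfl, fun p q hpq => (hMw₁ p q hpq).trans (hle p q), ?_⟩
    intro v hv
    refine (hsub fun i => crossAt side Z (M₀ i) v).trans (le_trans ?_ (hs'.trans' (hfix v)))
    rw [Finset.card_filter]
    refine Finset.sum_le_sum fun i _ => ?_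
    unfold crossAt
    by_cases h : M₀ i v = v
    · simp [h]
    · rw [if_neg]
      · exact Nat.zero_le _
      · rintro (h' | ⟨h1, h2⟩)
        · exact h h'
        · rcases hcr i v h1 with rfl | h3
          · exact hv hxZ
          · exact h2 (h3 ▸ hxZ)
  obtain ⟨M', hM', hperf⟩ := hvalid.exists_perfect hw (fun i => (hgood i).1)
    (fun β => (hn β).le) (by rw [hcardW]; exact even_two_mul n) hN (fun i => (hgood i).2)
    (q := q) (by
      rw [Fintype.card_fin]
      exact lt_of_le_of_lt (Nat.mul_le_mul_right _ hIk) hq) hlarge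
  refine ⟨#I, M', hIk, hbad, hM'.inv, hperf, hM'.le, ?_, hM'.cross⟩
  intro z hz q hzq
  have : cnt M' z q = cnt M z q := by
    rw [cnt_eq_card, cnt_eq_card]
    congr 1
    ext i
    simp only [Finset.mem_filter, Finset.mem_univ, true_and]
    rw [hM'.eqOn i z hz]
  rw [this]
  exact hMw₁ z q hzq

end Kept

section Assemble

variable {W : Type*} [DecidableEq W] [Fintype W]

theorem exists_le_sum_eq (s : Finset W) (c : W → ℕ) {m : ℕ} (h : m ≤ ∑ v ∈ s, c v) :
    ∃ X : W → ℕ, (∀ v, X v ≤ c v) ∧ (∀ v ∉ s, X v = 0) ∧ ∑ v ∈ s, X v = m := by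
  induction s using Finset.induction_on generalizing m with
  | empty => exact ⟨fun _ => 0, fun _ => Nat.zero_le _, fun _ _ => rfl, by simp_all⟩
  | insert a s ha ih =>
    rw [Finset.sum_insert ha] at h
    obtain ⟨X, h1, h2, h3⟩ := ih (m := m - min m (c a)) (by omega)
    refine ⟨update X a (min m (c a)), ?_, ?_, ?_⟩
    · intro v
      by_cases hv : v = a
      · subst hv
        simp
      · rw [update_of_ne hv]
        exact h1 v
    · intro v hv
      rw [Finset.mem_insert, not_or] at hv
      rw [update_of_ne hv.1]
      exact h2 v hv.2
    · have : ∑ v ∈ s, update X a (min m (c a)) v = ∑ v ∈ s, X v :=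
        Finset.sum_congr rfl fun v hv => update_of_ne (by rintro rfl; exact ha hv) _ _
      rw [Finset.sum_insert ha, update_self, this, h3]
      omega

theorem le_sum_min (s : Finset W) (hs : 2 ≤ #s) (c : W → ℕ) {K m S : ℕ} (hm : K ≤ 3 * m)
    (hS : S = ∑ v ∈ s, c v) (h : ∀ p ∈ s, ∀ q ∈ s, p ≠ q → c p + c q + K ≤ S) :
    K ≤ ∑ v ∈ s, min (c v) m := by
  by_cases hL : 3 ≤ #{v ∈ s | m ≤ c v}
  · have e1 : #{v ∈ s | m ≤ c v} • m ≤ ∑ v ∈ s with m ≤ c v, min (c v) m :=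
      Finset.card_nsmul_le_sum _ _ _ fun v hv => by
        rw [min_eq_right (Finset.mem_filter.1 hv).2]
    have e2 : ∑ v ∈ s with m ≤ c v, min (c v) m ≤ ∑ v ∈ s, min (c v) m :=
      Finset.sum_le_sum_of_subset (Finset.filter_subset _ _)
    rw [smul_eq_mul] at e1
    have e3 : 3 * m ≤ #{v ∈ s | m ≤ c v} * m := Nat.mul_le_mul_right _ hL
    omega
  · obtain ⟨P, h1, h2, h3⟩ := Finset.exists_subsuperset_card_eq
      (Finset.filter_subset (fun v => m ≤ c v) s) (show #{v ∈ s | m ≤ c v} ≤ 2 by omega) hs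
    obtain ⟨p, q, hpq, rfl⟩ := Finset.card_eq_two.1 h3
    have e1 := h p (h2 (by simp)) q (h2 (by simp)) hpq
    rw [hS, ← Finset.sum_sdiff h2, Finset.sum_pair hpq] at e1
    have e2 : ∑ v ∈ s \ {p, q}, c v ≤ ∑ v ∈ s, min (c v) m := by
      refine le_trans (Finset.sum_le_sum fun v hv => ?_)
        (Finset.sum_le_sum_of_subset (Finset.sdiff_subset (t := {p, q})))
      rw [Finset.mem_sdiff] at hv
      have : ¬ m ≤ c v := fun hc => hv.2 (h1 (Finset.mem_filter.2 ⟨hv.1, hc⟩))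
      omega
    omega

theorem le_crossAt (side : W → Bool) (Z : Finset W) (σ : W → W) (v : W) :
    (if side (σ v) ≠ side v ∧ σ v ∉ Z then 1 else 0) ≤ crossAt side Z σ v := by
  unfold crossAt
  split_ifs with h1 h2 h2
  · exact le_rfl
  · exact absurd (Or.inr h1) h2
  · exact Nat.zero_le _
  · exact le_rfl

/-- The part of `w` that is coloured first: the light part inside the sides, and the part `lam`
of the edges at `x`. -/
def innerPart (side : W → Bool) (w : W → W → ℕ) (x : W) (C : ℕ) (lam : W → ℕ) (p q : W) : ℕ :=
  if p = x then lam q else if q = x then lam p else if side p = side q then min (w p q) C else 0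

theorem factorable_of_partition {side : W → Bool} {w : W → W → ℕ} {Z : Finset W} {x : W}
    {lam : W → ℕ} {n d k s s' C C' b q t r₁ N N' R r K mm cap F : ℕ} (hxZ : x ∈ Z)
    (hside : side x = false) (hw : ∀ p q, w p q = w q p) (hdiag : ∀ p, w p p = 0)
    (hreg : ∀ p, ∑ q, w p q = d) (hn : ∀ β, #{v | side v = β} = n) (hn2 : 2 ≤ n)
    (hlamx : lam x = 0) (hlam : ∀ v, lam v ≤ w x v)
    (hlam' : ∀ v, side v = false → lam v = w x v)
    (hdeg : ∀ p, ∑ q, innerPart side w x C lam p q + s ≤ k)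
    (hdeg' : ∀ p, k ≤ ∑ q, innerPart side w x C lam p q + s')
    (hC' : ∀ v, side v = false → w x v ≤ C')
    (hex : ∀ v, v ≠ x → ∑ q, (if q = x then 0 else w v q - C) ≤ R)
    (hpair : ∀ p q, side p = true → side q = true → p ≠ q →
      (w x p - lam p) + (w x q - lam q) + (#Z * s' + t) + K + k ≤ d)
    (hCs : C * k < s * s) (hs' : s' ≤ r₁)
    (ht : 3 * (2 * n * s') < (t + 1) * (b + 1 - 2 * #Z))
    (hN : ∀ v, v ∉ Z → N ≤ #{y | side v ≠ side y ∧ y ∉ Z ∧ 0 < w v y})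
    (hN' : ∀ v, v ∈ Z → v ≠ x → N' ≤ #{y | side v ≠ side y ∧ y ≠ x ∧ 0 < w v y})
    (hq : k * (b + 2) < r₁ * (q + 1)) (hlarge : n + 2 * (r₁ + b + 2 + 2 * q) < 2 * N)
    (hr : R + (#Z * s' + t) + r₁ ≤ r) (hrK : r ≤ K) (hmm : K ≤ 3 * mm)
    (hK : 4 * r + 2 * mm + 2 * C' + F < K) (hcap : 4 ≤ cap)
    (hF : 2 * n * r + 2 * K < (F + 1) * (cap - 3))
    (h1 : n + 2 * (K + cap + r₁) < 2 * N) (h2 : #Z + K + cap + r₁ ≤ N)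
    (h3 : #Z + K + cap ≤ N') : Factorable w d := by
  set w₁ := innerPart side w x C lam with hw₁def
  have hw₁ : ∀ p q, w₁ p q = w₁ q p := by
    intro p q
    simp only [hw₁def, innerPart]
    by_cases hp : p = x
    · by_cases hq : q = x
      · simp [hp, hq]
      · simp [hp, hq]
    · by_cases hq : q = x
      · simp [hp, hq]
      · simp only [hp, hq, if_false, hw p q]
        exact if_congr eq_comm rfl rfl
  have hw₁le : ∀ p q, w₁ p q ≤ w p q := by
    intro p q
    simp only [hw₁def, innerPart]
    split_ifs with h1 h2
    · exact h1 ▸ hlam q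
    · rw [hw, h2]; exact hlam p
    · exact min_le_left _ _
    · exact Nat.zero_le _
  have hw₁diag : ∀ p, w₁ p p = 0 := fun p => Nat.le_zero.1 ((hw₁le p p).trans (hdiag p).le)
  have hw₁cross : ∀ p q, p ≠ x → q ≠ x → side p ≠ side q → w₁ p q = 0 := by
    intro p q hp hq hs
    simp [hw₁def, innerPart, hp, hq, hs]
  have hw₁in : ∀ p q, p ≠ x → q ≠ x → side p = side q → w₁ p q = min (w p q) C := by
    intro p q hp hq hs
    simp [hw₁def, innerPart, hp, hq, hs]
  have hw₁x : ∀ q, w₁ x q = lam q := by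
    intro q
    simp [hw₁def, innerPart]
  obtain ⟨m, M, hmk, hkm, hinv, hperf, hcnt, hMZ, hcr⟩ := exists_perfect_family hxZ hw hw₁ hw₁diag
    hw₁le (fun p q hp hq => by
      by_cases hs : side p = side q
      · rw [hw₁in p q hp hq hs]; exact min_le_right _ _
      · rw [hw₁cross p q hp hq hs]; exact Nat.zero_le _) hw₁cross hdeg hdeg' hCs hn hs' ht hN hq
    hlarge
  set bad := #Z * s' + t with hbad
  have hcntd : ∀ p, cnt M p p = 0 := by
    intro p
    rw [cnt_eq_card, Finset.card_eq_zero, Finset.filter_eq_empty_iff]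
    exact fun i _ => hperf i p
  have hcntle : ∀ p q, cnt M p q ≤ w p q := by
    intro p q
    by_cases hpq : p = q
    · subst hpq
      rw [hcntd]
      exact Nat.zero_le _
    · exact hcnt p q hpq
  have hMsum : ∀ p, ∑ q, cnt M p q = m := fun p => by rw [sum_cnt, Fintype.card_fin]
  have hMx : ∀ v, cnt M x v ≤ lam v := by
    intro v
    by_cases hv : x = v
    · rw [← hv, hcntd]
      exact Nat.zero_le _
    · exact (hMZ x hxZ v hv).trans (hw₁x v).le
  have hMZ' : ∀ v, ∀ z ∈ Z, cnt M v z ≤ w₁ v z := by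
    intro v z hz
    by_cases hv : z = v
    · rw [hv, hcntd]
      exact Nat.zero_le _
    · rw [cnt_symm hinv, hw₁]
      exact hMZ z hz v hv
  set w' : W → W → ℕ := fun p q => w p q - cnt M p q with hw'
  have hw'le : ∀ p q, w' p q + cnt M p q = w p q := fun p q => Nat.sub_add_cancel (hcntle p q)
  have hreg' : ∀ p, ∑ q, w' p q + m = d := by
    intro p
    rw [← hreg p, ← hMsum p, ← Finset.sum_add_distrib]
    exact Finset.sum_congr rfl fun q _ => hw'le p q
  have hw's : ∀ p q, w' p q = w' q p := by
    intro p q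
    simp only [hw', hw p q, cnt_symm hinv p q]
  have hw'd : ∀ p, w' p p = 0 := by
    intro p
    simp [hw', hdiag]
  -- the edges at `x`
  have hmiss : ∑ v, (lam v - cnt M x v) ≤ bad := by
    have e1 : ∑ v, (lam v - cnt M x v) + m = ∑ v, w₁ x v := by
      have : ∑ v, (lam v - cnt M x v) + ∑ v, cnt M x v = ∑ v, w₁ x v := by
        rw [← Finset.sum_add_distrib]
        exact Finset.sum_congr rfl fun v _ => by rw [hw₁x]; exact Nat.sub_add_cancel (hMx v)
      rwa [hMsum] at this
    have e2 := hdeg x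
    omega
  have hw'x : ∀ v, w' x v = (w x v - lam v) + (lam v - cnt M x v) := by
    intro v
    have e1 := hMx v
    have e2 := hlam v
    have e3 := hw'le x v
    omega
  set c : W → ℕ := fun v => w' x v with hc
  have hsumA : ∑ v with side v = true, c v + ∑ v with side v = false, c v = ∑ v, c v := by
    rw [← Finset.sum_filter_add_sum_filter_not univ (fun v => side v = true)]
    simp only [Bool.not_eq_true]
  have hsumB : ∑ v with side v = false, c v = ∑ v with side v = false, (lam v - cnt M x v) := by
    refine Finset.sum_congr rfl fun v hv => ?_
    have := hlam' v (by simpa using hv)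
    have := hw'x v
    simp only [hc]
    omega
  have hmissAB : ∑ v with side v = true, (lam v - cnt M x v) +
      ∑ v with side v = false, (lam v - cnt M x v) ≤ bad := by
    refine le_trans (le_of_eq ?_) hmiss
    rw [← Finset.sum_filter_add_sum_filter_not univ (fun v => side v = true)]
    simp only [Bool.not_eq_true]
  have hpair' : ∀ p ∈ ({v | side v = true} : Finset W), ∀ q ∈ ({v | side v = true} : Finset W),
      p ≠ q → c p + c q + K ≤ ∑ v with side v = true, c v := by
    intro p hp q hq hpq
    have e1 : ∑ v ∈ {p, q}, (lam v - cnt M x v) ≤ ∑ v with side v = true, (lam v - cnt M x v) := by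
      refine Finset.sum_le_sum_of_subset fun v hv => ?_
      rw [Finset.mem_insert, Finset.mem_singleton] at hv
      rcases hv with rfl | rfl
      · exact hp
      · exact hq
    rw [Finset.sum_pair hpq] at e1
    have e2 := hpair p q (by simpa using hp) (by simpa using hq) hpq
    have e3 := hw'x p
    have e4 := hw'x q
    have e5 := hreg' x
    simp only [hc] at hsumA hsumB ⊢
    omega
  have hKsum := le_sum_min _ (by rw [hn]; exact hn2) c hmm rfl hpair'
  obtain ⟨Y, hY1, hY2, hY3⟩ := exists_le_sum_eq ({v | side v = true} : Finset W)
    (fun v => min (c v) mm) (m := K - ∑ v with side v = false, c v) (by omega)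
  set X : W → ℕ := fun v => if side v = true then Y v else c v with hXdef
  have hXsum : ∑ v, X v = K := by
    rw [← Finset.sum_filter_add_sum_filter_not univ (fun v => side v = true)]
    have e1 : ∑ v with side v = true, X v = ∑ v with side v = true, Y v :=
      Finset.sum_congr rfl fun v hv => by simp [hXdef, (Finset.mem_filter.1 hv).2]
    have e2 : ∑ v with ¬ side v = true, X v = ∑ v with side v = false, c v := by
      simp only [Bool.not_eq_true]
      exact Finset.sum_congr rfl fun v hv => by simp [hXdef, (Finset.mem_filter.1 hv).2]
    rw [e1, e2, hY3]
    have : ∑ v with side v = false, c v ≤ K := by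
      rw [hsumB]
      omega
    omega
  have hXA : ∀ v, side v = true → X v ≤ mm := by
    intro v hv
    simp only [hXdef, hv, if_true]
    exact (hY1 v).trans (min_le_right _ _)
  have hXB : ∀ v, side v = false → X v ≤ C' := by
    intro v hv
    simp only [hXdef, hv, Bool.false_eq_true, if_false]
    exact (Nat.sub_le _ _).trans (hC' v hv)
  have hcross_pos : ∀ v (S : Finset W), #S ≤ #{y ∈ S | 0 < w' v y} +
      #{y ∈ S | 0 < w v y → 0 < cnt M v y} := by
    intro v S
    rw [← Finset.card_filter_add_card_filter_not (s := S) (fun y => 0 < w' v y)]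
    refine Nat.add_le_add_left (Finset.card_le_card fun y hy => ?_) _
    rw [Finset.mem_filter] at hy ⊢
    refine ⟨hy.1, fun hpos => ?_⟩
    have := hw'le v y
    omega
  have hNv : ∀ v, v ∉ Z → N ≤ #{y | side v ≠ side y ∧ 0 < w' v y} + r₁ := by
    intro v hv
    have e1 := hcross_pos v ({y | side v ≠ side y ∧ y ∉ Z ∧ 0 < w v y} : Finset W)
    have e2 : #{y ∈ ({y | side v ≠ side y ∧ y ∉ Z ∧ 0 < w v y} : Finset W) | 0 < w' v y} ≤
        #{y | side v ≠ side y ∧ 0 < w' v y} := by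
      refine Finset.card_le_card fun y hy => ?_
      simp only [Finset.mem_filter, Finset.mem_univ, true_and] at hy ⊢
      exact ⟨hy.1.1, hy.2⟩
    have e3 : #{y ∈ ({y | side v ≠ side y ∧ y ∉ Z ∧ 0 < w v y} : Finset W) |
        0 < w v y → 0 < cnt M v y} ≤ r₁ := by
      refine le_trans ?_ (hcr v hv)
      have : ∑ i, crossAt side Z (M i) v ≥
          #(({i | side (M i v) ≠ side v ∧ M i v ∉ Z} : Finset (Fin m)).image fun i => M i v) := by
        refine le_trans Finset.card_image_le ?_
        rw [Finset.card_filter]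
        exact Finset.sum_le_sum fun i _ => le_crossAt side Z (M i) v
      refine le_trans (Finset.card_le_card fun y hy => ?_) this
      simp only [Finset.mem_filter, Finset.mem_univ, true_and] at hy
      have hpos := hy.2 hy.1.2.2
      rw [cnt_eq_card, Finset.card_pos] at hpos
      obtain ⟨i, hi⟩ := hpos
      have hi' := (Finset.mem_filter.1 hi).2
      refine Finset.mem_image.2 ⟨i, ?_, hi'⟩
      simp only [Finset.mem_filter, Finset.mem_univ, true_and, hi']
      exact ⟨Ne.symm hy.1.1, hy.1.2.1⟩
    have e4 := hN v hv
    omega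
  have hNz : ∀ z ∈ Z, z ≠ x → N' ≤ #{y | side z ≠ side y ∧ 0 < w' z y} := by
    intro z hz hzx
    refine (hN' z hz hzx).trans (Finset.card_le_card fun y hy => ?_)
    simp only [Finset.mem_filter, Finset.mem_univ, true_and] at hy ⊢
    have e1 := hMZ z hz y (by rintro rfl; exact hy.1 rfl)
    rw [hw₁cross z y hzx hy.2.1 hy.1] at e1
    have e2 := hw'le z y
    exact ⟨hy.1, by omega⟩
  have hinner : ∀ v, v ≠ x → ∑ q, (if side q = side v ∧ q ≠ x then w' v q else 0) ≤ r := by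
    intro v hv
    have hsum : ∑ q, (if side q = side v ∧ q ≠ x then w' v q else 0) + m ≤
        ∑ q, w₁ v q + R + r₁ := by
      have hcrsum : (∑ q, if v ∉ Z ∧ q ∉ Z ∧ side q ≠ side v then cnt M v q else 0) ≤ r₁ := by
        by_cases hvZ : v ∈ Z
        · simp [hvZ]
        · refine le_trans ?_ (hcr v hvZ)
          have : ∀ q, (if v ∉ Z ∧ q ∉ Z ∧ side q ≠ side v then cnt M v q else 0) =
              ∑ i, if v ∉ Z ∧ q ∉ Z ∧ side q ≠ side v then ind (M i) v q else 0 := by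
            intro q
            split_ifs
            · rfl
            · simp
          rw [Finset.sum_congr rfl fun q _ => this q, Finset.sum_comm]
          refine Finset.sum_le_sum fun i _ => ?_
          rw [Finset.sum_eq_single (M i v)]
          · refine le_trans ?_ (le_crossAt side Z (M i) v)
            simp only [ind, if_true]
            split_ifs with g1 g2 g2
            · exact le_rfl
            · exact absurd ⟨g1.2.2, g1.2.1⟩ g2
            · exact Nat.zero_le _
            · exact le_rfl
          · intro q _ hq
            simp [ind, Ne.symm hq]
          · simp
      refine le_trans ?_ (Nat.add_le_add (Nat.add_le_add_left (hex v hv) _) hcrsum)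
      refine le_trans (Nat.add_le_add_left (hMsum v).ge _) ?_
      rw [← Finset.sum_add_distrib, ← Finset.sum_add_distrib, ← Finset.sum_add_distrib]
      refine Finset.sum_le_sum fun q _ => ?_
      have e1 := hw'le v q
      by_cases hqv : q = v
      · subst hqv
        have e2 := hcntd q
        have e3 := hw'd q
        simp [e2, e3]
      · by_cases hqx : q = x
        · subst hqx
          have := hMZ' v q hxZ
          simp only [ne_eq, not_true_eq_false, and_false, if_false]
          omega
        · by_cases hs : side q = side v
          · rw [hw₁in v q hv hqx hs.symm]
            simp only [hs, hqx, ne_eq, not_false_eq_true, and_self, if_true, if_false]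
            omega
          · by_cases hvZ : v ∈ Z
            · have := hMZ v hvZ q (Ne.symm hqv)
              simp only [hs, false_and, if_false]
              omega
            · by_cases hqZ : q ∈ Z
              · have := hMZ' v q hqZ
                simp only [hs, false_and, if_false]
                omega
              · simp only [hs, hvZ, hqZ, false_and, if_false, ne_eq, not_false_eq_true, and_self,
                  if_true]
                omega
    have := hdeg v
    omega
  have hfin : Factorable w' (d - m) := by
    refine factorable_of_small_inner (Z := Z) (x := x) (X := X) (n := n) (r := r) (F := F)
      (cap := cap) hw's hw'd ?_ hn hside ?_ ?_ ?_ hcap hinner (by rw [hXsum]; exact hF) ?_ ?_ ?_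
    · intro p
      have := hreg' p
      omega
    · simp [hXdef, hside, hc, hw'd]
    · intro v _
      simp only [hXdef]
      split_ifs
      · exact (hY1 v).trans (min_le_left _ _)
      · exact le_rfl
    · intro v _ hv
      simp [hXdef, hv, hc]
    · intro p q p' q' hp hq hp' hq' _ _
      have e1 := hXA p hp
      have e2 := hXA q hq
      have e3 := hXB p' hp'
      have e4 := hXB q' hq'
      omega
    · intro v hv _
      have := hNv v hv
      omega
    · intro v hv
      by_cases hvZ : v ∈ Z
      · have := hNz v hvZ hv
        omega
      · have := hNv v hvZ
        omega
  have := hfin.add_cnt hinv hperf (w' := w) (fun p q => (hw'le p q).symm)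
  rw [Fintype.card_fin, Nat.sub_add_cancel (by have := hreg' x; omega)] at this
  exact this

end Assemble

section Split

theorem exists_balanced_extension {σ K : ℝ} (hσ : 0 < σ) (hK : 0 < K) : ∃ n₀ : ℕ, ∀ n ≥ n₀,
    ∀ (W ι : Type) [Fintype W] [DecidableEq W] [Fintype ι] (f : ι → W → ℝ) (A B : Finset W),
    Disjoint A B → #A = #B → Fintype.card W = 2 * n → Fintype.card ι ≤ 10 * n →
    (∀ i v, 0 ≤ f i v) → (∀ i v, f i v ≤ K) →
    ∃ side : W → Bool, (∀ β, #{v | side v = β} = n) ∧ (∀ v ∈ A, side v = true) ∧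
      (∀ v ∈ B, side v = false) ∧
      ∀ i, |∑ v with side v = true, f i v - ∑ v with side v = false, f i v| ≤
        σ * n + ∑ v ∈ A ∪ B, f i v := by
  obtain ⟨n₀, h⟩ := exists_balanced_partition hσ hK
  refine ⟨n₀, fun n hn W ι _ _ _ f A B hAB hc hW hι hf0 hfK => ?_⟩
  have hcAB : #(A ∪ B) = 2 * #A := by rw [Finset.card_union_of_disjoint hAB]; omega
  have hR : #(A ∪ B)ᶜ + 2 * #A = 2 * n := by
    rw [Finset.card_compl, hcAB, hW]
    have := Finset.card_le_univ (A ∪ B)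
    omega
  obtain ⟨side₀, hs1, hs2⟩ := h n hn W ι f (A ∪ B)ᶜ ⟨n - #A, by omega⟩ (by omega) hι hf0 hfK
  set side : W → Bool := fun v => if v ∈ A then true else if v ∈ B then false else side₀ v with hs
  have hsA : ∀ v ∈ A, side v = true := fun v hv => by simp [hs, hv]
  have hsB : ∀ v ∈ B, side v = false := fun v hv => by
    simp [hs, hv, Finset.disjoint_right.1 hAB hv]
  have hsR : ∀ v ∈ (A ∪ B)ᶜ, side v = side₀ v := fun v hv => by
    simp only [Finset.mem_compl, Finset.mem_union, not_or] at hv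
    simp [hs, hv]
  have ht : ({v | side v = true} : Finset W) = A ∪ {v ∈ (A ∪ B)ᶜ | side₀ v = true} := by
    ext v
    simp only [Finset.mem_filter, Finset.mem_univ, true_and, Finset.mem_union, Finset.mem_compl, hs]
    split_ifs with h1 h2 <;> simp [h1]
    · exact fun h => absurd h2 h
    · exact fun _ => h2
  have hf : ({v | side v = false} : Finset W) = B ∪ {v ∈ (A ∪ B)ᶜ | side₀ v = false} := by
    ext v
    simp only [Finset.mem_filter, Finset.mem_univ, true_and, Finset.mem_union, Finset.mem_compl, hs]
    split_ifs with h1 h2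
    · simp [h1, Finset.disjoint_left.1 hAB h1]
    · simp [h2]
    · simp [h1, h2]
  have hd1 : Disjoint A {v ∈ (A ∪ B)ᶜ | side₀ v = true} := by
    rw [Finset.disjoint_left]
    intro v hv
    simp [hv]
  have hd2 : Disjoint B {v ∈ (A ∪ B)ᶜ | side₀ v = false} := by
    rw [Finset.disjoint_left]
    intro v hv
    simp [hv]
  have hcR : #{v ∈ (A ∪ B)ᶜ | side₀ v = true} + #{v ∈ (A ∪ B)ᶜ | side₀ v = false} = #(A ∪ B)ᶜ := by
    rw [← Finset.card_filter_add_card_filter_not (s := (A ∪ B)ᶜ) (fun v => side₀ v = true)]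
    simp only [Bool.not_eq_true]
  refine ⟨side, ?_, hsA, hsB, ?_⟩
  · intro β
    cases β
    · rw [hf, Finset.card_union_of_disjoint hd2]
      omega
    · rw [ht, Finset.card_union_of_disjoint hd1]
      omega
  · intro i
    rw [ht, hf, Finset.sum_union hd1, Finset.sum_union hd2, Finset.sum_union hAB]
    have e1 := hs2 i
    have e2 : 0 ≤ ∑ v ∈ A, f i v := Finset.sum_nonneg fun v _ => hf0 i v
    have e3 : 0 ≤ ∑ v ∈ B, f i v := Finset.sum_nonneg fun v _ => hf0 i v
    rw [abs_le] at e1 ⊢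
    constructor <;> linarith [e1.1, e1.2]

end Split

section Rows

theorem exists_good_partition {σ : ℝ} (hσ : 0 < σ) (C : ℕ) : ∃ C' n₀ : ℕ, 1 / σ ≤ C' ∧ ∀ n ≥ n₀,
    ∀ (W : Type) [Fintype W] [DecidableEq W] (w : W → W → ℕ) (x : W) (d : ℕ),
    Fintype.card W = 2 * n → (∑ q, w x q = d) → d ≤ 2 * n → (w x x = 0) →
    ∃ side : W → Bool, (∀ β, #{v | side v = β} = n) ∧ side x = false ∧
      (∀ v, side v = false → w x v ≤ C') ∧
      (∀ v, |∑ q with side q = true, ((if q = x then 0 else min (w v q) C : ℕ) : ℝ) -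
        ∑ q with side q = false, ((if q = x then 0 else min (w v q) C : ℕ) : ℝ)| ≤ 2 * σ * n) ∧
      (∀ v, |∑ q with side q = true, ((if q ≠ x ∧ 0 < w v q then 1 else 0 : ℕ) : ℝ) -
        ∑ q with side q = false, ((if q ≠ x ∧ 0 < w v q then 1 else 0 : ℕ) : ℝ)| ≤ 2 * σ * n) ∧
      |∑ q with side q = true, ((if C' < w x q then 0 else w x q : ℕ) : ℝ) -
        ∑ q with side q = false, ((if C' < w x q then 0 else w x q : ℕ) : ℝ)| ≤ 2 * σ * n := by
  set C' : ℕ := ⌈8 * ((C : ℝ) + 3) / σ⌉₊ + 4 with hC'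
  have hC'1 : 8 * ((C : ℝ) + 3) ≤ σ * C' := by
    have := Nat.le_ceil (8 * ((C : ℝ) + 3) / σ)
    rw [div_le_iff₀ hσ] at this
    rw [hC']
    push_cast
    nlinarith
  have hC'4 : 4 ≤ C' := by omega
  obtain ⟨n₁, h⟩ := exists_balanced_extension (K := C' + C + 1) hσ (by positivity)
  refine ⟨C', max (max n₁ 2) ⌈4 * ((C : ℝ) + 3) / σ⌉₊, ?_, fun n hn W _ _ w x d hW hd hdn hdiag => ?_⟩
  · rw [div_le_iff₀ hσ]
    have : (0 : ℝ) ≤ C := by positivity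
    nlinarith
  have hn1 : n₁ ≤ n := by omega
  have hn2 : 2 ≤ n := by omega
  have hn3 : 4 * ((C : ℝ) + 3) ≤ σ * n := by
    have h1 : 4 * ((C : ℝ) + 3) / σ ≤ n := by
      refine (Nat.le_ceil _).trans ?_
      exact_mod_cast (le_max_right _ _).trans hn
    rw [div_le_iff₀ hσ] at h1
    linarith
  set T : Finset W := {v | C' < w x v} with hT
  have hcount : ∀ a : ℕ, #{v | a ≤ w x v} * a ≤ d := by
    intro a
    have e1 : #{v | a ≤ w x v} • a ≤ ∑ v with a ≤ w x v, w x v :=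
      Finset.card_nsmul_le_sum _ _ _ fun v hv => (Finset.mem_filter.1 hv).2
    rw [smul_eq_mul] at e1
    exact e1.trans (hd ▸ Finset.sum_le_univ_sum_of_nonneg fun _ => Nat.zero_le _)
  have hTC : #T * C' ≤ 2 * n := by
    refine le_trans (Nat.mul_le_mul_right _ (Finset.card_le_card fun v hv => ?_))
      ((hcount C').trans hdn)
    simp only [hT, Finset.mem_filter, Finset.mem_univ, true_and] at hv ⊢
    omega
  have hfour := hcount 4
  have hT4 : #T ≤ #{v | 4 ≤ w x v} := by
    refine Finset.card_le_card fun v hv => ?_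
    simp only [hT, Finset.mem_filter, Finset.mem_univ, true_and] at hv ⊢
    omega
  have hlight : #T + 1 ≤ #(({v | ¬ 4 ≤ w x v} : Finset W) \ {x}) := by
    have e1 := Finset.card_filter_add_card_filter_not (s := (univ : Finset W)) (fun v => 4 ≤ w x v)
    rw [Finset.card_univ, hW] at e1
    have e2 := Finset.le_card_sdiff ({x} : Finset W) ({v | ¬ 4 ≤ w x v} : Finset W)
    rw [Finset.card_singleton] at e2
    omega
  obtain ⟨P, hP, hPc⟩ := Finset.exists_subset_card_eq hlight
  have hPne : P.Nonempty := Finset.card_pos.1 (by omega)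
  obtain ⟨y, hy⟩ := hPne
  have hPl : ∀ v ∈ P, w x v < 4 ∧ v ≠ x := by
    intro v hv
    have := hP hv
    simp only [Finset.mem_sdiff, Finset.mem_filter, Finset.mem_univ, true_and,
      Finset.mem_singleton] at this
    exact ⟨by omega, this.2⟩
  have hPT : ∀ v ∈ P, v ∉ T := by
    intro v hv hvT
    have := (hPl v hv).1
    have := (Finset.mem_filter.1 hvT).2
    omega
  have hxT : x ∉ T := by simp [hT, hdiag]
  have hxP : x ∉ P.erase y := fun hx => (hPl x (Finset.mem_of_mem_erase hx)).2 rfl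
  have hdisj : Disjoint (insert y T) (insert x (P.erase y)) := by
    rw [Finset.disjoint_left]
    intro v hv hv'
    rw [Finset.mem_insert] at hv hv'
    rcases hv with rfl | hv
    · rcases hv' with h1 | h1
      · exact (hPl v hy).2 h1
      · exact absurd rfl (Finset.ne_of_mem_erase h1)
    · rcases hv' with rfl | h1
      · exact hxT hv
      · exact hPT v (Finset.mem_of_mem_erase h1) hv
  have hcA : #(insert y T) = #T + 1 := Finset.card_insert_of_notMem (hPT y hy)
  have hcB : #(insert x (P.erase y)) = #T + 1 := by
    rw [Finset.card_insert_of_notMem hxP, Finset.card_erase_of_mem hy]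
    omega
  let f : Option (W × Bool) → W → ℕ := fun i q => match i with
    | none => if C' < w x q then 0 else w x q
    | some (v, false) => if q = x then 0 else min (w v q) C
    | some (v, true) => if q ≠ x ∧ 0 < w v q then 1 else 0
  obtain ⟨side, h1, h2, h3, h4⟩ := h n hn1 W (Option (W × Bool)) (fun i q => (f i q : ℝ))
    (insert y T) (insert x (P.erase y)) hdisj (by omega) hW
    (by rw [Fintype.card_option, Fintype.card_prod, Fintype.card_bool]; omega)
    (fun _ _ => Nat.cast_nonneg _) (by
      rintro (_ | ⟨v, _ | _⟩) q
      · have : f none q ≤ C' + C + 1 := by simp only [f]; split_ifs <;> omega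
        exact_mod_cast this
      · have : f (some (v, false)) q ≤ C' + C + 1 := by simp only [f]; split_ifs <;> omega
        exact_mod_cast this
      · have : f (some (v, true)) q ≤ C' + C + 1 := by simp only [f]; split_ifs <;> omega
        exact_mod_cast this)
  have hforced : ∀ i, ∑ v ∈ insert y T ∪ insert x (P.erase y), (f i v : ℝ) ≤ σ * n := by
    intro i
    have e1 : ∀ v ∈ insert y T ∪ insert x (P.erase y), f i v ≤ C + 3 := by
      intro v hv
      rcases i with _ | ⟨u, _ | _⟩
      · simp only [f]
        split_ifs with hl
        · exact Nat.zero_le _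
        · rw [Finset.mem_union, Finset.mem_insert, Finset.mem_insert] at hv
          rcases hv with (rfl | hv) | (rfl | hv)
          · have := (hPl v hy).1
            omega
          · exact absurd (Finset.mem_filter.1 hv).2 hl
          · omega
          · have := (hPl v (Finset.mem_of_mem_erase hv)).1
            omega
      · simp only [f]; split_ifs <;> omega
      · simp only [f]; split_ifs <;> omega
    have e2 := Finset.sum_le_card_nsmul _ _ _ e1
    rw [Finset.card_union_of_disjoint hdisj, hcA, hcB, smul_eq_mul] at e2
    have e3 : ((∑ v ∈ insert y T ∪ insert x (P.erase y), f i v : ℕ) : ℝ) ≤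
        ((#T + 1 + (#T + 1)) * (C + 3) : ℕ) := by exact_mod_cast e2
    push_cast at e3
    have e4 : (#T : ℝ) * C' ≤ 2 * n := by exact_mod_cast hTC
    have e5 : (#T : ℝ) * (8 * ((C : ℝ) + 3)) ≤ σ * (2 * n) := by
      calc (#T : ℝ) * (8 * ((C : ℝ) + 3)) ≤ #T * (σ * C') := by gcongr
        _ = σ * (#T * C') := by ring
        _ ≤ σ * (2 * n) := by gcongr
    linarith
  have hall : ∀ i, |∑ v with side v = true, (f i v : ℝ) - ∑ v with side v = false, (f i v : ℝ)| ≤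
      2 * σ * n := fun i => (h4 i).trans (by linarith [hforced i])
  refine ⟨side, h1, h3 x (by simp), ?_, fun v => hall (some (v, false)),
    fun v => hall (some (v, true)), hall none⟩
  intro v hv
  by_contra! hlt
  have := h2 v (Finset.mem_insert_of_mem (Finset.mem_filter.2 ⟨mem_univ v, hlt⟩))
  rw [hv] at this
  exact absurd this (by simp)

end Rows

section Degrees

variable {W : Type*} [DecidableEq W] [Fintype W]

/-- The edges at `x` coloured in the first stage: all those to the side of `x`, and half of the
heavy ones. -/
def halfHeavy (side : W → Bool) (w : W → W → ℕ) (x : W) (C' : ℕ) (v : W) : ℕ :=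
  if side v = true then (if C' < w x v then w x v / 2 else 0) else w x v

theorem sum_side (side : W → Bool) (f : W → ℕ) :
    ∑ v with side v = true, f v + ∑ v with side v = false, f v = ∑ v, f v := by
  rw [← Finset.sum_filter_add_sum_filter_not univ (fun v => side v = true)]
  simp only [Bool.not_eq_true]

theorem abs_degree_innerPart_le {side : W → Bool} {w : W → W → ℕ} {x : W} {d C C' n R : ℕ} {σ : ℝ}
    (hσ : 0 < σ) (hC'σ : 1 / σ ≤ C') (hdn : d ≤ 2 * n)
    (hw : ∀ p q, w p q = w q p) (hdiag : w x x = 0)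
    (hreg : ∀ p, ∑ q, w p q = d) (hC' : ∀ v, side v = false → w x v ≤ C')
    (hex : ∀ v, v ≠ x → ∑ q, (if q = x then 0 else w v q - C) ≤ R)
    (h1 : ∀ v, |∑ q with side q = true, ((if q = x then 0 else min (w v q) C : ℕ) : ℝ) -
      ∑ q with side q = false, ((if q = x then 0 else min (w v q) C : ℕ) : ℝ)| ≤ 2 * σ * n)
    (h2 : |∑ q with side q = true, ((if C' < w x q then 0 else w x q : ℕ) : ℝ) -
      ∑ q with side q = false, ((if C' < w x q then 0 else w x q : ℕ) : ℝ)| ≤ 2 * σ * n) (p : W) :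
    |2 * ((∑ q, innerPart side w x C (halfHeavy side w x C') p q : ℕ) : ℝ) - d| ≤
      4 * σ * n + R + C' + 2 := by
  by_cases hp : p = x
  · subst hp
    have e0 : ∑ q, innerPart side w p C (halfHeavy side w p C') p q =
        ∑ q, halfHeavy side w p C' q := by simp [innerPart]
    have e1 := sum_side side (halfHeavy side w p C')
    have e2 := sum_side side (w p)
    have e3 : ∑ q with side q = false, halfHeavy side w p C' q =
        ∑ q with side q = false, w p q :=
      Finset.sum_congr rfl fun q hq => by simp [halfHeavy, (Finset.mem_filter.1 hq).2]
    have e4 : ∑ q with side q = false, (if C' < w p q then 0 else w p q) =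
        ∑ q with side q = false, w p q := by
      refine Finset.sum_congr rfl fun q hq => ?_
      have := hC' q (Finset.mem_filter.1 hq).2
      rw [if_neg (by omega)]
    have e5 : 2 * ∑ q with side q = true, halfHeavy side w p C' q +
        ∑ q with side q = true, (if C' < w p q then 0 else w p q) ≤
        ∑ q with side q = true, w p q := by
      rw [Finset.mul_sum, ← Finset.sum_add_distrib]
      refine Finset.sum_le_sum fun q hq => ?_
      simp only [halfHeavy, (Finset.mem_filter.1 hq).2, if_true]
      split_ifs <;> omega
    have e6 : ∑ q with side q = true, w p q ≤ 2 * ∑ q with side q = true, halfHeavy side w p C' q +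
        ∑ q with side q = true, (if C' < w p q then 0 else w p q) + #{q | C' < w p q} := by
      rw [Finset.card_filter, ← sum_side side (fun q => if C' < w p q then 1 else 0),
        ← add_assoc, Finset.mul_sum, ← Finset.sum_add_distrib, ← Finset.sum_add_distrib]
      refine le_trans (Finset.sum_le_sum fun q hq => ?_) (Nat.le_add_right _ _)
      simp only [halfHeavy, (Finset.mem_filter.1 hq).2, if_true]
      split_ifs <;> omega
    have e7 : #{q | C' < w p q} * C' ≤ d := by
      have : #{q | C' < w p q} • C' ≤ ∑ q with C' < w p q, w p q :=
        Finset.card_nsmul_le_sum _ _ _ fun v hv => (Finset.mem_filter.1 hv).2.le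
      rw [smul_eq_mul] at this
      exact this.trans (hreg p ▸ Finset.sum_le_univ_sum_of_nonneg fun _ => Nat.zero_le _)
    have e8 : (#{q | C' < w p q} : ℝ) ≤ 2 * σ * n := by
      rw [div_le_iff₀ hσ] at hC'σ
      have : (#{q | C' < w p q} : ℝ) * C' ≤ 2 * n := by exact_mod_cast e7.trans hdn
      have h0 : (0 : ℝ) ≤ #{q | C' < w p q} := Nat.cast_nonneg _
      nlinarith
    have e9 := hreg p
    rw [e0]
    rw [← Nat.cast_sum, ← Nat.cast_sum] at h2
    rw [e4] at h2
    rw [abs_le] at h2 ⊢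
    have f1 : ((∑ q, halfHeavy side w p C' q : ℕ) : ℝ) =
        (∑ q with side q = true, halfHeavy side w p C' q : ℕ) +
          (∑ q with side q = false, w p q : ℕ) := by
      rw [← e1, e3]
      push_cast
      rfl
    have f2 : (d : ℝ) = (∑ q with side q = true, w p q : ℕ) +
        (∑ q with side q = false, w p q : ℕ) := by
      rw [← e9, ← e2]
      push_cast
      rfl
    have f5 := (Nat.cast_le (α := ℝ)).2 e5
    have f6 := (Nat.cast_le (α := ℝ)).2 e6
    rw [Nat.cast_add, Nat.cast_mul] at f5
    rw [Nat.cast_add, Nat.cast_add, Nat.cast_mul] at f6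
    have r0 : (0 : ℝ) ≤ R := Nat.cast_nonneg _
    have r1 : (0 : ℝ) ≤ C' := Nat.cast_nonneg _
    rw [f1, f2]
    rw [Nat.cast_ofNat] at f5 f6
    constructor <;> linarith [h2.1, h2.2]
  · set m : W → ℕ := fun q => if q = x then 0 else min (w p q) C with hm
    have e0 : ∑ q, innerPart side w x C (halfHeavy side w x C') p q =
        halfHeavy side w x C' p + ∑ q with side q = side p, m q := by
      have : halfHeavy side w x C' p = ∑ q, if q = x then halfHeavy side w x C' p else 0 := by simp
      rw [this, Finset.sum_filter, ← Finset.sum_add_distrib]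
      refine Finset.sum_congr rfl fun q _ => ?_
      simp only [innerPart, hp, if_false, hm]
      by_cases hq : q = x
      · simp [hq]
      · simp only [hq, if_false, zero_add]
        exact if_congr eq_comm rfl rfl
    have e1 := sum_side side m
    have e2 : ∑ q, m q + ∑ q, (if q = x then 0 else w p q - C) + w x p = d := by
      have : w x p = ∑ q, if q = x then w x p else 0 := by simp
      rw [this, ← hreg p, ← Finset.sum_add_distrib, ← Finset.sum_add_distrib]
      refine Finset.sum_congr rfl fun q _ => ?_
      simp only [hm]
      split_ifs with h
      · rw [h, hw p x]; omega
      · omega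
    have e3 := hex p hp
    have e4 : 2 * halfHeavy side w x C' p ≤ w x p + C' ∧
        w x p ≤ 2 * halfHeavy side w x C' p + C' + 1 := by
      unfold halfHeavy
      split_ifs with g1 g2
      · omega
      · omega
      · have := hC' p (by simpa using g1)
        omega
    have h1p := h1 p
    rw [← Nat.cast_sum, ← Nat.cast_sum, abs_le] at h1p
    rw [e0, abs_le]
    have f1 : ((∑ q with side q = true, m q : ℕ) : ℝ) + (∑ q with side q = false, m q : ℕ) +
        (∑ q, (if q = x then 0 else w p q - C) : ℕ) + w x p = d := by
      rw [← e2, ← e1]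
      push_cast
      rfl
    have f3 := (Nat.cast_le (α := ℝ)).2 e3
    have f4 := (Nat.cast_le (α := ℝ)).2 e4.1
    have f5 := (Nat.cast_le (α := ℝ)).2 e4.2
    have f6 : (0 : ℝ) ≤ (∑ q, (if q = x then 0 else w p q - C) : ℕ) := Nat.cast_nonneg _
    have f7 : (0 : ℝ) ≤ σ * n := by positivity
    rw [Nat.cast_add, Nat.cast_mul, Nat.cast_ofNat] at f4
    rw [Nat.cast_add, Nat.cast_add, Nat.cast_mul, Nat.cast_ofNat, Nat.cast_one] at f5
    rw [Nat.cast_add]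
    simp only [← hm] at h1p
    cases side p <;> constructor <;> linarith [h1p.1, h1p.2]

end Degrees

section Main

theorem card_cross_ge {W : Type*} [DecidableEq W] [Fintype W] (side : W → Bool) (P : W → Prop)
    [DecidablePred P] (v : W) {σ N : ℝ} (h : |∑ q with side q = true, ((if P q then 1 else 0 : ℕ) : ℝ) -
        ∑ q with side q = false, ((if P q then 1 else 0 : ℕ) : ℝ)| ≤ 2 * σ)
    (hN : N ≤ #{q | P q}) : N / 2 - σ ≤ #{q | side v ≠ side q ∧ P q} := by
  have e := (sum_side side (fun q => if P q then 1 else 0)).trans (Finset.card_filter P univ).symm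
  have e' : ∀ β, #{q | side q = β ∧ P q} = ∑ q with side q = β, if P q then 1 else 0 := by
    intro β
    rw [← Finset.card_filter, Finset.filter_filter]
  rw [← e', ← e'] at e
  rw [← Nat.cast_sum, ← Nat.cast_sum, ← e', ← e', abs_le] at h
  rw [← e] at hN
  rw [Nat.cast_add] at hN
  cases hv : side v
  · have : #{q | false ≠ side q ∧ P q} = #{q | side q = true ∧ P q} := by
      congr 1; ext q; cases side q <;> simp
    rw [this]
    linarith [h.1, h.2]
  · have : #{q | true ≠ side q ∧ P q} = #{q | side q = false ∧ P q} := by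
      congr 1; ext q; cases side q <;> simp
    rw [this]
    linarith [h.1, h.2]

set_option maxHeartbeats 2000000 in
/-- Numerical parameters for `factorable_of_partition`. -/
theorem exists_parameters {ε : ℝ} (hε : 0 < ε) (hε1 : ε < 1) (Q : ℕ) : ∃ σ : ℝ, 0 < σ ∧
    ∀ C C' : ℕ, ∃ n₀ : ℕ, ∀ n ≥ n₀, ∀ d : ℕ, d ≤ 2 * n → ∀ z ≤ Q, ∀ R : ℕ, (R : ℝ) ≤ σ * n →
    ∃ k s s' b q t r₁ N N' r K mm cap F : ℕ, 2 ≤ n ∧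
      (∀ m : ℕ, |2 * (m : ℝ) - d| ≤ 4 * σ * n + R + C' + 2 → m + s ≤ k ∧ k ≤ m + s') ∧
      (∀ m m' : ℕ, 2 * (m : ℝ) + ε * n ≤ d / 2 + 1 + 2 * C' →
        2 * (m' : ℝ) + ε * n ≤ d / 2 + 1 + 2 * C' → m + m' + (z * s' + t) + K + k ≤ d) ∧
      C * k < s * s ∧ s' ≤ r₁ ∧ 3 * (2 * n * s') < (t + 1) * (b + 1 - 2 * z) ∧
      (∀ m : ℕ, (1 + ε) * n / 2 - σ * n ≤ m → N + z ≤ m) ∧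
      (∀ m : ℕ, (n : ℝ) / 2 / 2 - σ * n ≤ m → N' ≤ m) ∧
      k * (b + 2) < r₁ * (q + 1) ∧ n + 2 * (r₁ + b + 2 + 2 * q) < 2 * N ∧
      R + (z * s' + t) + r₁ ≤ r ∧ r ≤ K ∧ K ≤ 3 * mm ∧ 4 * r + 2 * mm + 2 * C' + F < K ∧
      4 ≤ cap ∧ 2 * n * r + 2 * K < (F + 1) * (cap - 3) ∧ n + 2 * (K + cap + r₁) < 2 * N ∧
      z + K + cap + r₁ ≤ N ∧ z + K + cap ≤ N' := by
  obtain ⟨ρ, hρ⟩ : ∃ ρ, ρ = ε ^ 2 / 65536 := ⟨_, rfl⟩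
  obtain ⟨β, hβ⟩ : ∃ β, β = ρ * (ε / 64) / 16 := ⟨_, rfl⟩
  obtain ⟨σ, hσ⟩ : ∃ σ, σ = ρ * β / (256 * (Q + 1)) := ⟨_, rfl⟩
  have hQ0 : (0 : ℝ) ≤ Q := Nat.cast_nonneg _
  have hρ0 : 0 < ρ := by rw [hρ]; positivity
  have hβ0 : 0 < β := by rw [hβ]; positivity
  have hσ0 : 0 < σ := by rw [hσ]; positivity
  have c1 : ρ ≤ ε / 65536 := by rw [hρ]; nlinarith
  have c2 : β ≤ ρ / 1000 := by rw [hβ]; nlinarith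
  have cσ : σ * (Q + 1) = ρ * β / 256 := by rw [hσ]; field_simp
  have c3 : σ ≤ β / 256 := by nlinarith
  have c4 : Q * σ ≤ ρ / 256 := by nlinarith
  have c5 : 256 * σ ≤ ρ * β := by nlinarith
  have hσ1 : σ ≤ 1 := by nlinarith
  refine ⟨σ, hσ0, fun C C' => ⟨⌈((C' + C + Q + 100 : ℝ)) / σ ^ 2⌉₊, fun n hn d hd z hz R hR => ?_⟩⟩
  have hn' : ((C' + C + Q + 100 : ℝ)) ≤ σ ^ 2 * n := by
    have := (Nat.le_ceil _).trans (Nat.cast_le (α := ℝ).2 hn)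
    rwa [div_le_iff₀ (by positivity), mul_comm] at this
  have hC0 : (0 : ℝ) ≤ C := Nat.cast_nonneg _
  have hC'0 : (0 : ℝ) ≤ C' := Nat.cast_nonneg _
  have hR0 : (0 : ℝ) ≤ R := Nat.cast_nonneg _
  have hd0 : (0 : ℝ) ≤ d := Nat.cast_nonneg _
  have hz0 : (0 : ℝ) ≤ z := Nat.cast_nonneg _
  have hz' : (z : ℝ) ≤ Q := Nat.cast_le.2 hz
  have hd' : (d : ℝ) ≤ 2 * n := by exact_mod_cast hd
  obtain ⟨x, hx⟩ : ∃ x : ℝ, x = n := ⟨_, rfl⟩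
  have hx0 : 0 ≤ x := hx ▸ Nat.cast_nonneg _
  rw [← hx] at hn' hR hd'
  obtain ⟨S, hS⟩ : ∃ S, S = σ * x := ⟨_, rfl⟩
  obtain ⟨B, hB⟩ : ∃ B, B = β * x := ⟨_, rfl⟩
  obtain ⟨P, hP⟩ : ∃ P, P = ρ * x := ⟨_, rfl⟩
  obtain ⟨X, hX⟩ : ∃ X, X = ε * x := ⟨_, rfl⟩
  have hSb : C' + C + Q + 100 ≤ S := by rw [hS]; nlinarith only [mul_nonneg hσ0.le hx0, hn', hσ1]
  have l1 : P ≤ X / 65536 := by rw [hP, hX]; nlinarith only [c1, hx0]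
  have l2 : B ≤ P / 1000 := by rw [hB, hP]; nlinarith only [c2, hx0]
  have l3 : S ≤ B / 256 := by rw [hS, hB]; nlinarith only [c3, hx0]
  have l4 : Q * S ≤ P / 256 := by rw [hS, hP]; nlinarith only [c4, hx0]
  have l5 : X ≤ x := by rw [hX]; nlinarith only [hε1, hx0]
  have m1 : (C' + C + Q + 100) * x ≤ S * S := by rw [hS]; nlinarith only [hn', hx0]
  have m2 : 256 * S * x ≤ P * B := by rw [hS, hP, hB]; nlinarith only [mul_nonneg hx0 hx0, c5]
  have m3 : 16 * B * x = P * (X / 64) := by rw [hP, hX, hB, hβ]; ring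
  have m4 : 65536 * P * x = X * X := by rw [hP, hX, hρ]; ring
  rw [← hS] at hR
  have hS100 : 100 ≤ S := by linarith
  have nat : ∀ y : ℝ, 0 ≤ y → ∃ m : ℕ, (m : ℝ) ≤ y ∧ y ≤ m + 1 := fun y hy =>
    ⟨⌊y⌋₊, Nat.floor_le hy, (Nat.lt_floor_add_one y).le⟩
  obtain ⟨s, s1, s2⟩ := nat (3 * S) (by linarith)
  obtain ⟨k, k1, k2⟩ := nat (d / 2 + 6 * S + 1) (by linarith)
  obtain ⟨s', t1, t2⟩ := nat (10 * S + 1) (by linarith)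
  obtain ⟨r₁, r1, r2⟩ := nat P (by linarith)
  obtain ⟨b, b1, b2⟩ := nat B (by linarith)
  obtain ⟨q, q1, q2⟩ := nat (X / 64) (by linarith)
  obtain ⟨K, K1, K2⟩ := nat (X / 16) (by linarith)
  obtain ⟨F, F1, F2⟩ := nat (X / 192) (by linarith)
  obtain ⟨N, N1, N2⟩ := nat (x / 2 + X / 2 - 2 * S) (by linarith)
  obtain ⟨N', N3, N4⟩ := nat (x / 4 - 2 * S) (by linarith)
  obtain ⟨mm, M1, M2⟩ : ∃ mm, 5 * mm ≤ 2 * K + 5 ∧ K ≤ 3 * mm := ⟨2 * K / 5 + 1, by omega, by omega⟩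
  have M1' : 5 * (mm : ℝ) ≤ 2 * K + 5 := by exact_mod_cast M1
  have zs : (z : ℝ) * s' ≤ P / 20 := by
    have : (z : ℝ) * s' ≤ Q * (11 * S) := mul_le_mul hz' (by linarith) (Nat.cast_nonneg _) hQ0
    linarith
  have hz2b : 2 * z ≤ b := by
    have : 2 * (z : ℝ) ≤ b := by linarith
    exact_mod_cast this
  have hK4 : 4 ≤ K := by
    have : (4 : ℝ) ≤ K := by linarith
    exact_mod_cast this
  refine ⟨k, s, s', b, q, r₁, r₁, N, N', R + (z * s' + r₁) + r₁, K, mm, K, F, ?_, ?_, ?_, ?_, ?_,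
    ?_, ?_, ?_, ?_, ?_, le_rfl, ?_, M2, ?_, hK4, ?_, ?_, ?_, ?_⟩
  · have : (2 : ℝ) ≤ n := by linarith
    exact_mod_cast this
  · intro m hm
    rw [mul_assoc, ← hx, ← hS, abs_le] at hm
    constructor
    · have : (m : ℝ) + s ≤ k := by linarith [hm.1, hm.2]
      exact_mod_cast this
    · have : (k : ℝ) ≤ m + s' := by linarith [hm.1, hm.2]
      exact_mod_cast this
  · intro m m' hm hm'
    rw [← hx, ← hX] at hm hm'
    have : (m : ℝ) + m' + (z * s' + r₁) + K + k ≤ d := by linarith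
    exact_mod_cast this
  · have : (C : ℝ) * k < s * s := by
      have a1 : (C : ℝ) * k ≤ C * (2 * x) := mul_le_mul_of_nonneg_left (by linarith) hC0
      have a2 : (2 * S) * (2 * S) ≤ s * s := by
        have : 2 * S ≤ s := by linarith
        exact mul_le_mul this this (by linarith) (by linarith)
      have a3 : 0 < x * 100 := by linarith
      linarith only [a1, a2, a3, m1, mul_nonneg hC'0 hx0, mul_nonneg hC0 hx0, mul_nonneg hQ0 hx0]
    exact_mod_cast this
  · have : (s' : ℝ) ≤ r₁ := by linarith
    exact_mod_cast this
  · have : (3 : ℝ) * (2 * n * s') < (r₁ + 1) * (b + 1 - 2 * z) := by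
      rw [← hx]
      have a1 : x * s' ≤ x * (11 * S) := mul_le_mul_of_nonneg_left (by linarith) hx0
      have a2 : P * (B / 2) ≤ (r₁ + 1) * (b + 1 - 2 * z) :=
        mul_le_mul r2 (by linarith) (by linarith) (by linarith)
      have a3 : 0 < x * S := mul_pos (by linarith) (by linarith)
      linarith only [a1, a2, a3, m2]
    have e : ((b + 1 - 2 * z : ℕ) : ℝ) = b + 1 - 2 * z := by
      rw [Nat.cast_sub (by omega)]; push_cast; ring
    rw [← e] at this
    exact_mod_cast this
  · intro m hm
    rw [← hx, ← hS, add_mul, ← hX] at hm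
    have : (N : ℝ) + z ≤ m := by linarith
    exact_mod_cast this
  · intro m hm
    rw [← hx, ← hS] at hm
    have : (N' : ℝ) ≤ m := by linarith
    exact_mod_cast this
  · have : (k : ℝ) * (b + 2) < r₁ * (q + 1) := by
      have a1 : (k : ℝ) * (b + 2) ≤ (2 * x) * (2 * B) :=
        mul_le_mul (by linarith) (by linarith) (by positivity) (by linarith)
      have a2 : (P / 2) * (X / 64) ≤ r₁ * (q + 1) :=
        mul_le_mul (by linarith) q2 (by linarith) (by positivity)
      have a3 : 0 < B * x := mul_pos (by linarith) (by linarith)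
      linarith only [a1, a2, a3, m3]
    exact_mod_cast this
  · have : (n : ℝ) + 2 * (r₁ + b + 2 + 2 * q) < 2 * N := by linarith
    exact_mod_cast this
  · have : (R : ℝ) + (z * s' + r₁) + r₁ ≤ K := by linarith
    exact_mod_cast this
  · have : 4 * ((R : ℝ) + (z * s' + r₁) + r₁) + 2 * mm + 2 * C' + F < K := by linarith
    exact_mod_cast this
  · have : 2 * (n : ℝ) * (R + (z * s' + r₁) + r₁) + 2 * K < (F + 1) * (K - 3) := by
      rw [← hx]
      have a1 : x * (R + (z * s' + r₁) + r₁) ≤ x * (3 * P) :=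
        mul_le_mul_of_nonneg_left (by linarith) hx0
      have a2 : (X / 192) * (X / 17) ≤ (F + 1) * (K - 3) :=
        mul_le_mul F2 (by linarith) (by linarith) (by positivity)
      have a3 : x * 1 < x * P := mul_lt_mul_of_pos_left (by linarith) (by linarith)
      linarith only [a1, a2, a3, m4, K1, l5]
    have e : ((K - 3 : ℕ) : ℝ) = K - 3 := by
      rw [Nat.cast_sub (by omega)]; push_cast; ring
    rw [← e] at this
    exact_mod_cast this
  · have : (n : ℝ) + 2 * (K + K + r₁) < 2 * N := by linarith
    exact_mod_cast this
  · have : (z : ℝ) + K + K + r₁ ≤ N := by linarith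
    exact_mod_cast this
  · have : (z : ℝ) + K + K ≤ N' := by linarith
    exact_mod_cast this

/-- A regular multigraph of high minimum degree, with one exceptional vertex `x` and a bounded
number of vertices of moderately small degree, has a `1`-factorization. -/
theorem factorable_of_regular {ε : ℝ} (hε : 0 < ε) (hε1 : ε < 1) (Q : ℕ) : ∃ ρ : ℝ, 0 < ρ ∧
    ∀ C : ℕ, ∃ n₀ : ℕ, ∀ n ≥ n₀, ∀ (W : Type) [Fintype W] [DecidableEq W] (w : W → W → ℕ)
    (Z : Finset W) (x : W) (d : ℕ), Fintype.card W = 2 * n → x ∈ Z → #Z ≤ Q →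
    (∀ p q, w p q = w q p) → (∀ p, w p p = 0) → (∀ p, ∑ q, w p q = d) → d ≤ 2 * n →
    (∀ v, v ∉ Z → (1 + ε) * n ≤ #{u | u ≠ x ∧ 0 < w v u}) →
    (∀ v, v ∈ Z → v ≠ x → (n : ℝ) / 2 ≤ #{u | u ≠ x ∧ 0 < w v u}) →
    (∀ v, v ≠ x → (w x v : ℝ) ≤ d / 2 - ε * n) →
    (∀ v, v ≠ x → ((∑ q, (if q = x then 0 else w v q - C) : ℕ) : ℝ) ≤ ρ * n) →
    Factorable w d := by
  obtain ⟨σ, hσ, H⟩ := exists_parameters hε hε1 Q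
  refine ⟨σ, hσ, fun C => ?_⟩
  obtain ⟨C', n₁, hC'σ, H1⟩ := exists_good_partition hσ C
  obtain ⟨n₂, H2⟩ := H C C'
  refine ⟨max n₁ n₂, fun n hn W _ _ w Z x d hW hxZ hZQ hw hdiag hreg hdn hdeg hdegZ hx hex => ?_⟩
  obtain ⟨side, g1, g2, g3, g4, g5, g6⟩ :=
    H1 n (le_trans (le_max_left _ _) hn) W w x d hW (hreg x) hdn (hdiag x)
  obtain ⟨k, s, s', b, q, t, r₁, N, N', r, K, mm, cap, F, p0, p1, p2, p3, p4, p5, p6, p7, p8, p9,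
      p10, p11, p12, p13, p14, p15, p16, p17, p18⟩ :=
    H2 n (le_trans (le_max_right _ _) hn) d hdn #Z hZQ ⌊σ * n⌋₊ (Nat.floor_le (by positivity))
  have hex' : ∀ v, v ≠ x → ∑ q, (if q = x then 0 else w v q - C) ≤ ⌊σ * n⌋₊ :=
    fun v hv => Nat.le_floor (hex v hv)
  have hD := fun p => p1 _ (abs_degree_innerPart_le hσ hC'σ hdn hw (hdiag x) hreg g3 hex' g4 g6 p)
  have hlamx : halfHeavy side w x C' x = 0 := by simp [halfHeavy, g2, hdiag]
  have hrest : ∀ p, side p = true →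
      2 * ((w x p - halfHeavy side w x C' p : ℕ) : ℝ) + ε * n ≤ d / 2 + 1 + 2 * C' := by
    intro p hp
    have hpx : p ≠ x := by rintro rfl; simp [g2] at hp
    have h1 := hx p hpx
    have h0 : (0 : ℝ) ≤ w x p := Nat.cast_nonneg _
    have h2 : 2 * (w x p - halfHeavy side w x C' p) ≤ w x p + 1 ∨
        w x p - halfHeavy side w x C' p ≤ C' := by
      simp only [halfHeavy, hp, if_true]
      split_ifs <;> omega
    rcases h2 with h2 | h2
    · have h3 : 2 * ((w x p - halfHeavy side w x C' p : ℕ) : ℝ) ≤ w x p + 1 := by exact_mod_cast h2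
      have : (0 : ℝ) ≤ C' := Nat.cast_nonneg _
      linarith
    · have h3 : ((w x p - halfHeavy side w x C' p : ℕ) : ℝ) ≤ C' := by exact_mod_cast h2
      linarith
  have g5' : ∀ v, |∑ q with side q = true, ((if q ≠ x ∧ 0 < w v q then 1 else 0 : ℕ) : ℝ) -
        ∑ q with side q = false, ((if q ≠ x ∧ 0 < w v q then 1 else 0 : ℕ) : ℝ)| ≤ 2 * (σ * n) :=
    fun v => (g5 v).trans_eq (by ring)
  refine factorable_of_partition (C := C) (C' := C') hxZ g2 hw hdiag hreg g1 p0 hlamx ?_ ?_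
    (fun p => (hD p).1)
    (fun p => (hD p).2) g3 hex' (fun p q hp hq _ => p2 _ _ (hrest p hp) (hrest q hq)) p3 p4 p5
    ?_ ?_ p8 p9 p10 p11 p12 p13 p14 p15 p16 p17 p18
  · intro v
    unfold halfHeavy
    split_ifs <;> omega
  · intro v hv
    simp [halfHeavy, hv]
  · intro v hv
    have h1 := p6 _ (card_cross_ge side (fun u => u ≠ x ∧ 0 < w v u) v (g5' v) (hdeg v hv))
    have h2 : ({y | side v ≠ side y ∧ y ≠ x ∧ 0 < w v y} : Finset W) ⊆
        ({y | side v ≠ side y ∧ y ∉ Z ∧ 0 < w v y} : Finset W) ∪ Z := by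
      intro y hy
      simp only [Finset.mem_filter, Finset.mem_univ, true_and, Finset.mem_union] at hy ⊢
      tauto
    have h3 := (Finset.card_le_card h2).trans (Finset.card_union_le _ _)
    omega
  · intro v hv hvx
    exact p7 _ (card_cross_ge side (fun u => u ≠ x ∧ 0 < w v u) v (g5' v) (hdegZ v hv hvx))

end Main

section Realization

variable {W : Type*} [DecidableEq W] [Fintype W]

/-- `F` is a loopless multigraph with degree sequence `f`. -/
structure Realizes (F : W → W → ℕ) (f : W → ℕ) : Prop where
  symm : ∀ p q, F p q = F q p
  diag : ∀ p, F p p = 0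
  sum : ∀ p, ∑ q, F p q = f p

theorem exists_realizes (f : W → ℕ) (he : Even (∑ p, f p)) (hf : ∀ p, 2 * f p ≤ ∑ p, f p) :
    ∃ F, Realizes F f := by
  induction h : ∑ p, f p using Nat.strong_induction_on generalizing f with
  | _ T ih =>
    rcases Nat.eq_zero_or_pos T with h0 | h0
    · refine ⟨fun _ _ => 0, fun _ _ => rfl, fun _ => rfl, fun p => ?_⟩
      rw [h0] at h
      simp [Finset.sum_eq_zero_iff.1 h p (mem_univ p)]
    · have hne : (univ : Finset W).Nonempty := by
        rw [Finset.nonempty_iff_ne_empty]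
        rintro h1
        rw [h1] at h
        simp at h
        omega
      obtain ⟨u, -, hu⟩ := Finset.exists_max_image univ f hne
      have e1 := Finset.add_sum_erase univ f (mem_univ u)
      have hu2 := hf u
      obtain ⟨v, hv, hv0⟩ : ∃ v ∈ univ.erase u, f v ≠ 0 := by
        by_contra! hcon
        rw [Finset.sum_eq_zero hcon] at e1
        omega
      have hvu : v ≠ u := Finset.ne_of_mem_erase hv
      have hfu : 0 < f u := lt_of_lt_of_le (Nat.pos_of_ne_zero hv0) (hu v (mem_univ v))
      set f' : W → ℕ := fun p => f p - (if p = u ∨ p = v then 1 else 0) with hf'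
      have e2 : ∀ p, f' p + (if p = u ∨ p = v then 1 else 0) = f p := by
        intro p
        simp only [hf']
        by_cases h1 : p = u
        · simp only [h1, true_or, if_true]; omega
        · by_cases h2 : p = v
          · simp only [h2, or_true, if_true]; omega
          · simp [h1, h2]
      have e3 : ∑ p, f' p + 2 = T := by
        rw [← h, ← Finset.sum_congr rfl fun p _ => e2 p, Finset.sum_add_distrib]
        congr 1
        rw [← Finset.card_filter, Finset.filter_or, Finset.filter_eq', Finset.filter_eq']
        simp only [mem_univ, if_true]
        rw [Finset.card_union_of_disjoint (by simpa using hvu.symm)]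
        simp
      obtain ⟨T', hT'⟩ := he
      have h3 : ∀ p, p ≠ u → p ≠ v → f p + f u + f v ≤ T := by
        intro p h1 h2
        have e4 := Finset.add_sum_erase (univ.erase u) f hv
        have e5 := Finset.single_le_sum (f := f) (fun _ _ => Nat.zero_le _)
          (Finset.mem_erase.2 ⟨h2, Finset.mem_erase.2 ⟨h1, mem_univ p⟩⟩)
        omega
      obtain ⟨F, hF⟩ := ih (∑ p, f' p) (by omega) f' ⟨T' - 1, by omega⟩ (fun p => by
        have a1 := e2 p
        have a2 := hf p
        by_cases h1 : p = u
        · simp only [h1, true_or, if_true] at a1 a2 ⊢; omega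
        · by_cases h2 : p = v
          · simp only [h2, or_true, if_true] at a1 a2 ⊢; omega
          · have := h3 p h1 h2
            have := hu p (mem_univ p)
            simp only [h1, h2, or_self, if_false] at a1
            omega) rfl
      refine ⟨fun p q => F p q + edge u v p q, fun p q => ?_, fun p => ?_, fun p => ?_⟩
      · rw [hF.symm, edge_symm]
      · rw [hF.diag, edge_self hvu.symm]
      · rw [Finset.sum_add_distrib, hF.sum, sum_edge hvu.symm, e2]

theorem sum_sum_mul_edge (F : W → W → ℤ) {u v : W} (huv : u ≠ v) :
    ∑ p, ∑ q, F p q * edge u v p q = F u v + F v u := by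
  have h1 : ∀ p, ∑ q, F p q * edge u v p q =
      (if p = u then F u v else 0) + if p = v then F v u else 0 := by
    intro p
    by_cases h1 : p = u
    · subst h1
      simp [edge, huv]
    · by_cases h2 : p = v
      · subst h2
        simp [edge, h1]
      · simp [edge, h1, h2]
  simp_rw [h1]
  rw [Finset.sum_add_distrib]
  simp

/-- A realization minimizing the sum of squares admits no improving switch. -/
theorem exists_realizes_switch (f : W → ℕ) (he : Even (∑ p, f p)) (hf : ∀ p, 2 * f p ≤ ∑ p, f p) :
    ∃ F, Realizes F f ∧ ∀ u v a b, u ≠ v → a ≠ u → a ≠ v → b ≠ u → b ≠ v → 0 < F u v →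
      0 < F a b → F u v + F a b ≤ F u a + F v b + 2 := by
  obtain ⟨F, hF, hmin⟩ : ∃ F, Realizes F f ∧ ∀ F', Realizes F' f →
      ∑ p, ∑ q, F p q ^ 2 ≤ ∑ p, ∑ q, F' p q ^ 2 := by
    classical
    have hex : ∃ m F, Realizes F f ∧ ∑ p, ∑ q, F p q ^ 2 = m := by
      obtain ⟨F, hF⟩ := exists_realizes f he hf
      exact ⟨_, F, hF, rfl⟩
    obtain ⟨F, hF, h1⟩ := Nat.find_spec hex
    refine ⟨F, hF, fun F' hF' => ?_⟩
    rw [h1]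
    exact Nat.find_min' hex ⟨F', hF', rfl⟩
  refine ⟨F, hF, fun u v a b huv hau hav hbu hbv h1 h2 => ?_⟩
  have hab : a ≠ b := by rintro rfl; rw [hF.diag] at h2; omega
  have hle : ∀ p q, edge u v p q + edge a b p q ≤ F p q := by
    intro p q
    have e1 := hF.symm u v
    have e2 := hF.symm a b
    unfold edge
    grind
  have key : ∀ p q, F p q - (edge u v p q + edge a b p q) + (edge u a p q + edge v b p q) +
      (edge u v p q + edge a b p q) = F p q + (edge u a p q + edge v b p q) := by
    intro p q
    have := hle p q
    omega
  have hF' : Realizes (fun p q => F p q - (edge u v p q + edge a b p q) +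
      (edge u a p q + edge v b p q)) f := by
    refine ⟨fun p q => ?_, fun p => ?_, fun p => ?_⟩
    · simp only [hF.symm p q, edge_symm _ _ p q]
    · simp [hF.diag, edge_self, hau.symm, hbv.symm]
    · have := Finset.sum_congr rfl fun q (_ : q ∈ univ) => key p q
      simp only [Finset.sum_add_distrib, sum_edge huv, sum_edge hab, sum_edge hau.symm,
        sum_edge hbv.symm, hF.sum] at this ⊢
      grind
  have hsq : ∀ p q, ((F p q - (edge u v p q + edge a b p q) +
      (edge u a p q + edge v b p q) : ℕ) : ℤ) ^ 2 = (F p q : ℤ) ^ 2 +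
        ((1 - 2 * (F p q : ℤ)) * edge u v p q + (1 - 2 * (F p q : ℤ)) * edge a b p q) +
        ((1 + 2 * (F p q : ℤ)) * edge u a p q + (1 + 2 * (F p q : ℤ)) * edge v b p q) := by
    intro p q
    have e := hle p q
    have k := key p q
    have e0 : (edge u v p q + edge a b p q = 0 ∧ edge u a p q + edge v b p q = 0) ∨
      (edge u v p q + edge a b p q = 1 ∧ edge u a p q + edge v b p q = 0) ∨
      (edge u v p q + edge a b p q = 0 ∧ edge u a p q + edge v b p q = 1) := by
      unfold edge
      grind
    rw [add_assoc, ← mul_add, ← mul_add, ← Nat.cast_add, ← Nat.cast_add]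
    generalize edge u v p q + edge a b p q = A at *
    generalize edge u a p q + edge v b p q = B at *
    rcases e0 with ⟨rfl, rfl⟩ | ⟨rfl, rfl⟩ | ⟨rfl, rfl⟩
    · simp
    · rw [Nat.add_zero, Nat.cast_sub e]; push_cast; ring
    · push_cast [Nat.sub_zero]; ring
  have h3 := hmin _ hF'
  have h4 : ∑ p, ∑ q, (F p q : ℤ) ^ 2 ≤ ∑ p, ∑ q, ((F p q - (edge u v p q + edge a b p q) +
      (edge u a p q + edge v b p q) : ℕ) : ℤ) ^ 2 := by exact_mod_cast h3
  simp_rw [hsq, Finset.sum_add_distrib] at h4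
  rw [sum_sum_mul_edge _ huv, sum_sum_mul_edge _ hab, sum_sum_mul_edge _ hau.symm,
    sum_sum_mul_edge _ hbv.symm, hF.symm v u, hF.symm b a, hF.symm a u, hF.symm b v] at h4
  omega

/-- Degree sequences with one distinguished vertex `x` and large total degree have realizations
of bounded multiplicity off `x`. -/
theorem exists_realizes_le (f : W → ℕ) (he : Even (∑ p, f p)) (hf : ∀ p, 2 * f p ≤ ∑ p, f p)
    {x : W} {C m T : ℕ} (hm : ∀ p, p ≠ x → f p ≤ m) (hT : T + 2 * f x = ∑ p, f p)
    (hC : 0 < C) (hlarge : (4 * m + 4 * C) * m < C * T) :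
    ∃ F, Realizes F f ∧ ∀ p q, p ≠ x → q ≠ x → F p q ≤ C := by
  obtain ⟨F, hF, hsw⟩ := exists_realizes_switch f he hf
  refine ⟨F, hF, fun u v hu hv => ?_⟩
  by_contra! hlt
  have huv : u ≠ v := by rintro rfl; rw [hF.diag] at hlt; omega
  let A : W → Finset W := fun u => {a | C ≤ 2 * F u a}
  have hA : ∀ u, u ≠ x → #(A u) * C ≤ 2 * m := by
    intro u hu
    have h1 : #(A u) • C ≤ ∑ a ∈ A u, 2 * F u a :=
      Finset.card_nsmul_le_sum _ _ _ fun a ha => (Finset.mem_filter.1 ha).2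
    rw [smul_eq_mul, ← Finset.mul_sum] at h1
    have h2 : ∑ a ∈ A u, F u a ≤ f u :=
      hF.sum u ▸ Finset.sum_le_univ_sum_of_nonneg fun _ => Nat.zero_le _
    have := hm u hu
    omega
  let S : W → Finset W := fun y => (({u, v} : Finset W) ∪ A y).erase x
  have hS : ∀ y, y ≠ x → #(S y) * C ≤ 2 * m + 2 * C := by
    intro y hy
    have h1 : #(S y) ≤ 2 + #(A y) := (Finset.card_erase_le).trans
      ((Finset.card_union_le _ _).trans (Nat.add_le_add_right Finset.card_le_two _))
    have h2 := hA y hy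
    nlinarith
  have hSf : ∀ y, ∑ p ∈ S y, f p ≤ #(S y) * m := by
    intro y
    rw [← smul_eq_mul]
    exact Finset.sum_le_card_nsmul _ _ _ fun p hp => hm p (Finset.ne_of_mem_erase hp)
  have hpt : ∀ a ∈ univ.erase x, ∀ b ∈ univ.erase x, F a b ≤
      (if a ∈ S u then F a b else 0) + (if b ∈ S v then F a b else 0) := by
    intro a ha b hb
    have ha := Finset.ne_of_mem_erase ha
    have hb := Finset.ne_of_mem_erase hb
    rcases Nat.eq_zero_or_pos (F a b) with h0 | h0
    · simp [h0]
    · by_cases h1 : a ∈ S u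
      · rw [if_pos h1]; omega
      · by_cases h2 : b ∈ S v
        · rw [if_pos h2]; omega
        · exfalso
          simp only [S, A, Finset.mem_erase, Finset.mem_union, Finset.mem_insert,
            Finset.mem_singleton, Finset.mem_filter, mem_univ, true_and, not_and, not_or] at h1 h2
          obtain ⟨⟨h3, h4⟩, h5⟩ := h1 ha
          obtain ⟨⟨h6, h7⟩, h8⟩ := h2 hb
          have := hsw u v a b huv h3 h4 h6 h7 (by omega) h0
          omega
  have hsum : ∀ a, ∑ b ∈ univ.erase x, F a b + F a x = f a := by
    intro a
    rw [← hF.sum a, ← Finset.add_sum_erase univ _ (mem_univ x), add_comm]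
  have hT2 : ∑ a ∈ univ.erase x, ∑ b ∈ univ.erase x, F a b = T := by
    have e1 : ∑ a ∈ univ.erase x, (∑ b ∈ univ.erase x, F a b + F a x) + f x = ∑ p, f p := by
      rw [Finset.sum_congr rfl fun a _ => hsum a, ← Finset.add_sum_erase univ _ (mem_univ x),
        add_comm]
    have e2 := hsum x
    rw [hF.diag] at e2
    rw [Finset.sum_add_distrib] at e1
    simp_rw [hF.symm x] at e2
    omega
  have hle : T ≤ ∑ p ∈ S u, f p + ∑ p ∈ S v, f p := by
    rw [← hT2]
    refine (Finset.sum_le_sum fun a ha => Finset.sum_le_sum fun b hb => hpt a ha b hb).trans ?_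
    simp_rw [Finset.sum_add_distrib]
    refine Nat.add_le_add ?_ ?_
    · calc _ = ∑ a ∈ univ.erase x, if a ∈ S u then ∑ b ∈ univ.erase x, F a b else 0 :=
            Finset.sum_congr rfl fun a _ => by split_ifs <;> simp
        _ ≤ ∑ a, if a ∈ S u then ∑ b ∈ univ.erase x, F a b else 0 :=
            Finset.sum_le_univ_sum_of_nonneg fun _ => Nat.zero_le _
        _ = ∑ a ∈ S u, ∑ b ∈ univ.erase x, F a b := by simp
        _ ≤ _ := Finset.sum_le_sum fun a _ => by have := hsum a; omega
    · rw [Finset.sum_comm]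
      calc _ = ∑ b ∈ univ.erase x, if b ∈ S v then ∑ a ∈ univ.erase x, F a b else 0 :=
            Finset.sum_congr rfl fun a _ => by split_ifs <;> simp
        _ ≤ ∑ b, if b ∈ S v then ∑ a ∈ univ.erase x, F a b else 0 :=
            Finset.sum_le_univ_sum_of_nonneg fun _ => Nat.zero_le _
        _ = ∑ b ∈ S v, ∑ a ∈ univ.erase x, F a b := by simp
        _ ≤ _ := Finset.sum_le_sum fun b _ => by
            have := hsum b
            simp_rw [hF.symm b] at this
            omega
  have h1 := hSf u
  have h2 := hSf v
  have h3 := hS u hu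
  have h4 := hS v hv
  have h5 : C * T ≤ (#(S u) * C + #(S v) * C) * m := by
    calc C * T ≤ C * (#(S u) * m + #(S v) * m) := Nat.mul_le_mul_left _ (by omega)
      _ = _ := by ring
  have h6 : (#(S u) * C + #(S v) * C) * m ≤ (4 * m + 4 * C) * m :=
    Nat.mul_le_mul_right _ (by omega)
  omega

end Realization

section Matchings

variable {V : Type*} [DecidableEq V] [Fintype V]

/-- The adjacency function of a simple graph. -/
structure IsSimple (g : V → V → ℕ) : Prop where
  symm : ∀ p q, g p q = g q p
  diag : ∀ p, g p p = 0
  le_one : ∀ p q, g p q ≤ 1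

theorem even_sum_sum {g : V → V → ℕ} (hg : ∀ p q, g p q = g q p) (hd : ∀ p, g p p = 0) :
    Even (∑ p, ∑ q, g p q) := by
  rw [← ZMod.natCast_eq_zero_iff_even, ← Finset.sum_product', Nat.cast_sum]
  refine Finset.sum_involution (fun a _ => (a.2, a.1)) ?_ ?_ ?_ ?_
  · intro a _
    rw [hg a.2 a.1]
    exact CharTwo.add_self_eq_zero _
  · intro a _ h0 h1
    have : a.2 = a.1 := congrArg Prod.fst h1
    rw [this, hd] at h0
    simp at h0
  · intro a _
    simp
  · intro a _
    rfl

theorem even_card_moved {σ : V → V} (h : Involutive σ) : Even #{v | σ v ≠ v} := by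
  rw [← ZMod.natCast_eq_zero_iff_even, Finset.card_eq_sum_ones, Nat.cast_sum]
  refine Finset.sum_involution (fun a _ => σ a) ?_ ?_ ?_ ?_
  · intro a _
    exact CharTwo.add_self_eq_zero _
  · intro a ha _
    exact (Finset.mem_filter.1 ha).2
  · intro a ha
    simp only [Finset.mem_filter, mem_univ, true_and] at ha ⊢
    rw [h a]
    exact ha.symm
  · intro a _
    exact h a

theorem exists_fixedPointFree (hV : Even (Fintype.card V)) {τ : V → V} (hτ : Involutive τ) :
    ∃ σ : V → V, Involutive σ ∧ (∀ v, σ v ≠ v) ∧ ∀ v, τ v ≠ v → σ v = τ v := by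
  induction h : #{v | τ v = v} using Nat.strong_induction_on generalizing τ with
  | _ m ih =>
    rcases Nat.eq_zero_or_pos m with h0 | h0
    · refine ⟨τ, hτ, fun v hv => ?_, fun _ _ => rfl⟩
      rw [h0, Finset.card_eq_zero] at h
      exact Finset.notMem_empty v (h ▸ by simpa using hv)
    · have he := even_card_fixed hτ hV
      have h2 : 1 < #{v | τ v = v} := by
        rw [h] at he ⊢
        obtain ⟨r, hr⟩ := he
        omega
      obtain ⟨p, hp, q, hq, hpq⟩ := Finset.one_lt_card.1 h2
      simp only [Finset.mem_filter, mem_univ, true_and] at hp hq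
      have hlt : #{v | link τ p q v = v} < m := by
        rw [← h]
        refine Finset.card_lt_card ⟨fun v hv => ?_, fun hcon => ?_⟩
        · simp only [Finset.mem_filter, mem_univ, true_and, link] at hv ⊢
          grind
        · have := hcon (Finset.mem_filter.2 ⟨mem_univ p, hp⟩)
          simp only [link] at this
          grind
      obtain ⟨σ, h3, h4, h5⟩ := ih _ hlt (link_involutive hτ hp hq) rfl
      refine ⟨σ, h3, h4, fun v hv => ?_⟩
      have hvp : v ≠ p := by rintro rfl; exact hv hp
      have hvq : v ≠ q := by rintro rfl; exact hv hq
      have e : link τ p q v = τ v := by simp [link, hvp, hvq]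
      rw [h5 v (by rwa [e]), e]

/-- A version of Dirac's theorem: perfect matchings of the subgraph induced on `U`. -/
theorem exists_matching {g : V → V → ℕ} (hg : IsSimple g) {U : Finset V} (hU : Even #U)
    (hdeg : ∀ u ∈ U, #U ≤ 2 * #{v ∈ U | 0 < g u v}) :
    ∃ σ : V → V, Involutive σ ∧ (∀ v, v ∉ U → σ v = v) ∧ ∀ v ∈ U, 0 < g v (σ v) := by
  suffices H : ∀ (m : ℕ) (τ : V → V), Involutive τ → (∀ v, v ∉ U → τ v = v) →
      (∀ v, τ v ≠ v → 0 < g v (τ v)) → #{v ∈ U | τ v = v} = m →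
      ∃ σ : V → V, Involutive σ ∧ (∀ v, v ∉ U → σ v = v) ∧ ∀ v ∈ U, 0 < g v (σ v) from
    H _ id (fun _ => rfl) (fun _ _ => rfl) (fun v hv => absurd rfl hv) rfl
  intro m
  induction m using Nat.strong_induction_on with
  | _ m ih =>
    intro τ hτ hfix hadj hm
    rcases Nat.eq_zero_or_pos m with h0 | h0
    · refine ⟨τ, hτ, hfix, fun v hv => hadj v fun hcon => ?_⟩
      rw [h0, Finset.card_eq_zero] at hm
      exact Finset.notMem_empty v (hm ▸ Finset.mem_filter.2 ⟨hv, hcon⟩)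
    · have hmoved : ({v | τ v ≠ v} : Finset V) = {v ∈ U | τ v ≠ v} := by
        ext v
        simp only [Finset.mem_filter, mem_univ, true_and]
        exact ⟨fun h => ⟨by_contra fun hv => h (hfix v hv), h⟩, fun h => h.2⟩
      have he := even_card_moved hτ
      rw [hmoved] at he
      have hs := Finset.card_filter_add_card_filter_not (s := U) (fun v => τ v = v)
      have h2 : 1 < #{v ∈ U | τ v = v} := by
        obtain ⟨r, hr⟩ := he
        obtain ⟨r', hr'⟩ := hU
        simp only [ne_eq] at hr
        omega
      obtain ⟨p, hp, q, hq, hpq⟩ := Finset.one_lt_card.1 h2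
      obtain ⟨hpU, hp⟩ := Finset.mem_filter.1 hp
      obtain ⟨hqU, hq⟩ := Finset.mem_filter.1 hq
      have one : ∀ p, p ∈ U → τ p = p → (∃ a ∈ U, 0 < g p a ∧ τ a = a) →
          ∃ σ : V → V, Involutive σ ∧ (∀ v, v ∉ U → σ v = v) ∧ ∀ v ∈ U, 0 < g v (σ v) := by
        rintro p hpU hp ⟨a, haU, hga, ha⟩
        have hpa : p ≠ a := by rintro rfl; rw [hg.diag] at hga; omega
        have hga' := hg.symm p a
        refine ih _ ?_ (link τ p a) (link_involutive hτ hp ha) ?_ ?_ rfl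
        · rw [← hm]
          refine Finset.card_lt_card ⟨fun v hv => ?_, fun hcon => ?_⟩
          · simp only [Finset.mem_filter, link] at hv ⊢
            grind
          · have := hcon (Finset.mem_filter.2 ⟨hpU, hp⟩)
            simp only [link] at this
            grind
        · intro v hv
          have := hfix v hv
          unfold link
          grind
        · intro v
          have := hadj v
          unfold link
          grind
      by_cases hp1 : ∃ a ∈ U, 0 < g p a ∧ τ a = a
      · exact one p hpU hp hp1
      by_cases hq1 : ∃ a ∈ U, 0 < g q a ∧ τ a = a
      · exact one q hqU hq hq1
      push Not at hp1 hq1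
      obtain ⟨a, haU, hpa, hqa⟩ : ∃ a ∈ U, 0 < g p a ∧ 0 < g q (τ a) := by
        by_contra! hcon
        have hd : Disjoint ({v ∈ U | 0 < g p v} : Finset V)
            (({v ∈ U | 0 < g q v} : Finset V).image τ) := by
          rw [Finset.disjoint_left]
          intro a ha hb
          obtain ⟨b, hb', rfl⟩ := Finset.mem_image.1 hb
          have h1 := hcon _ (Finset.mem_filter.1 ha).1 (Finset.mem_filter.1 ha).2
          rw [hτ b] at h1
          have := (Finset.mem_filter.1 hb').2
          omega
        have h3 := hdeg p hpU
        have h4 := hdeg q hqU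
        have h5 := Finset.card_union_of_disjoint hd
        rw [Finset.card_image_of_injective _ hτ.injective] at h5
        have h6 : ({v ∈ U | 0 < g p v} : Finset V) ∪ (({v ∈ U | 0 < g q v} : Finset V).image τ) ⊆
            {v ∈ U | τ v ≠ v} := by
          intro v hv
          rw [← hmoved, Finset.mem_filter]
          refine ⟨mem_univ v, ?_⟩
          rcases Finset.mem_union.1 hv with h | h
          · exact hp1 v (Finset.mem_filter.1 h).1 (Finset.mem_filter.1 h).2
          · obtain ⟨b, hb, rfl⟩ := Finset.mem_image.1 h
            rw [hτ b]
            exact (hq1 b (Finset.mem_filter.1 hb).1 (Finset.mem_filter.1 hb).2).symm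
        have h7 := Finset.card_le_card h6
        simp only [ne_eq] at h7
        omega
      have ha := hp1 a haU hpa
      have hra := hτ a
      have hga := hg.symm p a
      have hgq := hg.symm q (τ a)
      have hpa' : p ≠ a := by rintro rfl; exact ha hp
      have hqa' : q ≠ a := by rintro rfl; exact ha hq
      have hpb : p ≠ τ a := by rintro rfl; rw [hτ a] at hp; exact ha hp.symm
      have hqb : q ≠ τ a := by rintro rfl; rw [hτ a] at hq; exact ha hq.symm
      have i1 := unlink_involutive hτ a
      have i2 : Involutive (link (unlink τ a) p a) := by
        refine link_involutive i1 ?_ ?_ <;> unfold unlink <;> grind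
      have i3 : Involutive (link (link (unlink τ a) p a) q (τ a)) := by
        refine link_involutive i2 ?_ ?_ <;> unfold link unlink <;> grind
      refine ih _ ?_ _ i3 ?_ ?_ rfl
      · rw [← hm]
        refine Finset.card_lt_card ⟨fun v hv => ?_, fun hcon => ?_⟩
        · simp only [Finset.mem_filter, link, unlink] at hv ⊢
          grind
        · have := hcon (Finset.mem_filter.2 ⟨hpU, hp⟩)
          simp only [link, unlink] at this
          grind
      · intro v hv
        have := hfix v hv
        have := hfix (τ a)
        have h1 : τ a ∈ U := by
          by_contra h1
          have := hfix (τ a) h1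
          grind
        unfold link unlink
        grind
      · intro v
        have := hadj v
        have h1 : τ v = τ a → v = a := fun h => hτ.injective h
        unfold link unlink
        grind

/-- A version of Dirac's theorem with one vertex `y` of smaller degree. -/
theorem exists_matching_of_neighbor {g : V → V → ℕ} (hg : IsSimple g) {U : Finset V} (hU : Even #U)
    {y u : V} (hy : y ∈ U) (hu : u ∈ U) (hyu : 0 < g y u)
    (hdeg : ∀ v ∈ U, v ≠ y → #U + 2 ≤ 2 * #{q ∈ U | 0 < g v q}) :
    ∃ σ : V → V, Involutive σ ∧ (∀ v, v ∉ U → σ v = v) ∧ ∀ v ∈ U, 0 < g v (σ v) := by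
  have hne : y ≠ u := by rintro rfl; rw [hg.diag] at hyu; omega
  have hyu' := hg.symm y u
  have hc1 := Finset.card_erase_add_one hy
  have hc2 := Finset.card_erase_add_one (Finset.mem_erase.2 ⟨hne.symm, hu⟩)
  obtain ⟨σ, h1, h2, h3⟩ := exists_matching hg (U := (U.erase y).erase u)
    (by obtain ⟨r, hr⟩ := hU; exact ⟨r - 1, by omega⟩) (fun v hv => by
      have h1 := hdeg v (Finset.mem_of_mem_erase (Finset.mem_of_mem_erase hv))
        (Finset.ne_of_mem_erase (Finset.mem_of_mem_erase hv))
      have h2 : ({q ∈ U | 0 < g v q} : Finset V) ⊆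
          ({q ∈ (U.erase y).erase u | 0 < g v q} : Finset V) ∪ {y, u} := by
        intro q hq
        simp only [Finset.mem_filter, Finset.mem_union, Finset.mem_erase, Finset.mem_insert,
          Finset.mem_singleton] at hq ⊢
        tauto
      have h3 := (Finset.card_le_card h2).trans (Finset.card_union_le _ _)
      have h4 := Finset.card_le_two (a := y) (b := u)
      omega)
  have fy : σ y = y := h2 y (by simp)
  have fu : σ u = u := h2 u (by simp)
  refine ⟨link σ y u, link_involutive h1 fy fu, fun v hv => ?_, fun v hv => ?_⟩
  · have := h2 v (by simp [hv])
    unfold link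
    grind
  · have := h3 v
    simp only [Finset.mem_erase] at this
    unfold link
    grind

/-- `g` is contained in a multigraph on one more vertex which splits into `d` perfect
matchings. -/
def Extendable (g : V → V → ℕ) (d : ℕ) : Prop :=
  ∃ w : Option V → Option V → ℕ, Factorable w d ∧ ∀ u v, g u v ≤ w (some u) (some v)

/-- Delete the matching encoded by `σ`. -/
def remove (g : V → V → ℕ) (σ : V → V) (u v : V) : ℕ := if σ u = v then 0 else g u v

theorem IsSimple.remove {g : V → V → ℕ} (hg : IsSimple g) {σ : V → V} (hσ : Involutive σ) :
    IsSimple (remove g σ) := by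
  refine ⟨fun p q => ?_, fun p => ?_, fun p q => ?_⟩
  · have := hg.symm p q
    have := hσ p
    have := hσ q
    unfold Overfull.remove
    grind
  · simp [Overfull.remove, hg.diag]
  · have := hg.le_one p q
    unfold Overfull.remove
    split_ifs <;> omega

theorem sum_remove (g : V → V → ℕ) (σ : V → V) (u : V) :
    ∑ v, remove g σ u v + g u (σ u) = ∑ v, g u v := by
  have : g u (σ u) = ∑ v, if σ u = v then g u v else 0 := by simp
  rw [this, ← Finset.sum_add_distrib]
  refine Finset.sum_congr rfl fun v _ => ?_
  unfold remove
  split_ifs <;> simp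

theorem Extendable.of_remove {g : V → V → ℕ} (hg : IsSimple g) {σ : V → V} (hσ : Involutive σ)
    (hV : Even (Fintype.card V + 1)) {d : ℕ} (h : Extendable (Overfull.remove g σ) d) :
    Extendable g (d + 1) := by
  obtain ⟨w, hw, hle⟩ := h
  have hσ' : Involutive (Option.map σ) := by
    rintro (_ | v)
    · rfl
    · simp [hσ v]
  obtain ⟨τ, h1, h2, h3⟩ := exists_fixedPointFree (by rwa [Fintype.card_option]) hσ'
  refine ⟨_, hw.add h1 h2, fun u v => ?_⟩
  have h4 := hle u v
  unfold Overfull.remove at h4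
  by_cases huv : σ u = v
  · by_cases h5 : u = v
    · subst h5; rw [hg.diag]; exact Nat.zero_le _
    · have h6 := h3 (some u) (by simp only [Option.map_some, ne_eq, Option.some.injEq, huv]
                                 exact fun h => h5 h.symm)
      have h7 := hg.le_one u v
      rw [Option.map_some, huv] at h6
      simp only [ind, h6, if_true]
      omega
  · rw [if_neg huv] at h4
    omega

end Matchings

section Base

variable {V : Type} [DecidableEq V] [Fintype V]

/-- Add an isolated vertex. -/
def addIsolated (g : V → V → ℕ) : Option V → Option V → ℕ
  | some u, some v => g u v
  | _, _ => 0

/-- Excess multiplicity at a vertex of `F` other than the new one. -/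
theorem sum_excess_le {g : V → V → ℕ} (hg : IsSimple g) {F : Option V → Option V → ℕ}
    {f : Option V → ℕ} (hF : Realizes F f) (v : V) :
    ∑ q, (if q = none then 0 else (addIsolated g (some v) q + F (some v) q) - 1) + F (some v) none ≤
      f (some v) := by
  rw [← hF.sum, Fintype.sum_option, Fintype.sum_option]
  simp only [if_true, zero_add, addIsolated, reduceCtorEq, if_false]
  rw [add_comm]
  refine Nat.add_le_add_left (Finset.sum_le_sum fun q _ => ?_) _
  have := hg.le_one v q
  omega

theorem extendable_of_realizes {ε ρ : ℝ} {C n d : ℕ} {Q : ℕ}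
    (H : ∀ (W : Type) [Fintype W] [DecidableEq W] (w : W → W → ℕ)
    (Z : Finset W) (x : W) (d : ℕ), Fintype.card W = 2 * n → x ∈ Z → #Z ≤ Q + 1 →
    (∀ p q, w p q = w q p) → (∀ p, w p p = 0) → (∀ p, ∑ q, w p q = d) → d ≤ 2 * n →
    (∀ v, v ∉ Z → (1 + ε) * n ≤ #{u | u ≠ x ∧ 0 < w v u}) →
    (∀ v, v ∈ Z → v ≠ x → (n : ℝ) / 2 ≤ #{u | u ≠ x ∧ 0 < w v u}) →
    (∀ v, v ≠ x → (w x v : ℝ) ≤ d / 2 - ε * n) →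
    (∀ v, v ≠ x → ((∑ q, (if q = x then 0 else w v q - C) : ℕ) : ℝ) ≤ ρ * n) →
    Factorable w d) {g : V → V → ℕ} (hg : IsSimple g) {f : V → ℕ}
    (hf : ∀ v, ∑ u, g v u + f v = d) {Z : Finset V} (hV : Fintype.card V + 1 = 2 * n) (hZ : #Z ≤ Q)
    (hd : d ≤ 2 * n) (hdeg : ∀ v, v ∉ Z → (1 + ε) * n ≤ (∑ u, g v u : ℕ))
    (hdegZ : ∀ v, v ∈ Z → (n : ℝ) / 2 ≤ (∑ u, g v u : ℕ))
    (hx : ∀ v, (f v : ℝ) ≤ d / 2 - ε * n) {F : Option V → Option V → ℕ}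
    (hF : Realizes F (fun o => o.elim d f))
    (hex : ∀ v, ((∑ q, (if q = none then 0 else (addIsolated g (some v) q + F (some v) q) - C) : ℕ)
      : ℝ) ≤ ρ * n) : Extendable g d := by
  refine ⟨fun p q => addIsolated g p q + F p q, ?_, fun u v => Nat.le_add_right _ _⟩
  have hcard : ∀ v, ∑ u, g v u ≤ #{u : Option V | u ≠ none ∧ 0 < addIsolated g (some v) u +
      F (some v) u} := by
    intro v
    rw [Finset.card_filter, Fintype.sum_option]
    simp only [addIsolated, ne_eq, not_true_eq_false, false_and, if_false, zero_add, reduceCtorEq,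
      not_false_eq_true, true_and]
    refine Finset.sum_le_sum fun u _ => ?_
    have := hg.le_one v u
    split_ifs <;> omega
  refine H (Option V) _ (insert none (Z.map Embedding.some)) none d ?_ ?_ ?_ ?_ ?_ ?_ hd ?_ ?_ ?_ ?_
  · rw [Fintype.card_option, hV]
  · simp
  · refine (Finset.card_insert_le _ _).trans ?_
    rw [Finset.card_map]
    omega
  · rintro (_ | p) (_ | q)
    · rfl
    · simp only [addIsolated, hF.symm none]
    · simp only [addIsolated, hF.symm none]
    · simp only [addIsolated, hF.symm (some p), hg.symm p]
  · rintro (_ | p) <;> simp [addIsolated, hF.diag, hg.diag]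
  · rintro (_ | p)
    · rw [Finset.sum_add_distrib, hF.sum]
      simp [addIsolated]
    · rw [Finset.sum_add_distrib, hF.sum, Fintype.sum_option]
      simpa [addIsolated] using hf p
  · rintro (_ | v) hv
    · simp at hv
    · have hv' : v ∉ Z := by simpa using hv
      exact (hdeg v hv').trans (by exact_mod_cast hcard v)
  · rintro (_ | v) hv hvx
    · exact absurd rfl hvx
    · have hv' : v ∈ Z := by simpa using hv
      exact (hdegZ v hv').trans (by exact_mod_cast hcard v)
  · rintro (_ | v) hv
    · exact absurd rfl hv
    · refine le_trans (Nat.cast_le.2 ?_) (hx v)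
      have h1 := hF.sum (some v)
      simp only [Option.elim] at h1
      have h2 := Finset.single_le_sum (f := fun q => F (some v) q) (fun _ _ => Nat.zero_le _)
        (mem_univ none)
      simp only [addIsolated, zero_add]
      rw [hF.symm]
      omega
  · rintro (_ | v) hv
    · exact absurd rfl hv
    · exact hex v

/-- The base case: `g` is extendable when the deficits `f` are all small, or their sum is close to
`d`, or their sum is quadratic. -/
theorem extendable_base {ε : ℝ} (hε : 0 < ε) (hε1 : ε < 1) (Q : ℕ) : ∃ ρ : ℝ, 0 < ρ ∧
    ∀ η : ℝ, 0 < η → ∃ n₀ : ℕ, ∀ n ≥ n₀, ∀ (V : Type) [Fintype V] [DecidableEq V] (g : V → V → ℕ)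
    (d : ℕ) (f : V → ℕ) (Z : Finset V) (T : ℕ), Fintype.card V + 1 = 2 * n → IsSimple g →
    (∀ v, ∑ u, g v u + f v = d) → T + d = ∑ v, f v → #Z ≤ Q → d ≤ 2 * n →
    (∀ v, v ∉ Z → (1 + ε) * n ≤ (∑ u, g v u : ℕ)) →
    (∀ v, v ∈ Z → (n : ℝ) / 2 ≤ (∑ u, g v u : ℕ)) →
    (∀ v, (f v : ℝ) ≤ d / 2 - ε * n) →
    ((∀ v, (f v : ℝ) ≤ ρ * n) ∨ (T : ℝ) ≤ ρ * n ∨ η * n ^ 2 ≤ T) → Extendable g d := by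
  obtain ⟨ρ, hρ, H⟩ := factorable_of_regular hε hε1 (Q + 1)
  refine ⟨ρ, hρ, fun η hη => ?_⟩
  obtain ⟨n₁, H1⟩ := H 1
  obtain ⟨C, hC⟩ : ∃ C : ℕ, 5 / η ≤ C ∧ 0 < C := ⟨⌈5 / η⌉₊ + 1, by
    have := Nat.le_ceil (5 / η)
    push_cast
    linarith, by omega⟩
  obtain ⟨n₂, H2⟩ := H (C + 1)
  refine ⟨max (max n₁ n₂) (4 * C + 1), fun n hn V _ _ g d f Z T hV hg hf hT hZ hd hdeg hdegZ hx
    hcase => ?_⟩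
  have hn1 : n₁ ≤ n := (le_max_left _ _).trans ((le_max_left _ _).trans hn)
  have hn2 : n₂ ≤ n := (le_max_right _ _).trans ((le_max_left _ _).trans hn)
  have hn3 : 4 * C + 1 ≤ n := (le_max_right _ _).trans hn
  set f' : Option V → ℕ := fun o => o.elim d f with hf'
  have hsum : ∑ p, f' p = T + 2 * d := by
    rw [Fintype.sum_option]
    simp only [hf', Option.elim]
    omega
  have heven : Even (∑ p, f' p) := by
    have h1 := even_sum_sum hg.symm hg.diag
    have h2 : ∑ v, (∑ u, g v u + f v) = Fintype.card V * d := by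
      rw [Finset.sum_congr rfl fun v _ => hf v, Finset.sum_const, smul_eq_mul, Finset.card_univ]
    rw [Finset.sum_add_distrib] at h2
    have h3 : ∑ p, f' p + ∑ v, ∑ u, g v u = 2 * (n * d) := by
      have : 2 * (n * d) = Fintype.card V * d + d := by rw [← mul_assoc, ← hV]; ring
      omega
    obtain ⟨r, hr⟩ := h1
    exact ⟨n * d - r, by omega⟩
  have hfd : ∀ p, 2 * f' p ≤ ∑ p, f' p := by
    rw [hsum]
    rintro (_ | v)
    · simp only [hf', Option.elim]; omega
    · have := hf v
      simp only [hf', Option.elim]; omega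
  by_cases hbig : η * n ^ 2 ≤ T
  · have hm : ∀ p, p ≠ none → f' p ≤ n := by
      rintro (_ | v) hp
      · exact absurd rfl hp
      · have h1 := hx v
        have h2 : (d : ℝ) ≤ 2 * n := by exact_mod_cast hd
        have h3 : 0 ≤ ε * n := by positivity
        have : (f v : ℝ) ≤ n := by linarith
        exact_mod_cast this
    obtain ⟨F, hF, hFC⟩ := exists_realizes_le f' heven hfd (x := none) (C := C) (m := n) (T := T) hm
      (by rw [hsum]; rfl) hC.2 (by
        have h1 := hC.1
        rw [div_le_iff₀ hη] at h1
        have h2 : (4 * C + 1 : ℝ) ≤ n := by exact_mod_cast hn3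
        have h3 : (5 : ℝ) * n ^ 2 ≤ C * T := calc
          (5 : ℝ) * n ^ 2 ≤ C * η * n ^ 2 := by gcongr
          _ = C * (η * n ^ 2) := by ring
          _ ≤ C * T := by gcongr
        have h0 : (0 : ℝ) ≤ C := Nat.cast_nonneg _
        have : ((4 * n + 4 * C) * n : ℝ) < C * T := by nlinarith
        exact_mod_cast this)
    refine extendable_of_realizes (fun W _ _ => H2 n hn2 W) hg hf hV (by omega) hd hdeg hdegZ hx hF
      (fun v => ?_)
    rw [Finset.sum_eq_zero]
    · simp only [Nat.cast_zero]; positivity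
    · rintro (_ | q) -
      · rfl
      · have h1 := hFC (some v) (some q) (by simp) (by simp)
        have h2 := hg.le_one v q
        simp only [addIsolated, reduceCtorEq, if_false]
        omega
  · obtain ⟨F, hF⟩ := exists_realizes f' heven hfd
    refine extendable_of_realizes (fun W _ _ => H1 n hn1 W) hg hf hV (by omega) hd hdeg hdegZ hx hF
      (fun v => ?_)
    have h1 := sum_excess_le hg hF v
    rcases hcase with h2 | h2 | h2
    · refine le_trans (Nat.cast_le.2 ?_) (h2 v)
      simp only [hf', Option.elim] at h1
      omega
    · refine le_trans (Nat.cast_le.2 ?_) h2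
      have h3 : ∀ u, F (some u) none ≤ f u := by
        intro u
        have h4 := hF.sum (some u)
        simp only [hf', Option.elim] at h4
        exact h4 ▸ Finset.single_le_sum (f := fun q => F (some u) q) (fun _ _ => Nat.zero_le _)
          (mem_univ none)
      have h5 : ∑ u, F (some u) none = d := by
        have h6 := hF.sum none
        rw [Fintype.sum_option, hF.diag, zero_add] at h6
        rw [Finset.sum_congr rfl fun u _ => hF.symm (some u) none, h6]
        rfl
      have h6 : ∑ u, (f u - F (some u) none) + ∑ u, F (some u) none = ∑ u, f u := by
        rw [← Finset.sum_add_distrib]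
        exact Finset.sum_congr rfl fun u _ => Nat.sub_add_cancel (h3 u)
      have h7 := Finset.single_le_sum (f := fun u => f u - F (some u) none)
        (fun _ _ => Nat.zero_le _) (mem_univ v)
      simp only [hf', Option.elim] at h1
      have h8 := h3 v
      omega
    · exact absurd h2 hbig

end Base

section Reduction

/-- Removing a matching that covers exactly the complement of `R`. -/
theorem reduce_step {V : Type} [DecidableEq V] [Fintype V] {g : V → V → ℕ} {d T : ℕ} {f : V → ℕ}
    {R : Finset V} {σ : V → V} (hV : Even (Fintype.card V + 1)) (hg : IsSimple g)
    (hf : ∀ v, ∑ u, g v u + f v = d) (hT : T + d = ∑ v, f v) (hR : #R ≤ T + 1) (hd : 0 < d)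
    (hfR : ∀ v ∈ R, 0 < f v) (hσ : Involutive σ) (hfix : ∀ v ∈ R, σ v = v)
    (hadj : ∀ v, v ∉ R → 0 < g v (σ v)) :
    IsSimple (remove g σ) ∧
      (∀ v, ∑ u, remove g σ v u + (f v - if v ∈ R then 1 else 0) = d - 1) ∧
      T + 1 - #R + (d - 1) = ∑ v, (f v - if v ∈ R then 1 else 0) ∧
      (Extendable (remove g σ) (d - 1) → Extendable g d) := by
  refine ⟨hg.remove hσ, fun v => ?_, ?_, fun h => ?_⟩
  · have h1 := sum_remove g σ v
    have h2 := hf v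
    by_cases hv : v ∈ R
    · have h3 := hfR v hv
      rw [hfix v hv, hg.diag] at h1
      rw [if_pos hv]
      omega
    · have h3 := hadj v hv
      have h4 := hg.le_one v (σ v)
      rw [if_neg hv]
      omega
  · have h1 : ∑ v, (f v - if v ∈ R then 1 else 0) + #R = ∑ v, f v := by
      have : #R = ∑ v, if v ∈ R then 1 else 0 := by simp
      rw [this, ← Finset.sum_add_distrib]
      refine Finset.sum_congr rfl fun v _ => ?_
      split_ifs with h
      · have := hfR v h; omega
      · rfl
    omega
  · have := h.of_remove hg hσ hV
    rwa [Nat.sub_add_cancel hd] at this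

theorem card_adj_compl {V : Type} [DecidableEq V] [Fintype V] {g : V → V → ℕ} (hg : IsSimple g)
    (R : Finset V) (v : V) : ∑ u, g v u ≤ #{u ∈ Rᶜ | 0 < g v u} + #R := by
  have h1 : ∑ u, g v u ≤ #{u | 0 < g v u} := by
    rw [Finset.card_filter]
    refine Finset.sum_le_sum fun u _ => ?_
    have := hg.le_one v u
    split_ifs <;> omega
  refine h1.trans (le_trans (Finset.card_le_card fun u hu => ?_) (Finset.card_union_le _ _))
  simp only [Finset.mem_union, Finset.mem_filter, Finset.mem_compl, mem_univ, true_and] at hu ⊢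
  tauto

/-- The assertion of `extendable_base` for given parameters. -/
def Base (ε ρ η : ℝ) (Q n : ℕ) : Prop :=
  ∀ (V : Type) [Fintype V] [DecidableEq V] (g : V → V → ℕ)
    (d : ℕ) (f : V → ℕ) (Z : Finset V) (T : ℕ), Fintype.card V + 1 = 2 * n → IsSimple g →
    (∀ v, ∑ u, g v u + f v = d) → T + d = ∑ v, f v → #Z ≤ Q → d ≤ 2 * n →
    (∀ v, v ∉ Z → (1 + ε) * n ≤ (∑ u, g v u : ℕ)) →
    (∀ v, v ∈ Z → (n : ℝ) / 2 ≤ (∑ u, g v u : ℕ)) →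
    (∀ v, (f v : ℝ) ≤ d / 2 - ε * n) →
    ((∀ v, (f v : ℝ) ≤ ρ * n) ∨ (T : ℝ) ≤ ρ * n ∨ η * n ^ 2 ≤ T) → Extendable g d

/-- The case in which all deficits are concentrated, and nearly equal, on a small even set `S`. -/
theorem extendable_of_concentrated {ε ρ η : ℝ} {Q n : ℕ} (hε : 0 < ε) (hε4 : ε ≤ 1 / 4)
    (hQ : 8 / ε ≤ Q) (hρε : ρ ≤ ε / 8) (hn : 100 / ε ≤ n) (hB : Base (ε / 2) ρ η Q n)
    {V : Type} [Fintype V] [DecidableEq V] (hV : Fintype.card V + 1 = 2 * n) (S : Finset V)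
    (hS : Even #S) (hS4 : 4 ≤ #S) (hSρ : (#S : ℝ) ≤ ρ * n) (d : ℕ) (g : V → V → ℕ) (f : V → ℕ)
    (T : ℕ) (hg : IsSimple g) (hf : ∀ v, ∑ u, g v u + f v = d) (hT : T + d = ∑ v, f v)
    (hd : d ≤ 2 * n) (hf0 : ∀ v, v ∉ S → f v = 0) (hlevel : ∀ u ∈ S, ∀ v ∈ S, f u ≤ f v + 1)
    (hinv : ((#S : ℝ) - 2) * ((1 + ε) * n) + T ≤ (#S - 2) * d) : Extendable g d := by
  have hεn : 100 ≤ ε * n := by rwa [div_le_iff₀ hε, mul_comm] at hn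
  have hn0 : (400 : ℝ) ≤ n := by nlinarith
  have hSn : (#S : ℝ) ≤ ε * n / 8 := by nlinarith
  have hQ' : 8 ≤ ε * Q := by rwa [div_le_iff₀ hε, mul_comm] at hQ
  have hq4 : (4 : ℝ) ≤ #S := by exact_mod_cast hS4
  obtain ⟨q, hq⟩ : ∃ q : ℝ, q = #S := ⟨_, rfl⟩
  obtain ⟨x, hx⟩ : ∃ x : ℝ, x = n := ⟨_, rfl⟩
  induction d using Nat.strong_induction_on generalizing g f T with
  | _ d ih =>
    rw [← hq] at hinv hq4 hSn
    rw [← hx] at hinv hn0 hSn hεn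
    have hd' : (d : ℝ) ≤ 2 * x := by rw [hx]; exact_mod_cast hd
    have hT0 : (0 : ℝ) ≤ T := Nat.cast_nonneg _
    have hdx : (1 + ε) * x ≤ d := by
      by_contra! hcon
      nlinarith only [hcon, hinv, hT0, hq4]
    have hsumS : ∑ v ∈ S, f v = ∑ v, f v :=
      Finset.sum_subset (Finset.subset_univ _) fun v _ hv => hf0 v hv
    have hfS : ∀ v ∈ S, q * f v ≤ T + d + q := by
      intro v hv
      have h1 : #S • f v ≤ ∑ u ∈ S, (f u + 1) :=
        Finset.card_nsmul_le_sum _ _ _ fun u hu => hlevel v hv u hu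
      rw [Finset.sum_add_distrib, hsumS, ← hT, smul_eq_mul, Finset.sum_const, smul_eq_mul,
        mul_one] at h1
      rw [hq]
      exact_mod_cast h1
    have hfR : ∀ v, ((∑ u, g v u : ℕ) : ℝ) + f v = d := fun v => by exact_mod_cast hf v
    have hdegS : ∀ v ∈ S, (q - 1) * ((1 + ε) * x) - q ≤ q * (∑ u, g v u : ℕ) := by
      intro v hv
      have h1 := hfS v hv
      have h2 := hfR v
      have h3 : q * ((∑ u, g v u : ℕ) : ℝ) + q * f v = q * d := by rw [← h2]; ring
      nlinarith only [h1, h3, hinv, hdx]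
    have hdegS' : ∀ v ∈ S, x / 2 ≤ (∑ u, g v u : ℕ) := by
      intro v hv
      have h1 := hdegS v hv
      by_contra! hcon
      have h2 : q * (∑ u, g v u : ℕ) ≤ q * (x / 2) :=
        mul_le_mul_of_nonneg_left hcon.le (by linarith)
      have h3 : (q - 1) * x ≤ (q - 1) * ((1 + ε) * x) :=
        mul_le_mul_of_nonneg_left (by linarith) (by linarith)
      nlinarith only [h1, h2, h3, hq4, hn0]
    have hdegS0 : ∀ v, v ∉ S → ∑ u, g v u = d := by
      intro v hv
      have h1 := hf v
      rw [hf0 v hv] at h1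
      omega
    by_cases hTq : T + 2 < #S
    · have hTq' : (T : ℝ) + 2 < q := by rw [hq]; exact_mod_cast hTq
      have hfd : ∀ v, (f v : ℝ) ≤ d / 2 - ε / 2 * n := by
        intro v
        rw [← hx]
        by_cases hv : v ∈ S
        · have h1 := hfS v hv
          by_contra! hcon
          have h2 : (d : ℝ) / 4 + 2 ≤ d / 2 - ε / 2 * x := by nlinarith only [hdx, hn0, hε4]
          have h3 : q * (d / 4 + 2) ≤ q * f v :=
            mul_le_mul_of_nonneg_left (by linarith) (by linarith)
          have h4 : 0 ≤ (q - 4) * d := mul_nonneg (by linarith) (Nat.cast_nonneg _)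
          nlinarith only [h1, h3, h4, hTq', hq4]
        · rw [hf0 v hv, Nat.cast_zero]
          nlinarith only [hdx, hn0, hε4, hεn]
      by_cases hqQ : #S ≤ Q
      · refine hB V g d f S T hV hg hf hT hqQ hd (fun v hv => ?_) (fun v hv => ?_) hfd
          (Or.inr (Or.inl ?_))
        · rw [hdegS0 v hv, ← hx]
          nlinarith only [hdx, hεn]
        · rw [← hx]; exact hdegS' v hv
        · rw [← hq] at hSρ; linarith
      · have hqQ' : (Q : ℝ) ≤ q := by rw [hq]; exact_mod_cast (not_le.1 hqQ).le
        refine hB V g d f ∅ T hV hg hf hT (by simp) hd (fun v _ => ?_) (fun v hv => ?_) hfd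
          (Or.inr (Or.inl ?_))
        · rw [← hx]
          by_cases hv : v ∈ S
          · have h1 := hdegS v hv
            by_contra! hcon
            have h2 : q * (∑ u, g v u : ℕ) ≤ q * ((1 + ε / 2) * x) :=
              mul_le_mul_of_nonneg_left hcon.le (by linarith)
            have h3 : 8 ≤ ε * q := hQ'.trans (mul_le_mul_of_nonneg_left hqQ' hε.le)
            have h4 : 8 * x ≤ ε * q * x := mul_le_mul_of_nonneg_right h3 (by linarith)
            have h5 : 100 * q ≤ ε * x * q := mul_le_mul_of_nonneg_right hεn (by linarith)
            nlinarith only [h1, h2, h4, h5, hε4, hn0, hq4]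
          · rw [hdegS0 v hv]
            nlinarith only [hdx, hεn]
        · simp at hv
        · rw [← hq] at hSρ; linarith
    · have hne : S.Nonempty := Finset.card_pos.1 (by omega)
      obtain ⟨y, hy, hmin⟩ := Finset.exists_min_image S f hne
      have hcR := Finset.card_erase_add_one hy
      have hcU : #(S.erase y)ᶜ + #(S.erase y) = Fintype.card V := by
        rw [add_comm]; exact Finset.card_add_card_compl _
      have hSn' : #S ≤ n := by
        have : (#S : ℝ) ≤ n := by rw [← hq, ← hx]; nlinarith only [hSn, hε4, hn0]
        exact_mod_cast this
      have hdpos : #S < d := by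
        have : (#S : ℝ) < d := by rw [← hq]; nlinarith only [hSn, hε4, hn0, hdx, hεn]
        exact_mod_cast this
      have hyU : y ∈ (S.erase y)ᶜ := by simp
      obtain ⟨u, huU, hyu⟩ : ∃ u ∈ (S.erase y)ᶜ, 0 < g y u := by
        have h1 := card_adj_compl hg (S.erase y) y
        have h2 := hdegS' y hy
        have h3 : (#S : ℝ) < (∑ u, g y u : ℕ) := by
          rw [← hq]; nlinarith only [h2, hSn, hε4, hn0]
        have h4 : #S < ∑ u, g y u := by exact_mod_cast h3
        have h5 : 0 < #{u ∈ (S.erase y)ᶜ | 0 < g y u} := by omega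
        obtain ⟨u, hu⟩ := Finset.card_pos.1 h5
        exact ⟨u, (Finset.mem_filter.1 hu).1, (Finset.mem_filter.1 hu).2⟩
      obtain ⟨σ, h1, h2, h3⟩ := exists_matching_of_neighbor hg (U := (S.erase y)ᶜ)
        (by obtain ⟨r, hr⟩ := hS; exact ⟨n - r, by omega⟩) hyU huU hyu (fun v hv hvy => by
          have hvS : v ∉ S := by
            simp only [Finset.mem_compl, Finset.mem_erase, not_and] at hv
            exact hv hvy
          have h1 := card_adj_compl hg (S.erase y) v
          rw [hdegS0 v hvS] at h1
          have h2 : 2 * n + #S ≤ 2 * d := by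
            have : (2 : ℝ) * n + #S ≤ 2 * d := by
              rw [← hq, ← hx]; nlinarith only [hdx, hSn, hεn]
            exact_mod_cast this
          omega)
      obtain ⟨k1, k2, k3, k4⟩ := reduce_step (R := S.erase y) (T := T) (f := f) (d := d) (σ := σ)
        ⟨n, by omega⟩ hg hf hT (by omega) (by omega) (fun v hv => by
          have hvS := Finset.mem_of_mem_erase hv
          by_contra hcon
          have h4 : ∑ u ∈ S, f u ≤ #S • 1 :=
            Finset.sum_le_card_nsmul _ _ _ fun u hu => by have := hlevel u hu v hvS; omega
          rw [hsumS, smul_eq_mul] at h4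
          omega) h1 (fun v hv => h2 v (by rwa [Finset.mem_compl, not_not]))
        (fun v hv => h3 v (Finset.mem_compl.2 hv))
      refine k4 (ih (d - 1) (by omega) (remove g σ) _ (T + 1 - #(S.erase y)) k1 k2 k3 (by omega)
        (fun v hv => ?_) (fun u hu v hv => ?_) ?_ )
      · simp [hf0 v hv]
      · have e1 := hlevel u hu v hv
        have e2 := hlevel u hu y hy
        have e3 := hmin v hv
        have e4 : u = y → f u = f y := fun h => by rw [h]
        have e5 : v = y → f v = f y := fun h => by rw [h]
        simp only [Finset.mem_erase, hu, hv, and_true, ne_eq]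
        by_cases huy : u = y <;> by_cases hvy : v = y <;>
          simp only [huy, hvy, not_true_eq_false, not_false_eq_true, if_true, if_false] <;>
          simp only [huy, hvy, forall_true_left, forall_false] at e4 e5 <;> omega
      · have e1 : ((T + 1 - #(S.erase y) : ℕ) : ℝ) = T + 2 - q := by
          rw [show T + 1 - #(S.erase y) = T + 2 - #S by omega, Nat.cast_sub (by omega), hq]
          push_cast
          ring
        have e2 : ((d - 1 : ℕ) : ℝ) = d - 1 := by
          rw [Nat.cast_sub (by omega)]; simp
        rw [e1, e2, ← hq, ← hx]
        linarith only [hinv]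

/-- A graph of large minimum degree which is not overfull is extendable. -/
theorem extendable_of_minDegree {ε : ℝ} (hε : 0 < ε) (hε4 : ε ≤ 1 / 4) : ∃ n₀ : ℕ, ∀ n ≥ n₀,
    ∀ (V : Type) [Fintype V] [DecidableEq V] (d : ℕ) (g : V → V → ℕ) (f : V → ℕ) (T : ℕ),
    Fintype.card V + 1 = 2 * n → IsSimple g → (∀ v, ∑ u, g v u + f v = d) → T + d = ∑ v, f v →
    d ≤ 2 * n → (∀ v, (1 + ε) * n ≤ (∑ u, g v u : ℕ)) → Extendable g d := by
  obtain ⟨Q, hQ⟩ := exists_nat_ge (8 / ε)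
  obtain ⟨ρ₀, hρ₀, H⟩ := extendable_base (half_pos hε) (by linarith) Q
  obtain ⟨ρ, hρ⟩ : ∃ ρ, ρ = min ρ₀ (ε / 8) := ⟨_, rfl⟩
  have hρ1 : ρ ≤ ρ₀ := hρ ▸ min_le_left _ _
  have hρε : ρ ≤ ε / 8 := hρ ▸ min_le_right _ _
  have hρ0 : 0 < ρ := hρ ▸ lt_min hρ₀ (by linarith)
  obtain ⟨n₁, H1⟩ := H (ρ ^ 2 / 2) (by positivity)
  obtain ⟨n₂, hn₂⟩ := exists_nat_ge (100 / ε + 100 / ρ ^ 2)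
  refine ⟨max n₁ n₂, fun n hn => ?_⟩
  have hn2 : 100 / ε + 100 / ρ ^ 2 ≤ n :=
    hn₂.trans (Nat.cast_le.2 ((le_max_right _ _).trans hn))
  have hnε : 100 / ε ≤ n := by
    have : 0 ≤ 100 / ρ ^ 2 := by positivity
    linarith
  have hnρ : 100 ≤ ρ ^ 2 * n := by
    have h1 : 0 ≤ 100 / ε := by positivity
    have : 100 / ρ ^ 2 ≤ n := by linarith
    rwa [div_le_iff₀ (by positivity), mul_comm] at this
  have hB : Base (ε / 2) ρ (ρ ^ 2 / 2) Q n := by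
    intro V _ _ g d f Z T a1 a2 a3 a4 a5 a6 a7 a8 a9 a10
    refine H1 n ((le_max_left _ _).trans hn) V g d f Z T a1 a2 a3 a4 a5 a6 a7 a8 a9 ?_
    have : ρ * n ≤ ρ₀ * n := mul_le_mul_of_nonneg_right hρ1 (Nat.cast_nonneg _)
    rcases a10 with h | h | h
    · exact Or.inl fun v => (h v).trans this
    · exact Or.inr (Or.inl (h.trans this))
    · exact Or.inr (Or.inr h)
  intro V _ _ d
  have hεn : 100 ≤ ε * n := by rwa [div_le_iff₀ hε, mul_comm] at hnε
  have hρn : ρ * n ≤ ε * n / 8 := by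
    have := mul_le_mul_of_nonneg_right hρε (Nat.cast_nonneg (α := ℝ) n)
    linarith
  have hρn1 : 100 ≤ ρ * n := by
    have h1 : ρ ^ 2 * n ≤ ρ * n := by
      refine mul_le_mul_of_nonneg_right ?_ (Nat.cast_nonneg _)
      nlinarith only [hρ0, hρε, hε4]
    linarith
  induction d using Nat.strong_induction_on with
  | _ d ih =>
    intro g f T hV hg hf hT hd hdeg
    have hd' : (d : ℝ) ≤ 2 * n := by exact_mod_cast hd
    have hfR : ∀ v, ((∑ u, g v u : ℕ) : ℝ) + f v = d := fun v => by exact_mod_cast hf v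
    have hfd : ∀ v, (f v : ℝ) ≤ d / 2 - ε * n := by
      intro v
      linarith [hfR v, hdeg v]
    by_cases hcase : (∀ v, (f v : ℝ) ≤ ρ * n) ∨ (T : ℝ) ≤ ρ * n ∨ ρ ^ 2 / 2 * n ^ 2 ≤ T
    · exact hB V g d f ∅ T hV hg hf hT (by simp) hd (fun v _ => by linarith [hdeg v])
        (fun v hv => by simp at hv) (fun v => by linarith [hfd v]) hcase
    push Not at hcase
    obtain ⟨⟨v₁, hv₁⟩, hTρ, hTη⟩ := hcase
    obtain ⟨v₂, -, hmax⟩ := Finset.exists_max_image univ f ⟨v₁, mem_univ v₁⟩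
    have hM : ρ * n < f v₂ := hv₁.trans_le (Nat.cast_le.2 (hmax v₁ (mem_univ v₁)))
    have hM0 : 0 < f v₂ := by
      have : (0 : ℝ) < f v₂ := by linarith
      exact_mod_cast this
    set S : Finset V := {v | f v = f v₂} with hSdef
    have hv₂S : v₂ ∈ S := by simp [hSdef]
    have hSsum : ∑ v ∈ S, f v = #S * f v₂ := by
      rw [Finset.sum_congr rfl fun v hv => (Finset.mem_filter.1 hv).2, Finset.sum_const,
        smul_eq_mul]
    have hSρ : (#S : ℝ) + 1 ≤ ρ * n := by
      by_contra! hcon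
      have h1 : #S * f v₂ ≤ T + d := by
        rw [← hSsum, hT]; exact Finset.sum_le_univ_sum_of_nonneg fun _ => Nat.zero_le _
      have h2 : (#S : ℝ) * f v₂ ≤ T + d := by exact_mod_cast h1
      have h3 : (ρ * n - 1) * (ρ * n) ≤ #S * f v₂ :=
        mul_le_mul (by linarith) hM.le (by linarith) (Nat.cast_nonneg _)
      have h4 : 100 * (n : ℝ) ≤ ρ ^ 2 * n * n := mul_le_mul_of_nonneg_right hnρ (Nat.cast_nonneg _)
      have h5 : 100 * (ρ * n) ≤ (ρ * n) * (ρ * n) := mul_le_mul_of_nonneg_right hρn1 (by linarith)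
      nlinarith only [h2, h3, h4, h5, hTη, hd', hρn1]
    by_cases hR : ∃ R : Finset V, S ⊆ R ∧ Odd #R ∧ #R ≤ #S + 1 ∧ ∀ v ∈ R, 0 < f v
    · obtain ⟨R, hSR, hRodd, hRc, hRf⟩ := hR
      have hRρ : (#R : ℝ) ≤ ρ * n := by
        have : (#R : ℝ) ≤ #S + 1 := by exact_mod_cast hRc
        linarith
      have hcU : #R + #Rᶜ = Fintype.card V := Finset.card_add_card_compl _
      obtain ⟨σ, h1, h2, h3⟩ := exists_matching hg (U := Rᶜ)
        (by obtain ⟨r, hr⟩ := hRodd; exact ⟨n - 1 - r, by omega⟩) (fun v _ => by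
          have h1 := card_adj_compl hg R v
          have h2 : 2 * n + #R ≤ 2 * ∑ u, g v u := by
            have : (2 : ℝ) * n + #R ≤ 2 * (∑ u, g v u : ℕ) := by linarith [hdeg v]
            exact_mod_cast this
          omega)
      have hRT : #R ≤ T := by
        have : (#R : ℝ) ≤ T := by linarith
        exact_mod_cast this
      have hd0 : 0 < d := by have := hf v₂; omega
      obtain ⟨k1, k2, k3, k4⟩ := reduce_step (R := R) (T := T) (f := f) (d := d) (σ := σ)
        ⟨n, by omega⟩ hg hf hT (by omega) hd0 hRf h1 (fun v hv => h2 v (by simpa using hv))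
        (fun v hv => h3 v (by simpa using hv))
      refine k4 (ih (d - 1) (by omega) _ _ _ hV k1 k2 k3 (by omega) fun v => ?_)
      by_cases hv : v ∈ R
      · refine (hdeg v).trans (Nat.cast_le.2 ?_)
        have e1 := k2 v
        have e2 := hf v
        have e3 := hRf v hv
        rw [if_pos hv] at e1
        omega
      · refine (hdeg v₂).trans (Nat.cast_le.2 ?_)
        have e1 := k2 v
        have e2 := hf v
        have e3 := hf v₂
        have e4 : f v ≠ f v₂ := fun h => hv (hSR (by simp [hSdef, h]))
        have e5 := hmax v (mem_univ v)
        rw [if_neg hv] at e1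
        omega
    · push Not at hR
      have hSf : ∀ v ∈ S, 0 < f v := fun v hv => (Finset.mem_filter.1 hv).2 ▸ hM0
      have hSe : Even #S := by
        by_contra hcon
        obtain ⟨v, hv, h0⟩ := hR S (Finset.Subset.refl _) (Nat.not_even_iff_odd.1 hcon) (by omega)
        have := hSf v hv
        omega
      have hf0 : ∀ v, v ∉ S → f v = 0 := by
        intro v hv
        by_contra hcon
        obtain ⟨u, hu, h0⟩ := hR (insert v S) (Finset.subset_insert _ _)
          (by rw [Finset.card_insert_of_notMem hv]; exact hSe.add_one)
          (by rw [Finset.card_insert_of_notMem hv])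
        rcases Finset.mem_insert.1 hu with rfl | hu
        · omega
        · have := hSf u hu
          omega
      have hTS : T + d = #S * f v₂ := by
        rw [hT, ← hSsum]
        exact (Finset.sum_subset (Finset.subset_univ _) fun v _ hv => hf0 v hv).symm
      have hS4 : 4 ≤ #S := by
        have h1 : 0 < #S := Finset.card_pos.2 ⟨v₂, hv₂S⟩
        have h2 : #S ≠ 2 := by
          intro h2
          rw [h2] at hTS
          have h3 : (T : ℝ) + d = 2 * f v₂ := by exact_mod_cast hTS
          have h4 := hfd v₂
          have h5 : (0 : ℝ) ≤ T := Nat.cast_nonneg _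
          linarith
        obtain ⟨r, hr⟩ := hSe
        omega
      refine extendable_of_concentrated hε hε4 hQ hρε hnε hB hV S hSe hS4 (by linarith) d g f T hg
        hf hT hd hf0 (fun u hu v hv => ?_) ?_
      · rw [(Finset.mem_filter.1 hu).2, (Finset.mem_filter.1 hv).2]
        exact Nat.le_succ _
      · have h1 : (T : ℝ) + d = #S * f v₂ := by exact_mod_cast hTS
        have h2 : (#S : ℝ) * f v₂ ≤ #S * (d - (1 + ε) * n) :=
          mul_le_mul_of_nonneg_left (by linarith [hfR v₂, hdeg v₂]) (Nat.cast_nonneg _)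
        linarith only [h1, h2, hd', hεn]

end Reduction

section Graph

variable {V : Type} [Fintype V] [DecidableEq V] (G : SimpleGraph V) [DecidableRel G.Adj]

theorem maxDegree_le_of_isProperEdgeColoring [Nonempty V] {k : ℕ} {c : Sym2 V → Fin k}
    (hc : G.IsProperEdgeColoring c) : G.maxDegree ≤ k := by
  obtain ⟨v, hv⟩ := G.exists_maximal_degree_vertex
  rw [hv, ← G.card_incidenceFinset_eq_degree v]
  have h := Finset.card_le_card_of_injOn (s := G.incidenceFinset v) (t := Finset.univ) c
    (fun _ _ => Finset.mem_coe.2 (Finset.mem_univ _)) ?_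
  · simpa using h
  · intro e₁ h₁ e₂ h₂ h
    have h₁' := (G.mem_incidenceFinset v e₁).1 h₁
    have h₂' := (G.mem_incidenceFinset v e₂).1 h₂
    by_contra hne
    exact hc e₁ h₁'.1 e₂ h₂'.1 hne ⟨v, h₁'.2, h₂'.2⟩ h

theorem card_edgeFinset_le_of_isProperEdgeColoring {k n : ℕ} (hn : Fintype.card V + 1 = 2 * n)
    {c : Sym2 V → Fin k} (hc : G.IsProperEdgeColoring c) :
    #G.edgeFinset ≤ k * (n - 1) := by
  have key (i : Fin k) : #{e ∈ G.edgeFinset | c e = i} ≤ n - 1 := by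
    have h : #({e ∈ G.edgeFinset | c e = i}.biUnion Sym2.toFinset) =
        ∑ e ∈ G.edgeFinset with c e = i, #e.toFinset := by
      refine Finset.card_biUnion fun e₁ h₁ e₂ h₂ hne => ?_
      rw [Finset.mem_coe, Finset.mem_filter, SimpleGraph.mem_edgeFinset] at h₁ h₂
      refine Finset.disjoint_left.2 fun v hv₁ hv₂ => ?_
      rw [Sym2.mem_toFinset] at hv₁ hv₂
      exact hc e₁ h₁.1 e₂ h₂.1 hne ⟨v, hv₁, hv₂⟩ (h₁.2.trans h₂.2.symm)
    have h2 : ∑ e ∈ G.edgeFinset with c e = i, #e.toFinset =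
        #{e ∈ G.edgeFinset | c e = i} * 2 := by
      rw [Finset.sum_const_nat fun e he => ?_]
      rw [Finset.mem_filter, SimpleGraph.mem_edgeFinset] at he
      exact Sym2.card_toFinset_of_not_isDiag e (G.not_isDiag_of_mem_edgeSet he.1)
    have h3 := Finset.card_le_univ ({e ∈ G.edgeFinset | c e = i}.biUnion Sym2.toFinset)
    omega
  have h := Finset.card_eq_sum_card_fiberwise (s := G.edgeFinset) (t := Finset.univ) (f := c)
    fun _ _ => Finset.mem_coe.2 (Finset.mem_univ _)
  rw [h]
  exact (Finset.sum_le_card_nsmul _ _ _ fun i _ => key i).trans (by simp)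

theorem exists_isProperEdgeColoring_of_extendable {k : ℕ} (hk : 0 < k)
    (h : Extendable (fun u v => if G.Adj u v then 1 else 0) k) :
    ∃ c : Sym2 V → Fin k, G.IsProperEdgeColoring c := by
  obtain ⟨w, hw, hgw⟩ := h
  obtain ⟨M, hM, -, hcnt⟩ := hw.exists_family
  have key (e : Sym2 V) : ∃ i, e ∈ G.edgeSet →
      ∀ u v, e = s(u, v) → M i (some u) = some v := by
    by_cases he : e ∈ G.edgeSet
    · induction e with
      | _ a b =>
        rw [SimpleGraph.mem_edgeSet] at he
        have h1 : (if G.Adj a b then 1 else 0) ≤ w (some a) (some b) := hgw a b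
        rw [if_pos he, hcnt, cnt_eq_card] at h1
        obtain ⟨i, hi⟩ := Finset.card_pos.1 h1
        have hi' := (Finset.mem_filter.1 hi).2
        refine ⟨i, fun _ u v huv => ?_⟩
        rcases Sym2.eq_iff.1 huv with ⟨rfl, rfl⟩ | ⟨rfl, rfl⟩
        · exact hi'
        · rw [← hi', hM i]
    · exact ⟨⟨0, hk⟩, fun h => absurd h he⟩
  choose c hc using key
  refine ⟨c, fun e₁ h₁ e₂ h₂ hne ⟨v, hv₁, hv₂⟩ h => hne ?_⟩
  obtain ⟨a, rfl⟩ := hv₁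
  obtain ⟨b, rfl⟩ := hv₂
  have e1 := hc _ h₁ v a rfl
  rw [h, hc _ h₂ v b rfl, Option.some_inj] at e1
  rw [e1]

theorem isSimple_adj : IsSimple fun u v : V => if G.Adj u v then 1 else 0 where
  symm u v := by simp only [G.adj_comm]
  diag u := by simp
  le_one u v := by split_ifs <;> simp

end Graph

end Overfull

/-- For every `0 < ε < 1` there exists `n₀` such that every simple graph `G` on
`2n − 1 ≥ n₀` vertices with `δ(G) ≥ (1+ε)n` satisfies `χ'(G) = Δ(G)` if and only if
`G` is not overfull, i.e. `|E(G)| ≤ Δ(G)(n−1)`. -/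
theorem overfull_conjecture_odd_order :
    ∀ ε : ℝ, 0 < ε → ε < 1 →
      ∃ n₀ : ℕ, 0 < n₀ ∧
        ∀ (V : Type) [Fintype V] [DecidableEq V] (G : SimpleGraph V) [DecidableRel G.Adj]
          (n : ℕ),
          Fintype.card V + 1 = 2 * n → n₀ ≤ Fintype.card V →
          (1 + ε) * n ≤ (G.minDegree : ℝ) →
          (G.chromaticIndex = G.maxDegree ↔ G.edgeFinset.card ≤ G.maxDegree * (n - 1)) := by
  intro ε hε _
  obtain ⟨n₀, H⟩ := Overfull.extendable_of_minDegree (ε := min ε (1 / 4)) (lt_min hε (by norm_num))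
    (min_le_right _ _)
  refine ⟨2 * n₀ + 1, by omega, fun V _ _ G _ n hn hn₀ hδ => ?_⟩
  have hV : Nonempty V := Fintype.card_pos_iff.1 (by omega)
  have hΔ : 0 < G.maxDegree := by
    have h1 : (1 : ℝ) ≤ n := by exact_mod_cast (by omega : 1 ≤ n)
    have h2 : (0 : ℝ) < G.minDegree := lt_of_lt_of_le (by positivity) hδ
    have h3 : 0 < G.minDegree := by exact_mod_cast h2
    exact h3.trans_le G.minDegree_le_maxDegree
  constructor
  · intro h
    have hne : {k | ∃ c : Sym2 V → Fin k, G.IsProperEdgeColoring c}.Nonempty :=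
      Nat.nonempty_of_pos_sInf (hΔ.trans_eq h.symm)
    obtain ⟨c, hc⟩ : ∃ c : Sym2 V → Fin G.chromaticIndex, G.IsProperEdgeColoring c :=
      Nat.sInf_mem hne
    rw [← h]
    exact Overfull.card_edgeFinset_le_of_isProperEdgeColoring G hn hc
  · intro h
    have hdeg (v : V) : ∑ u, (if G.Adj v u then 1 else 0) = G.degree v := by
      rw [← Finset.card_filter, ← G.card_neighborFinset_eq_degree, G.neighborFinset_eq_filter]
    have hΔv := G.maxDegree_lt_card_verts
    have hsum : ∑ v, (G.maxDegree - G.degree v) + 2 * G.edgeFinset.card =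
        Fintype.card V * G.maxDegree := by
      rw [← G.sum_degrees_eq_twice_card_edges, ← Finset.sum_add_distrib,
        Finset.sum_congr rfl fun v _ => Nat.sub_add_cancel (G.degree_le_maxDegree v)]
      simp
    have hle : G.maxDegree ≤ ∑ v, (G.maxDegree - G.degree v) := by
      obtain ⟨m, rfl⟩ : ∃ m, n = m + 1 := ⟨n - 1, by omega⟩
      rw [show Fintype.card V = 2 * m + 1 by omega] at hsum
      rw [Nat.add_sub_cancel] at h
      nlinarith only [hsum, h]
    obtain ⟨c, hc⟩ := Overfull.exists_isProperEdgeColoring_of_extendable G hΔ <|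
      H n (by omega) V G.maxDegree _ (fun v => G.maxDegree - G.degree v)
        (∑ v, (G.maxDegree - G.degree v) - G.maxDegree) hn (Overfull.isSimple_adj G)
        (fun v => by
          have := G.degree_le_maxDegree v
          rw [hdeg]
          omega)
        (Nat.sub_add_cancel hle) (by omega)
        fun v => by
          rw [hdeg]
          calc (1 + min ε (1 / 4)) * (n : ℝ) ≤ (1 + ε) * n := by
                gcongr
                exact min_le_left _ _
            _ ≤ G.minDegree := hδ
            _ ≤ G.degree v := Nat.cast_le.2 (G.minDegree_le_degree v)
    refine le_antisymm (Nat.sInf_le ⟨c, hc⟩) ?_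
    obtain ⟨c', hc'⟩ : ∃ c : Sym2 V → Fin G.chromaticIndex, G.IsProperEdgeColoring c :=
      Nat.sInf_mem (s := {k | ∃ c : Sym2 V → Fin k, G.IsProperEdgeColoring c}) ⟨_, c, hc⟩
    exact Overfull.maxDegree_le_of_isProperEdgeColoring G hc'
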